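/- Let C ⊂ 𝕋² be a smooth curve with nowhere-vanishing curvature. There exist constants c > 0 and λ₀ > 0, depending only on C, such that for every λ ≥ λ₀ and every nonzero real-valued eigenfunction F of the Laplacian on 𝕋² with eigenvalue λ², the number of nodal intersections satisfies N_{F,C} ≥ c·λ/B_λ^{5/2}. -/

import Mathlib

open MeasureTheory Real

noncomputable section

/-- The Euclidean norm of a vector in `ℝ × ℝ`. -/
def e2 (x : ℝ × ℝ) : ℝ := Real.sqrt (x.1 ^ 2 + x.2 ^ 2)

/-- The integer vector `μ` viewed as a vector in `ℝ × ℝ`. -/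
def iv (μ : ℤ × ℤ) : ℝ × ℝ := ((μ.1 : ℝ), (μ.2 : ℝ))

/-- The set of lattice points on the circle of radius `lam`. -/
def Elat (lam : ℝ) : Finset (ℤ × ℤ) := by
  classical
  exact (Finset.Icc (-⌈lam⌉, -⌈lam⌉) (⌈lam⌉, ⌈lam⌉)).filter
    (fun μ => (μ.1 : ℝ) ^ 2 + (μ.2 : ℝ) ^ 2 = lam ^ 2)

/-- `B_lam`: the maximal number of lattice points on the circle of radius `lam`
lying in an arc of length `√lam`. -/
def Bmax (lam : ℝ) : ℕ := by
  classical
  exact sSup {n : ℕ | ∃ x : ℝ × ℝ, e2 x = lam ∧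
    n = ((Elat lam).filter fun ξ => e2 (iv ξ - x) ≤ Real.sqrt lam).card}

/-- The eigenfunction `F(x) = ∑_{μ ∈ E_lam} a_μ e^{i⟨μ,x⟩}` of the Laplacian on the torus
`ℝ²/(2πℤ²)` with eigenvalue `lam²`. -/
def efn (lam : ℝ) (a : ℤ × ℤ → ℂ) (x : ℝ × ℝ) : ℂ :=
  ∑ μ ∈ Elat lam, a μ *
    Complex.exp (Complex.I * Complex.ofReal ((μ.1 : ℝ) * x.1 + (μ.2 : ℝ) * x.2))

/-- The `L²` norm of `F` over the torus, realized as the square `[0,2π]²`. -/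
def l2T (F : ℝ × ℝ → ℂ) : ℝ :=
  Real.sqrt (∫ x in (Set.Icc (0:ℝ) (2 * π)) ×ˢ (Set.Icc (0:ℝ) (2 * π)), ‖F x‖ ^ 2)

theorem Nat.exists_succ_pow_le_mul_two_pow (s : ℕ) : ∃ C : ℕ, 1 ≤ C ∧ ∀ k : ℕ, (k + 1) ^ s ≤ C * 2 ^ k := by
  have h : Filter.Tendsto (fun k : ℕ => (k : ℝ) ^ s / 2 ^ k) Filter.atTop (nhds 0) :=
    tendsto_pow_const_div_const_pow_of_one_lt s (by norm_num)
  obtain ⟨B, hB⟩ := h.bddAbove_range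
  obtain ⟨C, hC⟩ := exists_nat_ge (2 * B)
  refine ⟨C + 1, by omega, fun k => ?_⟩
  have h1 : ((k + 1 : ℕ) : ℝ) ^ s / 2 ^ (k + 1) ≤ B := hB ⟨k + 1, rfl⟩
  rw [div_le_iff₀ (by positivity)] at h1
  have h2 : (((k + 1) ^ s : ℕ) : ℝ) ≤ (((C + 1) * 2 ^ k : ℕ) : ℝ) := by
    push_cast at h1 ⊢
    rw [pow_succ] at h1
    have : (0:ℝ) < 2 ^ k := by positivity
    nlinarith
  exact_mod_cast h2

/-- The Gaussian integers of norm `n`. -/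
def gaussianSphere (n : ℕ) : Set GaussianInt := {z | z.norm = n}

theorem finite_gaussianSphere (n : ℕ) : (gaussianSphere n).Finite := by
  have h : (gaussianSphere n) ⊆ (fun p : ℤ × ℤ => (⟨p.1, p.2⟩ : GaussianInt)) ''
      (Set.Icc (-(n:ℤ)) n ×ˢ Set.Icc (-(n:ℤ)) n) := by
    intro z hz
    have hz' : z.re * z.re + z.im * z.im = n := by
      have : z.norm = n := hz
      rw [Zsqrtd.norm_def] at this
      linarith
    refine ⟨(z.re, z.im), ⟨⟨?_, ?_⟩, ⟨?_, ?_⟩⟩, rfl⟩ <;> simp only <;> nlinarith [mul_self_nonneg z.re, mul_self_nonneg z.im]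
  exact Set.Finite.subset (Set.Finite.image _ ((Set.finite_Icc _ _).prod (Set.finite_Icc _ _))) h

theorem gaussianInt_exists_factor {p : ℕ} (hp : p.Prime) {ϖ : GaussianInt} (hq : Prime ϖ)
    (hdvd : ϖ ∣ (p : GaussianInt)) (k : ℕ) :
    ∀ (m : ℕ) (z : GaussianInt), ¬ p ∣ m → z.norm = ((p ^ k * m : ℕ) : ℤ) →
      ∃ j l : ℕ, ∃ w : GaussianInt, j ≤ k ∧ z = ϖ ^ j * star ϖ ^ l * w ∧ w.norm = m := by
  have hN : ϖ.norm.natAbs = p ∨ ϖ.norm.natAbs = p ^ 2 := by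
    have h1 : ϖ.norm.natAbs ∣ p ^ 2 := by
      obtain ⟨c, hc⟩ := hdvd
      have := congrArg (fun x : GaussianInt => x.norm.natAbs) hc
      simp only [Zsqrtd.norm_mul, Zsqrtd.norm_natCast, Int.natAbs_mul, Int.natAbs_natCast] at this
      exact ⟨_, by rw [sq, this]⟩
    rcases (Nat.dvd_prime_pow hp).1 h1 with ⟨i, hi, h⟩
    interval_cases i
    · exact absurd (Zsqrtd.norm_eq_one_iff.1 (by simpa using h)) hq.not_isUnit
    · left; simpa using h
    · right; exact h
  have hN' : ∃ e : ℕ, 1 ≤ e ∧ ϖ.norm = ((p ^ e : ℕ) : ℤ) := by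
    have h0 := GaussianInt.norm_nonneg ϖ
    rcases hN with h | h
    · exact ⟨1, le_rfl, by rw [pow_one]; omega⟩
    · exact ⟨2, by norm_num, by rw [← h]; omega⟩
  obtain ⟨e, he, hpe⟩ := hN'
  induction k using Nat.strong_induction_on with
  | _ k ih =>
    intro m z hm hz
    rcases Nat.eq_zero_or_pos k with rfl | hk
    · exact ⟨0, 0, z, le_rfl, by simp, by simpa using hz⟩
    have hd : ϖ ∣ z * star z := by
      have : ((z.norm : ℤ) : GaussianInt) = z * star z := Zsqrtd.norm_eq_mul_conj z
      rw [← this, hz]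
      refine hdvd.trans ?_
      refine ⟨((p ^ (k - 1) * m : ℕ) : GaussianInt), ?_⟩
      have : p ^ k * m = p * (p ^ (k - 1) * m) := by
        rw [← mul_assoc, ← pow_succ', Nat.sub_add_cancel hk]
      rw [this]; push_cast; ring
    have key : ∀ ρ z1 : GaussianInt, ρ.norm = ϖ.norm → z = ρ * z1 → e ≤ k ∧
        z1.norm = ((p ^ (k - e) * m : ℕ) : ℤ) := by
      intro ρ z1 hρ hz1
      have h1 : ((p ^ e : ℕ) : ℤ) * z1.norm = ((p ^ k * m : ℕ) : ℤ) := by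
        rw [← hz, hz1, Zsqrtd.norm_mul, hρ, hpe]
      have hek : e ≤ k := by
        by_contra hlt
        have h2 : ((p ^ e : ℕ) : ℤ) ∣ ((p ^ k * m : ℕ) : ℤ) := ⟨_, h1.symm⟩
        have h3 : p ^ e ∣ p ^ k * m := by exact_mod_cast h2
        have h4 : p ^ k * p ∣ p ^ k * m :=
          (by rw [← pow_succ]; exact pow_dvd_pow p (by omega) : p ^ k * p ∣ p ^ e).trans h3
        exact hm (Nat.dvd_of_mul_dvd_mul_left (pow_pos hp.pos k) h4)
      refine ⟨hek, ?_⟩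
      have h5 : p ^ k * m = p ^ e * (p ^ (k - e) * m) := by
        rw [← mul_assoc, ← pow_add]; congr 2; omega
      rw [h5] at h1
      push_cast at h1 ⊢
      have h6 : ((p : ℤ) ^ e) ≠ 0 := pow_ne_zero _ (by exact_mod_cast hp.ne_zero)
      exact mul_left_cancel₀ h6 h1
    rcases hq.dvd_or_dvd hd with ⟨z1, hz1⟩ | ⟨y, hy⟩
    · obtain ⟨hek, hn⟩ := key ϖ z1 rfl hz1
      obtain ⟨j, l, w, hj, hzw, hw⟩ := ih (k - e) (by omega) m z1 hm hn
      exact ⟨j + 1, l, w, by omega, by rw [hz1, hzw]; ring, hw⟩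
    · have hz1 : z = star ϖ * star y := by
        have := congrArg star hy
        rwa [star_star, star_mul, mul_comm] at this
      obtain ⟨hek, hn⟩ := key (star ϖ) (star y) (Zsqrtd.norm_conj ϖ) hz1
      obtain ⟨j, l, w, hj, hzw, hw⟩ := ih (k - e) (by omega) m (star y) hm hn
      exact ⟨j, l + 1, w, by omega, by rw [hz1, hzw]; ring, hw⟩

theorem ncard_gaussianSphere_pow_mul {p : ℕ} (hp : p.Prime) (k m : ℕ) (hm : ¬ p ∣ m) :
    (gaussianSphere (p ^ k * m)).ncard ≤ (k + 1) * (gaussianSphere m).ncard := by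
  obtain ⟨ϖ, hirr, hdvd⟩ := WfDvdMonoid.exists_irreducible_factor (a := (p : GaussianInt))
    (fun hu => by
      have := Zsqrtd.norm_eq_one_iff.2 hu
      rw [Zsqrtd.norm_natCast, Int.natAbs_mul] at this
      simp only [Int.natAbs_natCast] at this
      exact hp.one_lt.ne' (Nat.eq_one_of_mul_eq_one_right this))
    (by exact_mod_cast hp.ne_zero)
  have hq : Prime ϖ := hirr.prime
  have hm0 : m ≠ 0 := by rintro rfl; exact hm (dvd_zero _)
  have hfac := gaussianInt_exists_factor hp hq hdvd k m
  have hex : ∀ z ∈ gaussianSphere (p ^ k * m), ∃ j l : ℕ, ∃ w : GaussianInt, j ≤ k ∧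
      z = ϖ ^ j * star ϖ ^ l * w ∧ w.norm = m := fun z hz => hfac z hm hz
  choose! j l w hj hz hw using hex
  have hfin : ((Set.Iic k) ×ˢ gaussianSphere m).Finite :=
    (Set.finite_Iic k).prod (finite_gaussianSphere m)
  have hle : (gaussianSphere (p ^ k * m)).ncard ≤ ((Set.Iic k) ×ˢ gaussianSphere m).ncard := by
    refine Set.ncard_le_ncard_of_injOn (fun z => (j z, w z)) (fun z h => ⟨hj z h, hw z h⟩) ?_ hfin
    intro z hzz z' hzz' heq
    simp only [Prod.mk.injEq] at heq
    have hn : ϖ.norm ^ l z = ϖ.norm ^ l z' := by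
      have h1 := congrArg Zsqrtd.norm (hz z hzz)
      have h2 := congrArg Zsqrtd.norm (hz z' hzz')
      have hpow : ∀ (x : GaussianInt) (n : ℕ), (x ^ n).norm = x.norm ^ n := fun x n =>
        map_pow Zsqrtd.normMonoidHom x n
      rw [Zsqrtd.norm_mul, Zsqrtd.norm_mul, hpow, hpow, Zsqrtd.norm_conj, hw z hzz,
        show z.norm = _ from hzz] at h1
      rw [Zsqrtd.norm_mul, Zsqrtd.norm_mul, hpow, hpow, Zsqrtd.norm_conj, hw z' hzz',
        show z'.norm = _ from hzz', ← heq.1] at h2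
      have hm' : (m : ℤ) ≠ 0 := by exact_mod_cast hm0
      have h3 := mul_right_cancel₀ hm' (h1.symm.trans h2)
      have hqn : ϖ.norm ^ j z ≠ 0 := pow_ne_zero _ (by
        rw [Ne, GaussianInt.norm_eq_zero]; exact hq.ne_zero)
      exact mul_left_cancel₀ hqn h3
    have hl : l z = l z' := by
      have h2 : 2 ≤ ϖ.norm := by
        have h0 := GaussianInt.norm_pos.2 hq.ne_zero
        have h1 : ϖ.norm ≠ 1 := fun h => hq.not_isUnit (Zsqrtd.norm_eq_one_iff.1 (by rw [h]; rfl))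
        omega
      exact Int.pow_right_injective (a := ϖ.norm) (by omega) hn
    rw [hz z hzz, hz z' hzz', heq.1, heq.2, hl]
  refine hle.trans ?_
  rw [Set.ncard_prod]
  simp [Set.ncard_eq_toFinset_card']

theorem exists_ncard_gaussianSphere_pow_le (s : ℕ) : ∃ C : ℕ, ∀ n : ℕ, 0 < n →
    (gaussianSphere n).ncard ^ s ≤ C * n := by
  obtain ⟨C, hC1, hC⟩ := Nat.exists_succ_pow_le_mul_two_pow s
  let c : ℕ → ℕ := fun p => if p < 2 ^ s then C else 1
  have hc1 : ∀ p, 1 ≤ c p := fun p => by simp only [c]; split_ifs <;> omega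
  have hstep : ∀ p k : ℕ, p.Prime → (k + 1) ^ s ≤ c p * p ^ k := by
    intro p k hp
    by_cases h : p < 2 ^ s
    · simp only [c, if_pos h]
      exact (hC k).trans (Nat.mul_le_mul_left _ (Nat.pow_le_pow_left hp.two_le k))
    · simp only [c, if_neg h, one_mul]
      push Not at h
      calc (k + 1) ^ s ≤ (2 ^ k) ^ s := Nat.pow_le_pow_left Nat.lt_two_pow_self s
        _ = (2 ^ s) ^ k := by rw [← pow_mul, ← pow_mul, mul_comm]
        _ ≤ p ^ k := Nat.pow_le_pow_left h k
  have main : ∀ n : ℕ, 0 < n → (gaussianSphere n).ncard ^ s ≤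
      (gaussianSphere 1).ncard ^ s * (∏ p ∈ n.primeFactors, c p) * n := by
    intro n
    induction n using Nat.strong_induction_on with
    | _ n ih =>
      intro hn
      rcases eq_or_ne n 1 with rfl | h1
      · simp
      have hp := Nat.minFac_prime h1
      set p := n.minFac
      obtain ⟨k, m, hm, hnk⟩ := Nat.exists_eq_pow_mul_and_not_dvd hn.ne' p hp.ne_one
      have hk : k ≠ 0 := by
        rintro rfl
        rw [pow_zero, one_mul] at hnk
        exact hm (hnk ▸ n.minFac_dvd)
      have hm0 : 0 < m := Nat.pos_of_ne_zero (by rintro rfl; exact hm (dvd_zero _))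
      have hmn : m < n := by
        rw [hnk]
        have : 1 < p ^ k := Nat.one_lt_pow hk hp.one_lt
        nlinarith
      have hpf : n.primeFactors = insert p m.primeFactors := by
        rw [hnk, Nat.primeFactors_mul (pow_ne_zero _ hp.ne_zero) hm0.ne',
          Nat.primeFactors_prime_pow hk hp, Finset.insert_eq]
      have hpm : p ∉ m.primeFactors := fun h => hm (Nat.dvd_of_mem_primeFactors h)
      rw [hpf, Finset.prod_insert hpm]
      have hb := ncard_gaussianSphere_pow_mul hp k m hm
      rw [← hnk] at hb
      calc (gaussianSphere n).ncard ^ s ≤ ((k + 1) * (gaussianSphere m).ncard) ^ s :=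
            Nat.pow_le_pow_left hb s
        _ = (k + 1) ^ s * (gaussianSphere m).ncard ^ s := mul_pow _ _ _
        _ ≤ (c p * p ^ k) * ((gaussianSphere 1).ncard ^ s * (∏ p ∈ m.primeFactors, c p) * m) :=
            Nat.mul_le_mul (hstep p k hp) (ih m hmn hm0)
        _ = (gaussianSphere 1).ncard ^ s * (c p * ∏ p ∈ m.primeFactors, c p) * n := by
            conv_rhs => rw [hnk]
            ring
  refine ⟨(gaussianSphere 1).ncard ^ s * C ^ (2 ^ s), fun n hn => (main n hn).trans ?_⟩
  refine Nat.mul_le_mul_right _ (Nat.mul_le_mul_left _ ?_)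
  calc ∏ p ∈ n.primeFactors, c p = ∏ p ∈ n.primeFactors with p < 2 ^ s, C := by
        rw [Finset.prod_filter]
    _ = C ^ (n.primeFactors.filter (· < 2 ^ s)).card := Finset.prod_const _
    _ ≤ C ^ (2 ^ s) := by
        refine Nat.pow_le_pow_right hC1 ?_
        calc _ ≤ (Finset.range (2 ^ s)).card := Finset.card_le_card (fun x hx => by
              simp only [Finset.mem_filter] at hx; exact Finset.mem_range.2 hx.2)
          _ = 2 ^ s := Finset.card_range _

theorem mem_Elat {lam : ℝ} (hl : 0 ≤ lam) (μ : ℤ × ℤ) :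
    μ ∈ Elat lam ↔ (μ.1 : ℝ) ^ 2 + (μ.2 : ℝ) ^ 2 = lam ^ 2 := by
  unfold Elat
  rw [Finset.mem_filter, and_iff_right_iff_imp]
  intro h
  have h1 : |(μ.1 : ℝ)| ≤ lam := abs_le_of_sq_le_sq (by nlinarith [sq_nonneg (μ.2 : ℝ)]) hl
  have h2 : |(μ.2 : ℝ)| ≤ lam := abs_le_of_sq_le_sq (by nlinarith [sq_nonneg (μ.1 : ℝ)]) hl
  have hc := Int.le_ceil lam
  have h1' := abs_le.1 (h1.trans hc)
  have h2' := abs_le.1 (h2.trans hc)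
  rw [Finset.mem_Icc]
  refine ⟨⟨?_, ?_⟩, ⟨?_, ?_⟩⟩
  · exact_mod_cast h1'.1
  · exact_mod_cast h2'.1
  · exact_mod_cast h1'.2
  · exact_mod_cast h2'.2

/-- The number of lattice points on a circle grows more slowly than any power of its radius. -/
theorem exists_card_Elat_pow_le (s : ℕ) : ∃ C : ℝ, 0 < C ∧ ∀ lam : ℝ, 0 < lam →
    ((Elat lam).card : ℝ) ^ s ≤ C * lam ^ 2 ∨ Elat lam = ∅ := by
  obtain ⟨C, hC⟩ := exists_ncard_gaussianSphere_pow_le s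
  refine ⟨C + 1, by positivity, fun lam hl => ?_⟩
  rcases (Elat lam).eq_empty_or_nonempty with h | ⟨μ, hμ⟩
  · exact Or.inr h
  left
  rw [mem_Elat hl.le] at hμ
  set n : ℕ := (μ.1 ^ 2 + μ.2 ^ 2).toNat with hn
  have hnn : ((n : ℤ)) = μ.1 ^ 2 + μ.2 ^ 2 := Int.toNat_of_nonneg (by positivity)
  have hnl : (n : ℝ) = lam ^ 2 := by rw [← hμ]; exact_mod_cast hnn
  have hn0 : 0 < n := by
    have : (0:ℝ) < n := by rw [hnl]; positivity
    exact_mod_cast this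
  have hcard : (Elat lam).card ≤ (gaussianSphere n).ncard := by
    rw [← Set.ncard_coe_finset]
    refine Set.ncard_le_ncard_of_injOn (fun μ => (⟨μ.1, μ.2⟩ : GaussianInt)) ?_ ?_
      (finite_gaussianSphere n)
    · intro ν hν
      rw [Finset.mem_coe, mem_Elat hl.le, ← hnl] at hν
      have : ν.1 ^ 2 + ν.2 ^ 2 = (n : ℤ) := by exact_mod_cast hν
      change Zsqrtd.norm _ = _
      rw [Zsqrtd.norm_def]
      simp only
      linarith
    · intro a _ b _ hab
      simp only [Zsqrtd.mk.injEq] at hab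
      exact Prod.ext hab.1 hab.2
  rw [← hnl]
  have h1 : ((Elat lam).card) ^ s ≤ C * n := (Nat.pow_le_pow_left hcard s).trans (hC n hn0)
  have h2 : ((Elat lam).card : ℝ) ^ s ≤ C * n := by exact_mod_cast h1
  have : (0:ℝ) < n := by exact_mod_cast hn0
  linarith

/-- The oscillating exponential `e^{iφ}`. -/
def osc (φ : ℝ → ℝ) (t : ℝ) : ℂ := Complex.exp (Complex.I * (φ t : ℂ))

theorem norm_osc (φ : ℝ → ℝ) (t : ℝ) : ‖osc φ t‖ = 1 := by
  rw [osc, mul_comm, Complex.norm_exp_ofReal_mul_I]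

theorem continuous_osc {φ : ℝ → ℝ} (h : Continuous φ) : Continuous (osc φ) := by
  unfold osc; fun_prop

theorem hasDerivAt_osc {φ : ℝ → ℝ} {φ' t : ℝ} (h : HasDerivAt φ φ' t) :
    HasDerivAt (osc φ) (Complex.I * φ' * osc φ t) t := by
  have h1 : HasDerivAt (fun t => Complex.I * (φ t : ℂ)) (Complex.I * (φ' : ℂ)) t :=
    h.ofReal_comp.const_mul _
  convert! h1.cexp using 1
  simp only [osc]
  ring

theorem star_osc (φ : ℝ → ℝ) (t : ℝ) : starRingEnd ℂ (osc φ t) = osc (fun t => -φ t) t := by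
  simp [osc, ← Complex.exp_conj]

theorem norm_integral_osc_le {φ : ℝ → ℝ} {a b : ℝ} (hab : a ≤ b) :
    ‖∫ t in a..b, osc φ t‖ ≤ b - a := by
  have := intervalIntegral.norm_integral_le_of_norm_le_const (f := osc φ) (C := 1) (a := a) (b := b)
    (fun t _ => (norm_osc φ t).le)
  rwa [one_mul, abs_of_nonneg (by linarith)] at this

theorem norm_integral_osc_neg (φ : ℝ → ℝ) (a b : ℝ) :
    ‖∫ t in a..b, osc (fun t => -φ t) t‖ = ‖∫ t in a..b, osc φ t‖ := by
  have : ∫ t in a..b, osc (fun t => -φ t) t = starRingEnd ℂ (∫ t in a..b, osc φ t) := by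
    simp_rw [← star_osc]
    simp only [intervalIntegral, map_sub, integral_conj]
  rw [this, RCLike.norm_conj]

theorem norm_integral_osc_le_of_deriv {φ φ1 φ2 : ℝ → ℝ}
    (h1 : ∀ t, HasDerivAt φ (φ1 t) t) (h2 : ∀ t, HasDerivAt φ1 (φ2 t) t) (hc : Continuous φ2)
    {a b m : ℝ} (hab : a ≤ b) (hm : 0 < m)
    (hd : ∀ t ∈ Set.Icc a b, m ≤ |φ1 t|) :
    ‖∫ t in a..b, osc φ t‖ ≤ 2 / m + ∫ t in a..b, |φ2 t| / φ1 t ^ 2 := by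
  have hcφ : Continuous φ := continuous_iff_continuousAt.2 fun t => (h1 t).continuousAt
  have hcφ1 : Continuous φ1 := continuous_iff_continuousAt.2 fun t => (h2 t).continuousAt
  have hne : ∀ t ∈ Set.uIcc a b, φ1 t ≠ 0 := by
    intro t ht h0
    rw [Set.uIcc_of_le hab] at ht
    have := hd t ht
    rw [h0, abs_zero] at this
    linarith
  let u : ℝ → ℂ := fun t => osc φ t / (Complex.I * (φ1 t : ℂ))
  let w : ℝ → ℂ := fun t => osc φ t * (φ2 t : ℂ) / (Complex.I * (φ1 t : ℂ) ^ 2)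
  have hneC : ∀ t ∈ Set.uIcc a b, (φ1 t : ℂ) ≠ 0 := fun t ht => by exact_mod_cast hne t ht
  have hco := continuous_osc hcφ
  have hu : ∀ t ∈ Set.uIcc a b, HasDerivAt u (osc φ t - w t) t := by
    intro t ht
    have hd1 : HasDerivAt (fun t => Complex.I * (φ1 t : ℂ)) (Complex.I * (φ2 t : ℂ)) t :=
      (h2 t).ofReal_comp.const_mul _
    have hn := hneC t ht
    convert! (hasDerivAt_osc (h1 t)).div hd1 (mul_ne_zero Complex.I_ne_zero hn) using 1
    simp only [w]
    field_simp
  have hwc : ContinuousOn w (Set.uIcc a b) := by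
    apply ContinuousOn.div
    · fun_prop
    · fun_prop
    · intro t ht
      exact mul_ne_zero Complex.I_ne_zero (pow_ne_zero _ (hneC t ht))
  have hwi : IntervalIntegrable w volume a b := hwc.intervalIntegrable
  have hoi : IntervalIntegrable (osc φ) volume a b := hco.intervalIntegrable _ _
  have hftc := intervalIntegral.integral_eq_sub_of_hasDerivAt hu (hoi.sub hwi)
  rw [intervalIntegral.integral_sub hoi hwi] at hftc
  have heq : ∫ t in a..b, osc φ t = u b - u a + ∫ t in a..b, w t := by rw [← hftc]; ring
  have hub : ∀ t ∈ Set.Icc a b, ‖u t‖ ≤ 1 / m := by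
    intro t ht
    simp only [u, norm_div, norm_osc, norm_mul, Complex.norm_I, one_mul, Complex.norm_real,
      Real.norm_eq_abs]
    exact one_div_le_one_div_of_le hm (hd t ht)
  have hw : ‖∫ t in a..b, w t‖ ≤ ∫ t in a..b, |φ2 t| / φ1 t ^ 2 := by
    refine (intervalIntegral.norm_integral_le_integral_norm hab).trans (le_of_eq ?_)
    refine intervalIntegral.integral_congr fun t _ => ?_
    simp [w, norm_osc]
  rw [heq]
  have hA := hub a ⟨le_rfl, hab⟩
  have hB := hub b ⟨hab, le_rfl⟩
  calc _ ≤ ‖u b - u a‖ + ‖∫ t in a..b, w t‖ := norm_add_le _ _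
    _ ≤ (‖u b‖ + ‖u a‖) + ∫ t in a..b, |φ2 t| / φ1 t ^ 2 := add_le_add (norm_sub_le _ _) hw
    _ ≤ _ := by
      have : 2 / m = 1 / m + 1 / m := by ring
      linarith

theorem norm_integral_osc_le_of_deriv_of_bound {φ φ1 φ2 : ℝ → ℝ}
    (h1 : ∀ t, HasDerivAt φ (φ1 t) t) (h2 : ∀ t, HasDerivAt φ1 (φ2 t) t) (hc : Continuous φ2)
    {a b m K : ℝ} (hab : a ≤ b) (hm : 0 < m)
    (hd : ∀ t ∈ Set.Icc a b, m ≤ |φ1 t|) (hK : ∀ t ∈ Set.Icc a b, |φ2 t| ≤ K) :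
    ‖∫ t in a..b, osc φ t‖ ≤ 2 / m + (b - a) * K / m ^ 2 := by
  refine (norm_integral_osc_le_of_deriv h1 h2 hc hab hm hd).trans (add_le_add le_rfl ?_)
  have := intervalIntegral.norm_integral_le_of_norm_le_const (f := fun t => |φ2 t| / φ1 t ^ 2)
    (C := K / m ^ 2) (a := a) (b := b) (fun t ht => by
      rw [Set.uIoc_of_le hab] at ht
      have ht' : t ∈ Set.Icc a b := ⟨ht.1.le, ht.2⟩
      have h3 := hd t ht'
      rw [Real.norm_eq_abs, abs_div, abs_abs, abs_pow]
      have hK0 : 0 ≤ K := (abs_nonneg _).trans (hK t ht')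
      exact div_le_div₀ hK0 (hK t ht') (by positivity) (pow_le_pow_left₀ hm.le h3 2))
  rw [abs_of_nonneg (by linarith : (0:ℝ) ≤ b - a)] at this
  calc _ ≤ _ := Real.le_norm_self _
    _ ≤ _ := this
    _ = _ := by ring

theorem norm_integral_osc_le_of_deriv_of_monotone {φ φ1 φ2 : ℝ → ℝ}
    (h1 : ∀ t, HasDerivAt φ (φ1 t) t) (h2 : ∀ t, HasDerivAt φ1 (φ2 t) t) (hc : Continuous φ2)
    {a b m : ℝ} (hab : a ≤ b) (hm : 0 < m)
    (hd : ∀ t ∈ Set.Icc a b, m ≤ φ1 t) (hp : ∀ t ∈ Set.Icc a b, 0 ≤ φ2 t) :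
    ‖∫ t in a..b, osc φ t‖ ≤ 3 / m := by
  have hne : ∀ t ∈ Set.uIcc a b, φ1 t ≠ 0 := by
    intro t ht h0
    rw [Set.uIcc_of_le hab] at ht
    have := hd t ht
    linarith
  have hcφ1 : Continuous φ1 := continuous_iff_continuousAt.2 fun t => (h2 t).continuousAt
  refine (norm_integral_osc_le_of_deriv h1 h2 hc hab hm
    (fun t ht => (hd t ht).trans (le_abs_self _))).trans ?_
  have hi : IntervalIntegrable (fun t => φ2 t / φ1 t ^ 2) volume a b := by
    apply ContinuousOn.intervalIntegrable
    apply ContinuousOn.div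
    · fun_prop
    · fun_prop
    · intro t ht; exact pow_ne_zero _ (hne t ht)
  have hftc := intervalIntegral.integral_eq_sub_of_hasDerivAt (f := fun t => -(φ1 t)⁻¹)
    (f' := fun t => φ2 t / φ1 t ^ 2) (a := a) (b := b) (fun t ht => by
      convert! ((h2 t).inv (hne t ht)).neg using 1
      ring) hi
  have heq : ∫ t in a..b, |φ2 t| / φ1 t ^ 2 = ∫ t in a..b, φ2 t / φ1 t ^ 2 := by
    refine intervalIntegral.integral_congr fun t ht => ?_
    rw [Set.uIcc_of_le hab] at ht
    simp only [abs_of_nonneg (hp t ht)]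
  rw [heq, hftc]
  have hA := hd a ⟨le_rfl, hab⟩
  have hB := hd b ⟨hab, le_rfl⟩
  have h3 : (φ1 a)⁻¹ ≤ m⁻¹ := inv_anti₀ hm hA
  have h4 : 0 ≤ (φ1 b)⁻¹ := inv_nonneg.2 (by linarith)
  have h5 : 3 / m = 2 / m + m⁻¹ := by ring
  linarith

theorem norm_integral_osc_le_right {φ φ1 φ2 : ℝ → ℝ}
    (h1 : ∀ t, HasDerivAt φ (φ1 t) t) (h2 : ∀ t, HasDerivAt φ1 (φ2 t) t) (hc : Continuous φ2)
    {a b m : ℝ} (hab : a ≤ b) (hm : 0 < m)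
    (hd : ∀ t ∈ Set.Icc a b, m * (t - a) ≤ φ1 t) (hp : ∀ t ∈ Set.Icc a b, 0 ≤ φ2 t) :
    ‖∫ t in a..b, osc φ t‖ ≤ 4 / √m := by
  have hs : 0 < √m := Real.sqrt_pos.2 hm
  have hss : √m * √m = m := Real.mul_self_sqrt hm.le
  have hcφ : Continuous φ := continuous_iff_continuousAt.2 fun t => (h1 t).continuousAt
  rcases le_total (b - a) (1 / √m) with h | h
  · refine (norm_integral_osc_le hab).trans (h.trans ?_)
    gcongr
    norm_num
  · set c := a + 1 / √m with hcdef
    have hac : a ≤ c := by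
      have : 0 < 1 / √m := by positivity
      linarith
    have hcb : c ≤ b := by linarith
    have hi : ∀ x y : ℝ, IntervalIntegrable (osc φ) volume x y :=
      fun x y => (continuous_osc hcφ).intervalIntegrable _ _
    rw [← intervalIntegral.integral_add_adjacent_intervals (hi a c) (hi c b)]
    have hmid := norm_integral_osc_le_of_deriv_of_monotone h1 h2 hc hcb hs (fun t ht => by
      refine le_trans ?_ (hd t ⟨hac.trans ht.1, ht.2⟩)
      have h6 : 1 / √m ≤ t - a := by have := ht.1; linarith
      calc √m = m * (1 / √m) := by field_simp; rw [sq]; exact hss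
        _ ≤ m * (t - a) := by gcongr) (fun t ht => hp t ⟨hac.trans ht.1, ht.2⟩)
    have hl := norm_integral_osc_le (φ := φ) hac
    have h7 : 4 / √m = 1 / √m + 3 / √m := by ring
    have h8 : c - a = 1 / √m := by rw [hcdef]; ring
    calc _ ≤ _ := norm_add_le _ _
      _ ≤ _ := by rw [h7]; linarith

theorem norm_integral_osc_le_left {φ φ1 φ2 : ℝ → ℝ}
    (h1 : ∀ t, HasDerivAt φ (φ1 t) t) (h2 : ∀ t, HasDerivAt φ1 (φ2 t) t) (hc : Continuous φ2)
    {a b m : ℝ} (hab : a ≤ b) (hm : 0 < m)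
    (hd : ∀ t ∈ Set.Icc a b, φ1 t ≤ m * (t - b)) (hp : ∀ t ∈ Set.Icc a b, 0 ≤ φ2 t) :
    ‖∫ t in a..b, osc φ t‖ ≤ 4 / √m := by
  have e1 : ∀ t, HasDerivAt (fun t => φ (-t)) (-φ1 (-t)) t := fun t => by
    have h := HasDerivAt.comp t (h1 (-t)) (hasDerivAt_neg t)
    convert! h using 1
    ring
  have e2 : ∀ t, HasDerivAt (fun t => -φ1 (-t)) (φ2 (-t)) t := fun t => by
    have h := (HasDerivAt.comp t (h2 (-t)) (hasDerivAt_neg t)).neg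
    convert! h using 1
    ring
  have := norm_integral_osc_le_right e1 e2 (by fun_prop) (neg_le_neg hab) hm
    (fun t ht => by
      have := hd (-t) ⟨by linarith [ht.2], by linarith [ht.1]⟩
      linarith)
    (fun t ht => hp (-t) ⟨by linarith [ht.2], by linarith [ht.1]⟩)
  have h3 : ∫ t in (-b)..(-a), osc (fun t => φ (-t)) t = ∫ t in a..b, osc φ t := by
    have := intervalIntegral.integral_comp_neg (a := -b) (b := -a) (osc φ)
    simpa [osc] using this
  rwa [h3] at this

theorem norm_integral_osc_le_of_deriv_two_pos {φ φ1 φ2 : ℝ → ℝ}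
    (h1 : ∀ t, HasDerivAt φ (φ1 t) t) (h2 : ∀ t, HasDerivAt φ1 (φ2 t) t) (hc : Continuous φ2)
    {a b m : ℝ} (hab : a ≤ b) (hm : 0 < m)
    (hp : ∀ t ∈ Set.Icc a b, m ≤ φ2 t) :
    ‖∫ t in a..b, osc φ t‖ ≤ 8 / √m := by
  have hs : 0 < √m := Real.sqrt_pos.2 hm
  have hcφ : Continuous φ := continuous_iff_continuousAt.2 fun t => (h1 t).continuousAt
  have hcφ1 : Continuous φ1 := continuous_iff_continuousAt.2 fun t => (h2 t).continuousAt
  have hp0 : ∀ t ∈ Set.Icc a b, 0 ≤ φ2 t := fun t ht => hm.le.trans (hp t ht)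
  have hinc : ∀ x ∈ Set.Icc a b, ∀ y ∈ Set.Icc a b, x ≤ y → m * (y - x) ≤ φ1 y - φ1 x :=
    fun x hx y hy hxy =>
    (convex_Icc a b).mul_sub_le_image_sub_of_le_deriv hcφ1.continuousOn
      (fun t _ => (h2 t).differentiableAt.differentiableWithinAt)
      (fun t ht => by rw [(h2 t).deriv]; exact hp t (interior_subset ht)) x hx y hy hxy
  have h48 : 4 / √m ≤ 8 / √m := by gcongr; norm_num
  have ha : a ∈ Set.Icc a b := ⟨le_rfl, hab⟩
  have hb : b ∈ Set.Icc a b := ⟨hab, le_rfl⟩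
  rcases le_total 0 (φ1 a) with h | h
  · refine (norm_integral_osc_le_right h1 h2 hc hab hm (fun t ht => ?_) hp0).trans h48
    linarith [hinc a ha t ht ht.1]
  rcases le_total (φ1 b) 0 with h' | h'
  · refine (norm_integral_osc_le_left h1 h2 hc hab hm (fun t ht => ?_) hp0).trans h48
    linarith [hinc t ht b hb ht.2]
  obtain ⟨τ, hτ, h0⟩ := intermediate_value_Icc hab hcφ1.continuousOn ⟨h, h'⟩
  have hi : ∀ x y : ℝ, IntervalIntegrable (osc φ) volume x y :=
    fun x y => (continuous_osc hcφ).intervalIntegrable _ _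
  rw [← intervalIntegral.integral_add_adjacent_intervals (hi a τ) (hi τ b)]
  have hr := norm_integral_osc_le_right h1 h2 hc hτ.2 hm (fun t ht => by
    linarith [hinc τ hτ t ⟨hτ.1.trans ht.1, ht.2⟩ ht.1])
    (fun t ht => hp0 t ⟨hτ.1.trans ht.1, ht.2⟩)
  have hl := norm_integral_osc_le_left h1 h2 hc hτ.1 hm (fun t ht => by
    linarith [hinc t ⟨ht.1, ht.2.trans hτ.2⟩ τ hτ ht.2])
    (fun t ht => hp0 t ⟨ht.1, ht.2.trans hτ.2⟩)
  have h8 : 8 / √m = 4 / √m + 4 / √m := by ring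
  calc _ ≤ _ := norm_add_le _ _
    _ ≤ _ := by rw [h8]; exact add_le_add hl hr

theorem norm_integral_osc_le_of_deriv_two {φ φ1 φ2 : ℝ → ℝ}
    (h1 : ∀ t, HasDerivAt φ (φ1 t) t) (h2 : ∀ t, HasDerivAt φ1 (φ2 t) t) (hc : Continuous φ2)
    {a b m : ℝ} (hab : a ≤ b) (hm : 0 < m)
    (hp : ∀ t ∈ Set.Icc a b, m ≤ |φ2 t|) :
    ‖∫ t in a..b, osc φ t‖ ≤ 8 / √m := by
  have hsign : (∀ t ∈ Set.Icc a b, m ≤ φ2 t) ∨ (∀ t ∈ Set.Icc a b, m ≤ -φ2 t) := by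
    by_contra hcon
    push Not at hcon
    obtain ⟨⟨x, hx, hx'⟩, ⟨y, hy, hy'⟩⟩ := hcon
    have hx2 : φ2 x ≤ -m := by
      rcases le_abs.1 (hp x hx) with h | h <;> linarith
    have hy2 : m ≤ φ2 y := by
      rcases le_abs.1 (hp y hy) with h | h <;> linarith
    have hpre : IsPreconnected (Set.Icc a b) := isPreconnected_Icc
    obtain ⟨z, hz, hz0⟩ := hpre.intermediate_value hx hy hc.continuousOn
      (⟨by linarith, by linarith⟩ : (0:ℝ) ∈ Set.Icc (φ2 x) (φ2 y))
    have := hp z hz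
    rw [hz0, abs_zero] at this
    linarith
  rcases hsign with h | h
  · exact norm_integral_osc_le_of_deriv_two_pos h1 h2 hc hab hm h
  · rw [← norm_integral_osc_neg]
    exact norm_integral_osc_le_of_deriv_two_pos (fun t => (h1 t).neg) (fun t => (h2 t).neg)
      hc.neg hab hm h

theorem e2_eq_norm (v : ℝ × ℝ) : e2 v = ‖(⟨v.1, v.2⟩ : ℂ)‖ := by
  rw [e2, Complex.norm_eq_sqrt_sq_add_sq]

theorem e2_nonneg (v : ℝ × ℝ) : 0 ≤ e2 v := Real.sqrt_nonneg _

theorem e2_sq (v : ℝ × ℝ) : e2 v ^ 2 = v.1 ^ 2 + v.2 ^ 2 := Real.sq_sqrt (by positivity)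

theorem e2_add_le (u v : ℝ × ℝ) : e2 (u + v) ≤ e2 u + e2 v := by
  simp only [e2_eq_norm]
  exact norm_add_le (⟨u.1, u.2⟩ : ℂ) ⟨v.1, v.2⟩

theorem e2_neg (v : ℝ × ℝ) : e2 (-v) = e2 v := by simp [e2]

theorem e2_sub_comm (u v : ℝ × ℝ) : e2 (u - v) = e2 (v - u) := by rw [← e2_neg, neg_sub]

theorem e2_sub_le (u v w : ℝ × ℝ) : e2 (u - w) ≤ e2 (u - v) + e2 (v - w) := by
  simpa using e2_add_le (u - v) (v - w)

theorem abs_fst_le_e2 (v : ℝ × ℝ) : |v.1| ≤ e2 v :=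
  Real.abs_le_sqrt (by nlinarith [sq_nonneg v.2])

theorem abs_snd_le_e2 (v : ℝ × ℝ) : |v.2| ≤ e2 v :=
  Real.abs_le_sqrt (by nlinarith [sq_nonneg v.1])

theorem abs_dot_le (u v : ℝ × ℝ) : |u.1 * v.1 + u.2 * v.2| ≤ e2 u * e2 v := by
  rw [e2, e2, ← Real.sqrt_mul (by positivity)]
  apply Real.abs_le_sqrt
  nlinarith [sq_nonneg (u.1 * v.2 - u.2 * v.1)]

theorem iv_sub (μ ν : ℤ × ℤ) : iv (μ - ν) = iv μ - iv ν := by ext <;> simp [iv]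

theorem iv_add (μ ν : ℤ × ℤ) : iv (μ + ν) = iv μ + iv ν := by ext <;> simp [iv]

theorem iv_neg (μ : ℤ × ℤ) : iv (-μ) = -iv μ := by ext <;> simp [iv]

theorem one_le_e2_iv {μ : ℤ × ℤ} (h : μ ≠ 0) : 1 ≤ e2 (iv μ) := by
  by_cases h1 : μ.1 = 0
  · have h2 : μ.2 ≠ 0 := fun h2 => h (Prod.ext h1 h2)
    refine le_trans ?_ (abs_snd_le_e2 _)
    simp only [iv]
    exact_mod_cast Int.one_le_abs h2
  · refine le_trans ?_ (abs_fst_le_e2 _)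
    simp only [iv]
    exact_mod_cast Int.one_le_abs h1

theorem e2_iv_of_mem {lam : ℝ} (hl : 0 ≤ lam) {μ : ℤ × ℤ} (h : μ ∈ Elat lam) :
    e2 (iv μ) = lam := by
  rw [mem_Elat hl] at h
  rw [e2, iv, h, Real.sqrt_sq hl]

/-- The function `t ↦ ⟨v, γ t⟩`. -/
def phase (γ : ℝ → ℝ × ℝ) (v : ℝ × ℝ) (t : ℝ) : ℝ := v.1 * (γ t).1 + v.2 * (γ t).2

theorem phase_add (γ : ℝ → ℝ × ℝ) (u v : ℝ × ℝ) (t : ℝ) :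
    phase γ (u + v) t = phase γ u t + phase γ v t := by
  simp only [phase, Prod.fst_add, Prod.snd_add]; ring

theorem phase_neg (γ : ℝ → ℝ × ℝ) (v : ℝ × ℝ) (t : ℝ) : phase γ (-v) t = -phase γ v t := by
  simp only [phase, Prod.fst_neg, Prod.snd_neg]; ring

theorem abs_phase_le (γ : ℝ → ℝ × ℝ) (v : ℝ × ℝ) (t : ℝ) : |phase γ v t| ≤ e2 v * e2 (γ t) :=
  abs_dot_le _ _

theorem osc_phase_add (γ : ℝ → ℝ × ℝ) (u v : ℝ × ℝ) (t : ℝ) :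
    osc (phase γ (u + v)) t = osc (phase γ u) t * osc (phase γ v) t := by
  simp only [osc, phase_add, ← Complex.exp_add]
  push_cast
  ring_nf

theorem star_osc_phase (γ : ℝ → ℝ × ℝ) (v : ℝ × ℝ) (t : ℝ) :
    starRingEnd ℂ (osc (phase γ v) t) = osc (phase γ (-v)) t := by
  rw [star_osc]
  simp only [osc, phase_neg]

theorem osc_phase_sub (γ : ℝ → ℝ × ℝ) (u v : ℝ × ℝ) (t : ℝ) :
    osc (phase γ (u - v)) t = osc (phase γ u) t * starRingEnd ℂ (osc (phase γ v) t) := by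
  rw [sub_eq_add_neg, osc_phase_add, star_osc_phase]

theorem efn_eq_sum_osc (lam : ℝ) (a : ℤ × ℤ → ℂ) (γ : ℝ → ℝ × ℝ) (t : ℝ) :
    efn lam a (γ t) = ∑ μ ∈ Elat lam, a μ * osc (phase γ (iv μ)) t := rfl

theorem hasDerivAt_phase {γ : ℝ → ℝ × ℝ} (h : ContDiff ℝ (⊤ : ℕ∞) γ) (v : ℝ × ℝ) (t : ℝ) :
    HasDerivAt (phase γ v) (phase (deriv γ) v t) t := by
  have hd : HasDerivAt γ (deriv γ t) t :=
    ((h.differentiable (by simp)) t).hasDerivAt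
  have h1 : HasDerivAt (fun t => (γ t).1) (deriv γ t).1 t :=
    (ContinuousLinearMap.fst ℝ ℝ ℝ).hasFDerivAt.comp_hasDerivAt t hd
  have h2 : HasDerivAt (fun t => (γ t).2) (deriv γ t).2 t :=
    (ContinuousLinearMap.snd ℝ ℝ ℝ).hasFDerivAt.comp_hasDerivAt t hd
  exact (h1.const_mul v.1).add (h2.const_mul v.2)

theorem contDiff_deriv_of_top {γ : ℝ → ℝ × ℝ} (h : ContDiff ℝ (⊤ : ℕ∞) γ) :
    ContDiff ℝ (⊤ : ℕ∞) (deriv γ) := by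
  exact (contDiff_infty_iff_deriv.1 h).2

theorem continuous_phase {γ : ℝ → ℝ × ℝ} (h : ContDiff ℝ (⊤ : ℕ∞) γ) (v : ℝ × ℝ) :
    Continuous (phase γ v) := by
  have := h.continuous
  unfold phase
  fun_prop

/-- Quantitative data of a curved arc `γ|[α, β]`: every phase function has a large first or a large
second derivative throughout. -/
structure IsCurvedArc (γ : ℝ → ℝ × ℝ) (α β c K : ℝ) : Prop where
  smooth : ContDiff ℝ (⊤ : ℕ∞) γ
  lt : α < β
  c_pos : 0 < c
  one_le : 1 ≤ K
  dich : ∀ v : ℝ × ℝ, (∀ t ∈ Set.Icc α β, c * e2 v ≤ |phase (deriv γ) v t|) ∨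
    ∀ t ∈ Set.Icc α β, c * e2 v ≤ |phase (deriv (deriv γ)) v t|
  bound_one : ∀ v : ℝ × ℝ, ∀ t ∈ Set.Icc α β, |phase (deriv γ) v t| ≤ K * e2 v
  bound_two : ∀ v : ℝ × ℝ, ∀ t ∈ Set.Icc α β, |phase (deriv (deriv γ)) v t| ≤ K * e2 v
  inj : Set.InjOn γ (Set.Icc α β)

theorem exists_isCurvedArc (L Kmin Kmax : ℝ) (γ : ℝ → ℝ × ℝ)
    (hL : 0 < L) (hKmin : 0 < Kmin)
    (hsmooth : ContDiff ℝ (⊤ : ℕ∞) γ)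
    (hunit : ∀ t ∈ Set.Icc (0:ℝ) L, e2 (deriv γ t) = 1)
    (hcurv : ∀ t ∈ Set.Icc (0:ℝ) L,
      Kmin ≤ e2 (deriv (deriv γ) t) ∧ e2 (deriv (deriv γ) t) ≤ Kmax) :
    ∃ α β c K : ℝ, Set.Icc α β ⊆ Set.Icc 0 L ∧ IsCurvedArc γ α β c K := by
  have hs1 := contDiff_deriv_of_top hsmooth
  have hs2 := contDiff_deriv_of_top hs1
  set τ := L / 2 with hτ
  set g := deriv γ with hg
  set k := deriv g with hk
  have hτm : τ ∈ Set.Ioo 0 L := ⟨by positivity, by rw [hτ]; linarith⟩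
  have hτI : τ ∈ Set.Icc 0 L := Set.Ioo_subset_Icc_self hτm
  have hperp : (g τ).1 * (k τ).1 + (g τ).2 * (k τ).2 = 0 := by
    have hd : HasDerivAt g (k τ) τ := ((hs1.differentiable (by simp)) τ).hasDerivAt
    have h1 : HasDerivAt (fun t => (g t).1) (k τ).1 τ :=
      (ContinuousLinearMap.fst ℝ ℝ ℝ).hasFDerivAt.comp_hasDerivAt τ hd
    have h2 : HasDerivAt (fun t => (g t).2) (k τ).2 τ :=
      (ContinuousLinearMap.snd ℝ ℝ ℝ).hasFDerivAt.comp_hasDerivAt τ hd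
    have h3 := (h1.pow 2).add (h2.pow 2)
    have h4 : HasDerivAt (fun _ : ℝ => (1:ℝ)) 0 τ := hasDerivAt_const _ _
    have h5 := h4.congr_of_eventuallyEq (f₁ := fun t => (g t).1 ^ 2 + (g t).2 ^ 2) (by
      filter_upwards [isOpen_Ioo.mem_nhds hτm] with t ht
      rw [← e2_sq, hunit t (Set.Ioo_subset_Icc_self ht), one_pow])
    have := h3.unique h5
    norm_num at this
    linarith
  have hgu : (g τ).1 ^ 2 + (g τ).2 ^ 2 = 1 := by rw [← e2_sq, hunit τ hτI, one_pow]
  have hku := (hcurv τ hτI).1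
  set κ := e2 (k τ) with hκ
  have hκ2 : (k τ).1 ^ 2 + (k τ).2 ^ 2 = κ ^ 2 := by rw [← e2_sq]
  have hκ0 : 0 < κ := hKmin.trans_le hku
  have hpoint : ∀ v : ℝ × ℝ, e2 v / 2 ≤ |phase g v τ| ∨ Kmin * e2 v / 2 ≤ |phase k v τ| := by
    intro v
    by_contra hcon
    push Not at hcon
    obtain ⟨c1, c2⟩ := hcon
    have c3 : |phase k v τ| < κ * e2 v / 2 :=
      c2.trans_le (by have := mul_le_mul_of_nonneg_right hku (e2_nonneg v); linarith)
    have d1 := pow_lt_pow_left₀ c1 (abs_nonneg _) two_ne_zero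
    have d2 := pow_lt_pow_left₀ c3 (abs_nonneg _) two_ne_zero
    rw [sq_abs] at d1 d2
    have hv := e2_sq v
    have hid : κ ^ 2 * phase g v τ ^ 2 + phase k v τ ^ 2 = κ ^ 2 * e2 v ^ 2 := by
      rw [hv, ← hκ2]
      simp only [phase]
      generalize (g τ).1 = g1 at *
      generalize (g τ).2 = g2 at *
      generalize (k τ).1 = k1 at *
      generalize (k τ).2 = k2 at *
      have e1 : k1 = -(g1 * k2 - g2 * k1) * g2 := by linear_combination (-k1) * hgu + g1 * hperp
      have e2 : k2 = (g1 * k2 - g2 * k1) * g1 := by linear_combination (-k2) * hgu + g2 * hperp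
      generalize g1 * k2 - g2 * k1 = s at *
      subst e1 e2
      linear_combination s ^ 2 * (v.1 * g1 + v.2 * g2) ^ 2 * hgu
    nlinarith [mul_lt_mul_of_pos_left d1 (by positivity : 0 < κ ^ 2), sq_nonneg (κ * e2 v)]
  set c := min 1 Kmin / 4 with hc
  have hc0 : 0 < c := by positivity
  have hc1 : c ≤ 1 / 4 := by rw [hc]; linarith [min_le_left 1 Kmin]
  have hc2 : c ≤ Kmin / 4 := by rw [hc]; linarith [min_le_right 1 Kmin]
  have hcont : ∀ f : ℝ → ℝ × ℝ, Continuous f → ∀ᶠ t in nhds τ, e2 (f t - f τ) < c := by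
    intro f hf
    have : Continuous fun t => e2 (f t - f τ) := by unfold e2; fun_prop
    have h0 := this.tendsto τ
    simp only [sub_self] at h0
    exact h0.eventually_lt_const (by simpa [e2] using hc0)
  have hev := ((hcont g hs1.continuous).and (hcont k hs2.continuous)).and
    (isOpen_Ioo.mem_nhds hτm)
  obtain ⟨δ, hδ, hδ'⟩ := Metric.eventually_nhds_iff.1 hev
  have hI : ∀ t ∈ Set.Icc (τ - δ / 2) (τ + δ / 2),
      (e2 (g t - g τ) < c ∧ e2 (k t - k τ) < c) ∧ t ∈ Set.Ioo 0 L := fun t ht => by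
    apply hδ'
    rw [Real.dist_eq, abs_lt]
    constructor <;> linarith [ht.1, ht.2]
  have hdiff : ∀ (f : ℝ → ℝ × ℝ) (v : ℝ × ℝ) t, e2 (f t - f τ) < c →
      |phase f v τ| - c * e2 v ≤ |phase f v t| := by
    intro f v t h
    have h1 : |phase f v τ - phase f v t| ≤ e2 v * e2 (f t - f τ) := by
      rw [abs_sub_comm]
      refine le_trans (le_of_eq ?_) (abs_dot_le v (f t - f τ))
      simp only [phase, Prod.fst_sub, Prod.snd_sub]
      ring_nf
    have h2 := abs_sub_abs_le_abs_sub (phase f v τ) (phase f v t)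
    have h3 := mul_le_mul_of_nonneg_left h.le (e2_nonneg v)
    linarith
  refine ⟨τ - δ / 2, τ + δ / 2, c, max 1 Kmax,
    fun t ht => Set.Ioo_subset_Icc_self (hI t ht).2, hsmooth, by linarith, hc0, le_max_left _ _,
    ?_, ?_, ?_, ?_⟩
  · intro v
    have hv := e2_nonneg v
    rcases hpoint v with h | h
    · left
      intro t ht
      have := hdiff g v t (hI t ht).1.1
      nlinarith
    · right
      intro t ht
      have := hdiff k v t (hI t ht).1.2
      nlinarith
  · intro v t ht
    refine (abs_phase_le _ _ _).trans ?_
    rw [hunit t (Set.Ioo_subset_Icc_self (hI t ht).2), mul_comm]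
    gcongr
    · exact e2_nonneg v
    · exact le_max_left _ _
  · intro v t ht
    refine (abs_phase_le _ _ _).trans ?_
    rw [mul_comm]
    gcongr
    · exact e2_nonneg v
    · exact (hcurv t (Set.Ioo_subset_Icc_self (hI t ht).2)).2.trans (le_max_right _ _)
  · have hmono : StrictMonoOn (phase γ (g τ)) (Set.Icc (τ - δ / 2) (τ + δ / 2)) := by
      apply strictMonoOn_of_deriv_pos (convex_Icc _ _) (continuous_phase hsmooth _).continuousOn
      intro t ht
      rw [(hasDerivAt_phase hsmooth _ t).deriv]
      have ht' := (hI t (interior_subset ht)).1.1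
      have h1 : |(g τ).1 * (g t - g τ).1 + (g τ).2 * (g t - g τ).2| ≤ e2 (g τ) * e2 (g t - g τ) :=
        abs_dot_le _ _
      rw [hunit τ hτI, one_mul] at h1
      have h2 := neg_le_of_abs_le h1
      simp only [phase, Prod.fst_sub, Prod.snd_sub] at h2 ⊢
      nlinarith
    intro s hs t ht hst
    apply hmono.injOn hs ht
    simp only [phase, hst]

theorem finite_setOf_e2_iv_lt (R : ℝ) : {ξ : ℤ × ℤ | e2 (iv ξ) < R}.Finite := by
  apply (Set.finite_Icc ((-⌈R⌉, -⌈R⌉) : ℤ × ℤ) (⌈R⌉, ⌈R⌉)).subset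
  intro ξ hξ
  have h1 := abs_le.1 ((abs_fst_le_e2 (iv ξ)).trans (le_of_lt hξ))
  have h2 := abs_le.1 ((abs_snd_le_e2 (iv ξ)).trans (le_of_lt hξ))
  have hR := Int.le_ceil R
  simp only [iv] at h1 h2
  refine ⟨⟨?_, ?_⟩, ⟨?_, ?_⟩⟩ <;> simp only [] <;> rify <;> linarith

namespace IsCurvedArc

variable {γ : ℝ → ℝ × ℝ} {α β c K : ℝ}

theorem exists_norm_integral_osc_le (A : IsCurvedArc γ α β c K) : ∃ C : ℝ, 0 < C ∧
    ∀ s t : ℝ, α ≤ s → s ≤ t → t ≤ β → ∀ v : ℝ × ℝ, 1 ≤ e2 v →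
      ‖∫ x in s..t, osc (phase γ v) x‖ ≤ C / √(e2 v) := by
  have hc := A.c_pos
  have hK := A.one_le
  have hab := A.lt
  have hs1 := contDiff_deriv_of_top A.smooth
  have hs2 := contDiff_deriv_of_top hs1
  refine ⟨max (2 / c + (β - α) * K / c ^ 2) (8 / √c), by positivity, ?_⟩
  intro s t hs hst ht v hv
  have hv0 : 0 < e2 v := by linarith
  have hsq : 0 < √(e2 v) := Real.sqrt_pos.2 hv0
  have hsub : ∀ x ∈ Set.Icc s t, x ∈ Set.Icc α β := fun x hx => ⟨hs.trans hx.1, hx.2.trans ht⟩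
  rcases A.dich v with h | h
  · refine (norm_integral_osc_le_of_deriv_of_bound (hasDerivAt_phase A.smooth v)
      (hasDerivAt_phase hs1 v) (continuous_phase hs2 v) hst (m := c * e2 v) (by positivity)
      (fun x hx => h x (hsub x hx)) (fun x hx => A.bound_two v x (hsub x hx))).trans ?_
    calc 2 / (c * e2 v) + (t - s) * (K * e2 v) / (c * e2 v) ^ 2
        ≤ 2 / (c * e2 v) + (β - α) * (K * e2 v) / (c * e2 v) ^ 2 := by gcongr
      _ = (2 / c + (β - α) * K / c ^ 2) / e2 v := by field_simp
      _ ≤ (2 / c + (β - α) * K / c ^ 2) / √(e2 v) := by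
        have hpos : 0 ≤ 2 / c + (β - α) * K / c ^ 2 := by
          have : 0 < β - α := by linarith
          positivity
        gcongr
        exact Real.sqrt_le_iff.2 ⟨by linarith, by nlinarith⟩
      _ ≤ _ := by
        gcongr
        exact le_max_left _ _
  · refine (norm_integral_osc_le_of_deriv_two (hasDerivAt_phase A.smooth v)
      (hasDerivAt_phase hs1 v) (continuous_phase hs2 v) hst (m := c * e2 v) (by positivity)
      (fun x hx => h x (hsub x hx))).trans ?_
    rw [Real.sqrt_mul hc.le, ← div_div]
    gcongr
    exact le_max_right _ _

theorem exists_norm_integral_mul_osc_le (A : IsCurvedArc γ α β c K) : ∃ C : ℝ, 0 < C ∧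
    ∀ s t : ℝ, α ≤ s → s ≤ t → t ≤ β → ∀ v : ℝ × ℝ, 1 ≤ e2 v → ∀ (ψ ψ' : ℝ → ℂ) (P Q : ℝ),
      (∀ x, HasDerivAt ψ (ψ' x) x) → Continuous ψ' → (∀ x ∈ Set.Icc s t, ‖ψ x‖ ≤ P) →
      (∀ x ∈ Set.Icc s t, ‖ψ' x‖ ≤ Q) →
      ‖∫ x in s..t, ψ x * osc (phase γ v) x‖ ≤ C / √(e2 v) * (P + (β - α) * Q) := by
  obtain ⟨C, hC, h⟩ := A.exists_norm_integral_osc_le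
  refine ⟨C, hC, ?_⟩
  intro s t hs hst ht v hv ψ ψ' P Q hψ hψc hP hQ
  have hco := continuous_osc (continuous_phase A.smooth v)
  have hQ0 : 0 ≤ Q := (norm_nonneg _).trans (hQ s ⟨le_rfl, hst⟩)
  set J : ℝ → ℂ := fun x => ∫ y in s..x, osc (phase γ v) y with hJ
  have hJd : ∀ x, HasDerivAt J (osc (phase γ v) x) x := fun x => hco.integral_hasStrictDerivAt _ _ |>.hasDerivAt
  have hJb : ∀ x ∈ Set.Icc s t, ‖J x‖ ≤ C / √(e2 v) := fun x hx =>
    h s x hs hx.1 (hx.2.trans ht) v hv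
  have hparts := intervalIntegral.integral_mul_deriv_eq_deriv_mul (a := s) (b := t)
    (fun x _ => hψ x) (fun x _ => hJd x) (hψc.intervalIntegrable _ _) (hco.intervalIntegrable _ _)
  rw [hparts]
  have hJs : J s = 0 := by simp [hJ]
  rw [hJs, mul_zero, sub_zero]
  have hC0 : 0 ≤ C / √(e2 v) := by positivity
  have h1 : ‖ψ t * J t‖ ≤ P * (C / √(e2 v)) := by
    rw [norm_mul]
    exact mul_le_mul (hP t ⟨hst, le_rfl⟩) (hJb t ⟨hst, le_rfl⟩) (norm_nonneg _)
      ((norm_nonneg _).trans (hP t ⟨hst, le_rfl⟩))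
  have h2 : ‖∫ x in s..t, ψ' x * J x‖ ≤ Q * (C / √(e2 v)) * |t - s| := by
    apply intervalIntegral.norm_integral_le_of_norm_le_const
    intro x hx
    rw [Set.uIoc_of_le hst] at hx
    have hx' : x ∈ Set.Icc s t := ⟨hx.1.le, hx.2⟩
    rw [norm_mul]
    exact mul_le_mul (hQ x hx') (hJb x hx') (norm_nonneg _) hQ0
  rw [abs_of_nonneg (by linarith : 0 ≤ t - s)] at h2
  calc _ ≤ _ := norm_sub_le _ _
    _ ≤ P * (C / √(e2 v)) + Q * (C / √(e2 v)) * (t - s) := add_le_add h1 h2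
    _ ≤ P * (C / √(e2 v)) + Q * (C / √(e2 v)) * (β - α) := by gcongr
    _ = _ := by ring

theorem norm_integral_osc_lt (A : IsCurvedArc γ α β c K) {p q : ℝ} (hp : α ≤ p) (hpq : p < q)
    (hq : q ≤ β) {v : ℝ × ℝ} (hv : 0 < e2 v) :
    ‖∫ x in p..q, osc (phase γ v) x‖ < q - p := by
  have hs1 := contDiff_deriv_of_top A.smooth
  have hco := continuous_osc (continuous_phase A.smooth v)
  rw [intervalIntegral.integral_of_le hpq.le]
  rcases ae_eq_const_or_norm_integral_lt_of_norm_le_const (μ := volume.restrict (Set.Ioc p q))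
    (f := osc (phase γ v)) (C := 1) (Filter.Eventually.of_forall fun x => (norm_osc _ x).le) with h | h
  · exfalso
    have heq := Measure.eqOn_Ioc_of_ae_eq volume h hco.continuousOn continuousOn_const
    have h1 : ∀ x ∈ Set.Ioo p q, phase (deriv γ) v x = 0 := by
      intro x hx
      have hd := hasDerivAt_osc (hasDerivAt_phase A.smooth v x)
      have hd0 := (hasDerivAt_const x
        (⨍ x in Set.Ioc p q, osc (phase γ v) x)).congr_of_eventuallyEq
        (f₁ := osc (phase γ v)) (by
          filter_upwards [isOpen_Ioo.mem_nhds hx] with y hy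
          exact heq ⟨hy.1, hy.2.le⟩)
      have h0 := hd.unique hd0
      have hne : osc (phase γ v) x ≠ 0 := norm_ne_zero_iff.1 (by rw [norm_osc]; norm_num)
      simpa [hne] using h0
    have h2 : ∀ x ∈ Set.Ioo p q, phase (deriv (deriv γ)) v x = 0 := by
      intro x hx
      have hd := hasDerivAt_phase hs1 v x
      have hd0 := (hasDerivAt_const x (0:ℝ)).congr_of_eventuallyEq
        (f₁ := phase (deriv γ) v) (by
          filter_upwards [isOpen_Ioo.mem_nhds hx] with y hy
          exact h1 y hy)
      exact hd.unique hd0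
    have hm : (p + q) / 2 ∈ Set.Ioo p q := ⟨by linarith, by linarith⟩
    have hm' : (p + q) / 2 ∈ Set.Icc α β := ⟨by linarith, by linarith⟩
    have hcv : 0 < c * e2 v := mul_pos A.c_pos hv
    rcases A.dich v with h | h
    · have := h _ hm'
      rw [h1 _ hm, abs_zero] at this
      linarith
    · have := h _ hm'
      rw [h2 _ hm, abs_zero] at this
      linarith
  · simpa [Measure.real, hpq.le] using h

theorem exists_norm_integral_osc_le_gap (A : IsCurvedArc γ α β c K) {p q : ℝ} (hp : α ≤ p)
    (hpq : p < q) (hq : q ≤ β) : ∃ κ : ℝ, 0 < κ ∧ ∀ ξ : ℤ × ℤ, ξ ≠ 0 →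
      ‖∫ x in p..q, osc (phase γ (iv ξ)) x‖ ≤ (q - p) - κ := by
  obtain ⟨C, hC, h⟩ := A.exists_norm_integral_osc_le
  set R := (2 * C / (q - p)) ^ 2 + 1 with hR
  have hqp : 0 < q - p := by linarith
  have hfin := (finite_setOf_e2_iv_lt R).subset (Set.inter_subset_left (t := {0}ᶜ))
  have hfin' : ∃ κ : ℝ, 0 < κ ∧ ∀ ξ ∈ hfin.toFinset,
      ‖∫ x in p..q, osc (phase γ (iv ξ)) x‖ ≤ (q - p) - κ := by
    have : ∀ F : Finset (ℤ × ℤ), (0 : ℤ × ℤ) ∉ F → ∃ κ : ℝ, 0 < κ ∧ ∀ ξ ∈ F,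
        ‖∫ x in p..q, osc (phase γ (iv ξ)) x‖ ≤ (q - p) - κ := by
      classical
      intro F
      induction F using Finset.induction_on with
      | empty => intro _; exact ⟨1, one_pos, by simp⟩
      | insert ξ F hξ ih =>
        intro h0
        rw [Finset.mem_insert, not_or] at h0
        obtain ⟨κ, hκ, hF⟩ := ih h0.2
        have hlt := A.norm_integral_osc_lt hp hpq hq
          (v := iv ξ) (by linarith [one_le_e2_iv (Ne.symm h0.1)])
        refine ⟨min κ ((q - p) - ‖∫ x in p..q, osc (phase γ (iv ξ)) x‖), ?_, ?_⟩
        · exact lt_min hκ (by linarith)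
        · intro η hη
          rcases Finset.mem_insert.1 hη with rfl | hη
          · linarith [min_le_right κ ((q - p) - ‖∫ x in p..q, osc (phase γ (iv η)) x‖)]
          · linarith [hF η hη, min_le_left κ ((q - p) - ‖∫ x in p..q, osc (phase γ (iv ξ)) x‖)]
    exact this _ (by simp)
  obtain ⟨κ, hκ, hF⟩ := hfin'
  refine ⟨min κ ((q - p) / 2), by positivity, fun ξ hξ => ?_⟩
  by_cases hlt : e2 (iv ξ) < R
  · linarith [hF ξ (by simp [hlt, hξ]), min_le_left κ ((q - p) / 2)]
  · push Not at hlt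
    have h1 := h p q hp hpq.le hq (iv ξ) (one_le_e2_iv hξ)
    have hs : 2 * C / (q - p) ≤ √(e2 (iv ξ)) := Real.le_sqrt_of_sq_le (by linarith)
    have h2 : C / √(e2 (iv ξ)) ≤ (q - p) / 2 := by
      have hpos : 0 < √(e2 (iv ξ)) := Real.sqrt_pos.2 (by linarith [one_le_e2_iv hξ])
      rw [div_le_iff₀ hqp] at hs
      rw [div_le_iff₀ hpos]
      linarith
    linarith [min_le_right κ ((q - p) / 2)]

end IsCurvedArc

theorem two_mul_le_prod_e2 {lam : ℝ} (hl : 0 ≤ lam) {μ ν ρ : ℤ × ℤ} (hμ : μ ∈ Elat lam)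
    (hν : ν ∈ Elat lam) (hρ : ρ ∈ Elat lam) (h1 : μ ≠ ν) (h2 : μ ≠ ρ) (h3 : ν ≠ ρ) :
    2 * lam ≤ e2 (iv μ - iv ν) * e2 (iv μ - iv ρ) * e2 (iv ν - iv ρ) := by
  rw [mem_Elat hl] at hμ hν hρ
  have p1 := one_le_e2_iv (sub_ne_zero.2 h1)
  have p2 := one_le_e2_iv (sub_ne_zero.2 h2)
  have p3 := one_le_e2_iv (sub_ne_zero.2 h3)
  rw [iv_sub] at p1 p2 p3
  refine (sq_le_sq₀ (by positivity) (by positivity)).1 ?_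
  rw [mul_pow (e2 _ * e2 _), mul_pow (e2 _), e2_sq, e2_sq, e2_sq]
  set δ : ℤ := (ν.1 - μ.1) * (ρ.2 - μ.2) - (ν.2 - μ.2) * (ρ.1 - μ.1) with hδ
  have hδR : (δ : ℝ) = (ν.1 - μ.1) * (ρ.2 - μ.2) - (ν.2 - μ.2) * (ρ.1 - μ.1) := by
    rw [hδ]; push_cast; ring
  have key : (2 * lam) ^ 2 * (δ : ℝ) ^ 2 = ((iv μ - iv ν).1 ^ 2 + (iv μ - iv ν).2 ^ 2) *
      ((iv μ - iv ρ).1 ^ 2 + (iv μ - iv ρ).2 ^ 2) * ((iv ν - iv ρ).1 ^ 2 + (iv ν - iv ρ).2 ^ 2) := by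
    simp only [iv, Prod.fst_sub, Prod.snd_sub]
    rw [mul_pow, ← hμ, hδR]
    generalize (μ.1 : ℝ) = m1 at *
    generalize (μ.2 : ℝ) = m2 at *
    obtain ⟨u1, hu1⟩ : ∃ u, u = (ν.1 : ℝ) - m1 := ⟨_, rfl⟩
    obtain ⟨u2, hu2⟩ : ∃ u, u = (ν.2 : ℝ) - m2 := ⟨_, rfl⟩
    obtain ⟨w1, hw1⟩ : ∃ u, u = (ρ.1 : ℝ) - m1 := ⟨_, rfl⟩
    obtain ⟨w2, hw2⟩ : ∃ u, u = (ρ.2 : ℝ) - m2 := ⟨_, rfl⟩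
    have eu : 2 * (u1 * m1 + u2 * m2) + (u1 ^ 2 + u2 ^ 2) = 0 := by
      rw [hu1, hu2]; linear_combination hν - hμ
    have ew : 2 * (w1 * m1 + w2 * m2) + (w1 ^ 2 + w2 ^ 2) = 0 := by
      rw [hw1, hw2]; linear_combination hρ - hμ
    have a1 : 2 * ((u1 * w2 - u2 * w1) * m1) = (w1 ^ 2 + w2 ^ 2) * u2 - (u1 ^ 2 + u2 ^ 2) * w2 := by
      linear_combination w2 * eu - u2 * ew
    have a2 : 2 * ((u1 * w2 - u2 * w1) * m2) = (u1 ^ 2 + u2 ^ 2) * w1 - (w1 ^ 2 + w2 ^ 2) * u1 := by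
      linear_combination -w1 * eu + u1 * ew
    have e1 : (ν.1 : ℝ) = m1 + u1 := by rw [hu1]; ring
    have e2 : (ν.2 : ℝ) = m2 + u2 := by rw [hu2]; ring
    have e3 : (ρ.1 : ℝ) = m1 + w1 := by rw [hw1]; ring
    have e4 : (ρ.2 : ℝ) = m2 + w2 := by rw [hw2]; ring
    rw [e1, e2, e3, e4]
    calc _ = (2 * ((u1 * w2 - u2 * w1) * m1)) ^ 2 + (2 * ((u1 * w2 - u2 * w1) * m2)) ^ 2 := by ring
      _ = _ := by rw [a1, a2]; ring
  have hδ0 : δ ≠ 0 := by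
    intro h0
    rw [h0] at key
    have : 0 < ((iv μ - iv ν).1 ^ 2 + (iv μ - iv ν).2 ^ 2) *
      ((iv μ - iv ρ).1 ^ 2 + (iv μ - iv ρ).2 ^ 2) * ((iv ν - iv ρ).1 ^ 2 + (iv ν - iv ρ).2 ^ 2) := by
      rw [← e2_sq, ← e2_sq, ← e2_sq]
      positivity
    rw [← key] at this
    norm_num at this
  rw [← key]
  have h1 : (1:ℝ) ≤ (δ : ℝ) ^ 2 := by
    have : 0 < δ ^ 2 := by positivity
    exact_mod_cast this
  nlinarith [sq_nonneg (2 * lam)]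

theorem card_filter_e2_lt_le_two {lam R : ℝ} (hl : 0 ≤ lam) (hR : 8 * R ^ 3 ≤ 2 * lam)
    (x : ℝ × ℝ) {s : Finset (ℤ × ℤ)} (hs : s ⊆ Elat lam) (hx : ∀ ρ ∈ s, e2 (iv ρ - x) < R) :
    s.card ≤ 2 := by
  by_contra hcon
  push Not at hcon
  obtain ⟨a, b, c, ha, hb, hc, hab, hac, hbc⟩ := Finset.two_lt_card_iff.1 hcon
  have h := two_mul_le_prod_e2 hl (hs ha) (hs hb) (hs hc) hab hac hbc
  have hd : ∀ u ∈ s, ∀ v ∈ s, e2 (iv u - iv v) < 2 * R := by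
    intro u hu v hv
    have h1 := e2_sub_le (iv u) x (iv v)
    have h2 := hx v hv
    rw [e2_sub_comm] at h2
    linarith [hx u hu]
  have : e2 (iv a - iv b) * e2 (iv a - iv c) * e2 (iv b - iv c) < (2 * R) * (2 * R) * (2 * R) := by
    have q1 := hd a ha b hb
    have q2 := hd a ha c hc
    have q3 := hd b hb c hc
    have r1 := e2_nonneg (iv a - iv b)
    have r2 := e2_nonneg (iv a - iv c)
    have r3 := e2_nonneg (iv b - iv c)
    apply mul_lt_mul'' (mul_lt_mul'' q1 q2 r1 r2) q3 (by positivity) r3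
  nlinarith

theorem card_near_le_one {lam D : ℝ} (hl : 0 ≤ lam) (hD : 8 * D ^ 3 ≤ 2 * lam) {μ : ℤ × ℤ}
    (hμ : μ ∈ Elat lam) {s : Finset (ℤ × ℤ)} (hs : s ⊆ (Elat lam).erase μ)
    (hn : ∀ ν ∈ s, e2 (iv (μ - ν)) < D) : s.card ≤ 1 := by
  classical
  have hμs : μ ∉ s := fun h => by simpa using hs h
  have hsub : s ⊆ Elat lam := hs.trans (Finset.erase_subset _ _)
  rcases s.eq_empty_or_nonempty with rfl | ⟨ν, hν⟩
  · simp
  have hDpos : 0 < D := (e2_nonneg _).trans_lt (hn ν hν)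
  have := card_filter_e2_lt_le_two hl hD (iv μ) (s := insert μ s)
    (Finset.insert_subset hμ hsub) (fun ρ hρ => by
      rcases Finset.mem_insert.1 hρ with rfl | hρ
      · simpa [e2] using hDpos
      · rw [e2_sub_comm, ← iv_sub]; exact hn ρ hρ)
  rw [Finset.card_insert_of_notMem hμs] at this
  omega

/-- A quadratic form whose kernel is at most `P` on a sparse symmetric relation and at most `ε`
elsewhere. -/
theorem sum_sum_erase_le {ι : Type*} [DecidableEq ι] (E : Finset ι) (near : ι → ι → Prop)
    [DecidableRel near]
    (hsymm : ∀ μ ν, near μ ν → near ν μ)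
    (hnear : ∀ μ ∈ E, ((E.erase μ).filter (near μ)).card ≤ 1)
    (x : ι → ℝ) (hx : ∀ μ, 0 ≤ x μ) (k : ι → ι → ℝ) {P ε : ℝ} (hP : 0 ≤ P) (hε : 0 ≤ ε)
    (hk1 : ∀ μ ∈ E, ∀ ν ∈ E, μ ≠ ν → near μ ν → k μ ν ≤ P)
    (hk2 : ∀ μ ∈ E, ∀ ν ∈ E, ¬ near μ ν → k μ ν ≤ ε) :
    ∑ μ ∈ E, ∑ ν ∈ E.erase μ, x μ * x ν * k μ ν ≤ (P + ε * E.card) * ∑ μ ∈ E, x μ ^ 2 := by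
  let n : ι → ι → ℝ := fun μ ν => if μ ≠ ν ∧ near μ ν then 1 else 0
  have hn0 : ∀ μ ν, 0 ≤ n μ ν := fun μ ν => by simp only [n]; split_ifs <;> norm_num
  have hns : ∀ μ ν, n μ ν = n ν μ := fun μ ν => by
    simp only [n]
    congr 1
    exact propext ⟨fun h => ⟨h.1.symm, hsymm _ _ h.2⟩, fun h => ⟨h.1.symm, hsymm _ _ h.2⟩⟩
  have hrow : ∀ μ ∈ E, ∑ ν ∈ E, n μ ν ≤ 1 := by
    intro μ hμ
    have : ∑ ν ∈ E, n μ ν = ((E.erase μ).filter (near μ)).card := by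
      simp only [n, Finset.sum_boole]
      congr 2
      ext ν
      simp only [Finset.mem_filter, Finset.mem_erase]
      tauto
    rw [this]
    exact_mod_cast hnear μ hμ
  have hterm : ∀ μ ∈ E, ∀ ν ∈ E.erase μ, x μ * x ν * k μ ν ≤
      P * ((x μ ^ 2 + x ν ^ 2) / 2 * n μ ν) + ε * (x μ * x ν) := by
    intro μ hμ ν hν
    have hne : μ ≠ ν := (Finset.ne_of_mem_erase hν).symm
    have hν' := Finset.mem_of_mem_erase hν
    have hxx := mul_nonneg (hx μ) (hx ν)
    by_cases h : near μ ν
    · have h1 := mul_le_mul_of_nonneg_left (hk1 μ hμ ν hν' hne h) hxx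
      have h2 : n μ ν = 1 := by simp [n, hne, h]
      rw [h2]
      have h3 : x μ * x ν ≤ (x μ ^ 2 + x ν ^ 2) / 2 := by nlinarith [sq_nonneg (x μ - x ν)]
      nlinarith
    · have h1 := mul_le_mul_of_nonneg_left (hk2 μ hμ ν hν' h) hxx
      have h2 : n μ ν = 0 := by simp [n, h]
      rw [h2]
      linarith
  have hfull : ∀ μ ∈ E, ∑ ν ∈ E.erase μ, x μ * x ν * k μ ν ≤
      ∑ ν ∈ E, (P * ((x μ ^ 2 + x ν ^ 2) / 2 * n μ ν) + ε * (x μ * x ν)) := by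
    intro μ hμ
    refine (Finset.sum_le_sum (hterm μ hμ)).trans ?_
    refine Finset.sum_le_sum_of_subset_of_nonneg (Finset.erase_subset _ _) fun ν _ _ => ?_
    have := hx μ; have := hx ν; have := hn0 μ ν
    positivity
  refine (Finset.sum_le_sum hfull).trans ?_
  simp only [Finset.sum_add_distrib, ← Finset.mul_sum]
  have hN : ∑ μ ∈ E, ∑ ν ∈ E, (x μ ^ 2 + x ν ^ 2) / 2 * n μ ν ≤ ∑ μ ∈ E, x μ ^ 2 := by
    have e1 : ∑ μ ∈ E, ∑ ν ∈ E, (x μ ^ 2 + x ν ^ 2) / 2 * n μ ν =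
        (∑ μ ∈ E, ∑ ν ∈ E, x μ ^ 2 * n μ ν + ∑ μ ∈ E, ∑ ν ∈ E, x ν ^ 2 * n μ ν) / 2 := by
      rw [← Finset.sum_add_distrib, Finset.sum_div]
      refine Finset.sum_congr rfl fun μ _ => ?_
      rw [← Finset.sum_add_distrib, Finset.sum_div]
      refine Finset.sum_congr rfl fun ν _ => by ring
    have e2 : ∑ μ ∈ E, ∑ ν ∈ E, x ν ^ 2 * n μ ν = ∑ μ ∈ E, ∑ ν ∈ E, x μ ^ 2 * n μ ν := by
      rw [Finset.sum_comm]
      refine Finset.sum_congr rfl fun μ _ => Finset.sum_congr rfl fun ν _ => by rw [hns]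
    have e3 : ∑ μ ∈ E, ∑ ν ∈ E, x μ ^ 2 * n μ ν ≤ ∑ μ ∈ E, x μ ^ 2 := by
      refine Finset.sum_le_sum fun μ hμ => ?_
      rw [← Finset.mul_sum]
      nlinarith [hrow μ hμ, sq_nonneg (x μ)]
    rw [e1, e2]
    linarith
  have hM : ∑ μ ∈ E, x μ * ∑ ν ∈ E, x ν ≤ E.card * ∑ μ ∈ E, x μ ^ 2 := by
    rw [← Finset.sum_mul, ← sq]
    exact sq_sum_le_card_mul_sum_sq
  nlinarith [mul_le_mul_of_nonneg_left hN hP, mul_le_mul_of_nonneg_left hM hε]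

theorem abs_integral_normSq_sum_sub_le {γ : ℝ → ℝ × ℝ} (hγ : ContDiff ℝ (⊤ : ℕ∞) γ)
    (E : Finset (ℤ × ℤ)) (b : ℤ × ℤ → ℝ → ℂ) (hb : ∀ μ, Continuous (b μ)) (p q : ℝ) :
    |(∫ t in p..q, ‖∑ μ ∈ E, b μ t * osc (phase γ (iv μ)) t‖ ^ 2) -
      ∑ μ ∈ E, ∫ t in p..q, ‖b μ t‖ ^ 2| ≤
    ∑ μ ∈ E, ∑ ν ∈ E.erase μ,
      ‖∫ t in p..q, b μ t * starRingEnd ℂ (b ν t) * osc (phase γ (iv (μ - ν))) t‖ := by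
  have hco : ∀ v, Continuous (osc (phase γ v)) := fun v =>
    continuous_osc (continuous_phase hγ v)
  have hbs : ∀ ν, Continuous fun t => starRingEnd ℂ (b ν t) :=
    fun ν => Complex.continuous_conj.comp (hb ν)
  set J : ℤ × ℤ → ℤ × ℤ → ℂ := fun μ ν =>
    ∫ t in p..q, b μ t * starRingEnd ℂ (b ν t) * osc (phase γ (iv (μ - ν))) t with hJ
  have hsum : ((∫ t in p..q, ‖∑ μ ∈ E, b μ t * osc (phase γ (iv μ)) t‖ ^ 2 : ℝ) : ℂ) =
      ∑ μ ∈ E, ∑ ν ∈ E, J μ ν := by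
    rw [← intervalIntegral.integral_ofReal]
    have : ∀ t, ((‖∑ μ ∈ E, b μ t * osc (phase γ (iv μ)) t‖ ^ 2 : ℝ) : ℂ) =
        ∑ μ ∈ E, ∑ ν ∈ E, b μ t * starRingEnd ℂ (b ν t) * osc (phase γ (iv (μ - ν))) t := by
      intro t
      push_cast
      rw [← Complex.mul_conj', map_sum, Finset.sum_mul_sum]
      refine Finset.sum_congr rfl fun μ _ => Finset.sum_congr rfl fun ν _ => ?_
      rw [map_mul, iv_sub, osc_phase_sub]
      ring
    simp_rw [this]
    rw [intervalIntegral.integral_finsetSum]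
    · refine Finset.sum_congr rfl fun μ _ => ?_
      rw [intervalIntegral.integral_finsetSum]
      intro ν _
      exact (((hb μ).mul (hbs ν)).mul (hco _)).intervalIntegrable _ _
    · intro μ _
      exact (continuous_finsetSum _ fun ν _ =>
        ((hb μ).mul (hbs ν)).mul (hco _)).intervalIntegrable _ _
  have hdiag : ∀ μ, J μ μ = ((∫ t in p..q, ‖b μ t‖ ^ 2 : ℝ) : ℂ) := by
    intro μ
    rw [← intervalIntegral.integral_ofReal]
    refine intervalIntegral.integral_congr fun t _ => ?_
    simp [osc, phase, iv, Complex.mul_conj']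
  rw [← Real.norm_eq_abs, ← Complex.norm_real]
  push_cast
  rw [hsum]
  simp_rw [← hdiag]
  rw [← Finset.sum_sub_distrib]
  refine (norm_sum_le _ _).trans (Finset.sum_le_sum fun μ hμ => ?_)
  rw [← Finset.add_sum_erase _ _ hμ, add_sub_cancel_left]
  exact norm_sum_le _ _

/-- The average of `e^{i(φ(y) - φ(t))}` over the window `[t, t+h]`, times `h`. -/
def windowAmp (φ : ℝ → ℝ) (h t : ℝ) : ℂ := starRingEnd ℂ (osc φ t) * ∫ y in t..(t + h), osc φ y

theorem windowAmp_mul_osc {φ : ℝ → ℝ} (h t : ℝ) :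
    windowAmp φ h t * osc φ t = ∫ y in t..(t + h), osc φ y := by
  rw [windowAmp, mul_right_comm, Complex.conj_mul', norm_osc]
  simp

theorem norm_windowAmp (φ : ℝ → ℝ) (h t : ℝ) :
    ‖windowAmp φ h t‖ = ‖∫ y in t..(t + h), osc φ y‖ := by
  rw [windowAmp, norm_mul, RCLike.norm_conj, norm_osc, one_mul]

section

variable {φ φ1 : ℝ → ℝ}

theorem hasDerivAt_windowAmp (h1 : ∀ t, HasDerivAt φ (φ1 t) t) (hc : Continuous φ1) (h t : ℝ) :
    HasDerivAt (windowAmp φ h) (starRingEnd ℂ (osc φ t) *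
      ∫ y in t..(t + h), Complex.I * ((φ1 y - φ1 t : ℝ) : ℂ) * osc φ y) t := by
  have hcφ : Continuous φ := continuous_iff_continuousAt.2 fun t => (h1 t).continuousAt
  have hco := continuous_osc hcφ
  set F : ℝ → ℂ := fun x => ∫ y in (0:ℝ)..x, osc φ y with hF
  have hFd : ∀ x, HasDerivAt F (osc φ x) x :=
    fun x => (hco.integral_hasStrictDerivAt _ _).hasDerivAt
  have hi : ∀ x y : ℝ, IntervalIntegrable (osc φ) volume x y := fun x y => hco.intervalIntegrable _ _
  have hJ : ∀ x, ∫ y in x..(x + h), osc φ y = F (x + h) - F x := fun x =>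
    (intervalIntegral.integral_interval_sub_left (hi _ _) (hi _ _)).symm
  have hFh : HasDerivAt (fun x => F (x + h) - F x) (osc φ (t + h) - osc φ t) t :=
    ((hFd (t + h)).comp_add_const t h).sub (hFd t)
  have hs : HasDerivAt (fun x => starRingEnd ℂ (osc φ x))
      (Complex.I * ((-φ1 t : ℝ) : ℂ) * starRingEnd ℂ (osc φ t)) t := by
    simp_rw [star_osc]
    exact hasDerivAt_osc (h1 t).neg
  have hprod := hs.mul hFh
  have hfun : windowAmp φ h = fun x => starRingEnd ℂ (osc φ x) * (F (x + h) - F x) := by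
    funext x
    rw [windowAmp, hJ]
  rw [hfun]
  have hci : Continuous fun y => Complex.I * (φ1 y : ℂ) * osc φ y := by fun_prop
  have hftc : ∫ y in t..(t + h), Complex.I * (φ1 y : ℂ) * osc φ y = osc φ (t + h) - osc φ t :=
    intervalIntegral.integral_eq_sub_of_hasDerivAt (fun y _ => hasDerivAt_osc (h1 y))
      (hci.intervalIntegrable _ _)
  have hsplit : ∫ y in t..(t + h), Complex.I * ((φ1 y - φ1 t : ℝ) : ℂ) * osc φ y =
      (osc φ (t + h) - osc φ t) - Complex.I * (φ1 t : ℂ) * (F (t + h) - F t) := by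
    rw [← hftc, ← hJ, ← intervalIntegral.integral_const_mul, ← intervalIntegral.integral_sub
      (hci.intervalIntegrable _ _) ((hco.const_mul _).intervalIntegrable _ _)]
    refine intervalIntegral.integral_congr fun y _ => ?_
    push_cast
    ring
  convert! hprod using 1
  rw [hsplit]
  push_cast
  ring

theorem continuous_deriv_windowAmp (h1 : ∀ t, HasDerivAt φ (φ1 t) t) (hc : Continuous φ1) (h : ℝ) :
    Continuous fun t => starRingEnd ℂ (osc φ t) *
      ∫ y in t..(t + h), Complex.I * ((φ1 y - φ1 t : ℝ) : ℂ) * osc φ y := by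
  have hcφ : Continuous φ := continuous_iff_continuousAt.2 fun t => (h1 t).continuousAt
  have hco := continuous_osc hcφ
  refine (Complex.continuous_conj.comp hco).mul ?_
  have : ∀ t, ∫ y in t..(t + h), Complex.I * ((φ1 y - φ1 t : ℝ) : ℂ) * osc φ y =
      ∫ u in (0:ℝ)..h, Complex.I * ((φ1 (u + t) - φ1 t : ℝ) : ℂ) * osc φ (u + t) := by
    intro t
    rw [intervalIntegral.integral_comp_add_right
      (fun y => Complex.I * ((φ1 y - φ1 t : ℝ) : ℂ) * osc φ y) t, zero_add, add_comm h t]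
  simp_rw [this]
  apply intervalIntegral.continuous_parametric_intervalIntegral_of_continuous'
  fun_prop

theorem norm_deriv_windowAmp_le {h t Q : ℝ} (hh : 0 ≤ h)
    (hQ : ∀ y ∈ Set.Icc t (t + h), |φ1 y - φ1 t| ≤ Q) :
    ‖starRingEnd ℂ (osc φ t) *
      ∫ y in t..(t + h), Complex.I * ((φ1 y - φ1 t : ℝ) : ℂ) * osc φ y‖ ≤ Q * h := by
  rw [norm_mul, RCLike.norm_conj, norm_osc, one_mul]
  have := intervalIntegral.norm_integral_le_of_norm_le_const (a := t) (b := t + h) (C := Q)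
    (f := fun y => Complex.I * ((φ1 y - φ1 t : ℝ) : ℂ) * osc φ y) (fun y hy => by
      rw [Set.uIoc_of_le (by linarith)] at hy
      rw [norm_mul, norm_mul, norm_osc, Complex.norm_I, Complex.norm_real, Real.norm_eq_abs]
      simpa using hQ y ⟨hy.1.le, hy.2⟩)
  simpa [abs_of_nonneg hh] using this

theorem norm_windowAmp_le (φ : ℝ → ℝ) {h : ℝ} (hh : 0 ≤ h) (t : ℝ) : ‖windowAmp φ h t‖ ≤ h := by
  rw [norm_windowAmp]
  simpa using norm_integral_osc_le (φ := φ) (a := t) (b := t + h) (by linarith)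

end

namespace IsCurvedArc

variable {γ : ℝ → ℝ × ℝ} {α β c K : ℝ}

theorem abs_phase_deriv_sub_le (A : IsCurvedArc γ α β c K) (v : ℝ × ℝ) {x y : ℝ}
    (hx : x ∈ Set.Icc α β) (hy : y ∈ Set.Icc α β) :
    |phase (deriv γ) v y - phase (deriv γ) v x| ≤ K * e2 v * |y - x| := by
  have hs1 := contDiff_deriv_of_top A.smooth
  have := (convex_Icc α β).norm_image_sub_le_of_norm_hasDerivWithin_le
    (f := phase (deriv γ) v) (fun t _ => (hasDerivAt_phase hs1 v t).hasDerivWithinAt)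
    (fun t ht => A.bound_two v t ht) hx hy
  simpa [Real.norm_eq_abs] using this

theorem norm_windowAmp_le_of_large (A : IsCurvedArc γ α β c K) {v : ℝ × ℝ} {h θ t : ℝ}
    (hv : 0 < e2 v) (hh : 0 ≤ h) (hθ : 0 < θ) (hKh : 2 * K * h ≤ θ) (h0 : α ≤ t) (h1 : t + h ≤ β)
    (hl : θ * e2 v ≤ |phase (deriv γ) v t|) :
    ‖windowAmp (phase γ v) h t‖ ≤ 6 / (θ * e2 v) := by
  have hs1 := contDiff_deriv_of_top A.smooth
  have hs2 := contDiff_deriv_of_top hs1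
  have hK := A.one_le
  rw [norm_windowAmp]
  have hsub : ∀ y ∈ Set.Icc t (t + h), y ∈ Set.Icc α β := fun y hy =>
    ⟨h0.trans hy.1, hy.2.trans h1⟩
  refine (norm_integral_osc_le_of_deriv_of_bound (hasDerivAt_phase A.smooth v)
    (hasDerivAt_phase hs1 v) (continuous_phase hs2 v) (by linarith) (m := θ * e2 v / 2)
    (by positivity) (fun y hy => ?_) (fun y hy => A.bound_two v y (hsub y hy))).trans ?_
  · have := A.abs_phase_deriv_sub_le v (hsub t ⟨le_rfl, by linarith⟩) (hsub y hy)
    rw [abs_of_nonneg (by linarith [hy.1] : 0 ≤ y - t)] at this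
    have h3 : K * e2 v * (y - t) ≤ θ * e2 v / 2 := by
      have : K * e2 v * (y - t) ≤ K * e2 v * h := by
        gcongr
        linarith [hy.2]
      nlinarith
    have h4 := abs_sub_abs_le_abs_sub (phase (deriv γ) v t) (phase (deriv γ) v y)
    rw [abs_sub_comm] at h4
    linarith
  · rw [add_sub_cancel_left]
    have e : 2 / (θ * e2 v / 2) + h * (K * e2 v) / (θ * e2 v / 2) ^ 2 =
        (4 + 2 * (2 * K * h) / θ) / (θ * e2 v) := by
      field_simp
      ring
    rw [e]
    gcongr
    have : 2 * K * h / θ ≤ 1 := (div_le_one hθ).2 hKh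
    have e' : 2 * (2 * K * h) / θ = 2 * (2 * K * h / θ) := by ring
    rw [e']
    linarith

theorem exists_center_of_small_deriv (A : IsCurvedArc γ α β c K) {v : ℝ × ℝ} {θ : ℝ}
    (hv : 0 < e2 v) (hθc : θ ≤ c) :
    ∃ x : ℝ, ∀ t ∈ Set.Icc α β, |phase (deriv γ) v t| < θ * e2 v →
      t ∈ Set.Icc (x - 2 * θ / c) (x + 2 * θ / c) := by
  have hs1 := contDiff_deriv_of_top A.smooth
  have hs2 := contDiff_deriv_of_top hs1
  have hc := A.c_pos
  by_cases hex : ∃ x ∈ Set.Icc α β, |phase (deriv γ) v x| < θ * e2 v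
  swap
  · push Not at hex
    exact ⟨0, fun t ht h => absurd h (not_lt.2 (hex t ht))⟩
  obtain ⟨x, hx, hxs⟩ := hex
  refine ⟨x, fun t ht hts => ?_⟩
  rcases A.dich v with h | h
  · have := h x hx
    nlinarith
  have hinc : ∀ s ∈ Set.Icc α β, ∀ t ∈ Set.Icc α β, s ≤ t →
      c * e2 v * (t - s) ≤ |phase (deriv γ) v t - phase (deriv γ) v s| := by
    intro s hs t ht hst
    rcases hst.eq_or_lt with rfl | hlt
    · simp
    obtain ⟨z, hz, hzeq⟩ := exists_hasDerivAt_eq_slope (phase (deriv γ) v)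
      (phase (deriv (deriv γ)) v) hlt (continuous_phase hs1 v).continuousOn
      (fun z _ => hasDerivAt_phase hs1 v z)
    have := h z ⟨hs.1.trans hz.1.le, hz.2.le.trans ht.2⟩
    rw [hzeq, abs_div, abs_of_pos (by linarith : 0 < t - s), le_div_iff₀ (by linarith)] at this
    exact this
  have hkey : ∀ s ∈ Set.Icc α β, ∀ t ∈ Set.Icc α β, s ≤ t →
      |phase (deriv γ) v s| < θ * e2 v → |phase (deriv γ) v t| < θ * e2 v →
      t - s ≤ 2 * θ / c := by
    intro s hs t ht hst h1 h2
    have h3 := hinc s hs t ht hst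
    have h4 := abs_sub (phase (deriv γ) v t) (phase (deriv γ) v s)
    rw [le_div_iff₀ hc]
    by_contra hcon
    push Not at hcon
    nlinarith
  have hθ : 0 < θ := by
    by_contra hcon
    push Not at hcon
    have := abs_nonneg (phase (deriv γ) v x)
    nlinarith
  have hpos : 0 ≤ 2 * θ / c := by positivity
  rcases le_total x t with hxt | hxt
  · have := hkey x hx t ht hxt hxs hts
    constructor <;> linarith
  · have := hkey t ht x hx hxt hts hxs
    constructor <;> linarith

theorem integral_normSq_windowAmp_le (A : IsCurvedArc γ α β c K) {v : ℝ × ℝ} {h θ : ℝ}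
    (hv : 0 < e2 v) (hh : 0 ≤ h) (hhl : h ≤ β - α) (hθ : 0 < θ) (hKh : 2 * K * h ≤ θ)
    (hθc : θ ≤ c) :
    ∫ t in α..(β - h), ‖windowAmp (phase γ v) h t‖ ^ 2 ≤
      4 * θ / c * h ^ 2 + (β - α) * (6 / (θ * e2 v)) ^ 2 := by
  have hs1 := contDiff_deriv_of_top A.smooth
  have hc := A.c_pos
  obtain ⟨x, hx⟩ := A.exists_center_of_small_deriv hv hθc
  set S := Set.Icc (x - 2 * θ / c) (x + 2 * θ / c) with hS
  set e := (6 / (θ * e2 v)) ^ 2 with he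
  have hle : α ≤ β - h := by linarith
  have hcw : Continuous (windowAmp (phase γ v) h) := continuous_iff_continuousAt.2 fun t =>
    (hasDerivAt_windowAmp (hasDerivAt_phase A.smooth v) (continuous_phase hs1 v) h t).continuousAt
  rw [intervalIntegral.integral_of_le hle]
  have hSm : MeasurableSet S := measurableSet_Icc
  have hSi : Integrable (S.indicator fun _ => h ^ 2) (volume.restrict (Set.Ioc α (β - h))) :=
    (integrable_const _).indicator hSm
  calc ∫ t in Set.Ioc α (β - h), ‖windowAmp (phase γ v) h t‖ ^ 2
      ≤ ∫ t in Set.Ioc α (β - h), (S.indicator (fun _ => h ^ 2) t + e) := by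
        refine setIntegral_mono_on ?_ (hSi.add (integrable_const _)) measurableSet_Ioc ?_
        · have : Continuous fun t => ‖windowAmp (phase γ v) h t‖ ^ 2 := by fun_prop
          exact this.integrableOn_Ioc
        · intro t ht
          have htI : t ∈ Set.Icc α β := ⟨ht.1.le, by linarith [ht.2]⟩
          by_cases hts : |phase (deriv γ) v t| < θ * e2 v
          · rw [Set.indicator_of_mem (hx t htI hts)]
            have := pow_le_pow_left₀ (norm_nonneg _) (norm_windowAmp_le (phase γ v) hh t) 2
            have : 0 ≤ e := by positivity
            linarith
          · push Not at hts
            have h1 := A.norm_windowAmp_le_of_large hv hh hθ hKh ht.1.le (by linarith [ht.2]) hts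
            have h2 := pow_le_pow_left₀ (norm_nonneg _) h1 2
            have : 0 ≤ S.indicator (fun _ => h ^ 2) t :=
              Set.indicator_nonneg (fun _ _ => by positivity) _
            linarith
    _ = (∫ t in Set.Ioc α (β - h), S.indicator (fun _ => h ^ 2) t) + (β - h - α) * e := by
        rw [integral_add hSi (integrable_const _)]
        simp [Measure.real, hle]
    _ ≤ 4 * θ / c * h ^ 2 + (β - α) * e := by
        have h1 : ∫ t in Set.Ioc α (β - h), S.indicator (fun _ => h ^ 2) t ≤
            ∫ t, S.indicator (fun _ => h ^ 2) t := by
          apply setIntegral_le_integral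
          · rw [integrable_indicator_iff hSm]
            exact integrableOn_const (by simp [hS])
          · exact Filter.Eventually.of_forall fun t =>
              Set.indicator_nonneg (fun _ _ => by positivity) _
        have h2 : ∫ t, S.indicator (fun _ => h ^ 2) t = 4 * θ / c * h ^ 2 := by
          rw [integral_indicator hSm, setIntegral_const, hS, Measure.real, Real.volume_Icc,
            ENNReal.toReal_ofReal (by have : 0 < 2 * θ / c := by positivity
                                      linarith), smul_eq_mul]
          ring
        have h3 : (β - h - α) * e ≤ (β - α) * e := by
          have : 0 ≤ e := by positivity
          nlinarith
        linarith

end IsCurvedArc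

theorem norm_integral_mul_le_of_sq {f g : ℝ → ℂ} (hf : Continuous f) (hg : Continuous g) {p q δ : ℝ}
    (hpq : p ≤ q) (h1 : ∫ t in p..q, ‖f t‖ ^ 2 ≤ δ) (h2 : ∫ t in p..q, ‖g t‖ ^ 2 ≤ δ)
    {φ : ℝ → ℝ} :
    ‖∫ t in p..q, f t * starRingEnd ℂ (g t) * osc φ t‖ ≤ δ := by
  have hi1 : IntervalIntegrable (fun t => ‖f t‖ ^ 2) volume p q :=
    Continuous.intervalIntegrable (by fun_prop) _ _
  have hi2 : IntervalIntegrable (fun t => ‖g t‖ ^ 2) volume p q :=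
    Continuous.intervalIntegrable (by fun_prop) _ _
  have h := intervalIntegral.norm_integral_le_of_norm_le (μ := volume) hpq
    (f := fun t => f t * starRingEnd ℂ (g t) * osc φ t)
    (g := fun t => (1 / 2 : ℝ) * (‖f t‖ ^ 2 + ‖g t‖ ^ 2)) (Filter.Eventually.of_forall fun t _ => by
      rw [norm_mul, norm_mul, norm_osc, RCLike.norm_conj]
      nlinarith [sq_nonneg (‖f t‖ - ‖g t‖)]) ((hi1.add hi2).const_mul _)
  rw [intervalIntegral.integral_const_mul, intervalIntegral.integral_add hi1 hi2] at h
  linarith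

namespace IsCurvedArc

variable {γ : ℝ → ℝ × ℝ} {α β c K : ℝ}

theorem exists_le_integral_normSq (A : IsCurvedArc γ α β c K) {p q : ℝ} (hp : α ≤ p)
    (hpq : p < q) (hq : q ≤ β) : ∃ κ C : ℝ, 0 < κ ∧ 0 < C ∧ ∀ lam D : ℝ, 0 ≤ lam → 1 ≤ D →
      8 * D ^ 3 ≤ 2 * lam → C * (Elat lam).card ≤ √D → ∀ a : ℤ × ℤ → ℂ,
        κ * ∑ μ ∈ Elat lam, ‖a μ‖ ^ 2 ≤ ∫ t in p..q, ‖efn lam a (γ t)‖ ^ 2 := by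
  classical
  obtain ⟨κ, hκ, hgap⟩ := A.exists_norm_integral_osc_le_gap hp hpq hq
  obtain ⟨C, hC, hdec⟩ := A.exists_norm_integral_osc_le
  refine ⟨κ / 2, 2 * C / κ, by positivity, by positivity, ?_⟩
  intro lam D hl hD hD3 hCM a
  have hsD : 0 < √D := Real.sqrt_pos.2 (by linarith)
  have hP : 0 ≤ q - p - κ := (norm_nonneg _).trans (hgap (1, 0) (by simp))
  have h1 := abs_integral_normSq_sum_sub_le A.smooth (Elat lam) (fun μ _ => a μ)
    (fun _ => continuous_const) p q
  simp only [intervalIntegral.integral_const, smul_eq_mul, ← Finset.mul_sum] at h1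
  have h2 := sum_sum_erase_le (Elat lam) (fun μ ν => e2 (iv (μ - ν)) < D)
    (fun μ ν h => by rwa [iv_sub, e2_sub_comm, ← iv_sub])
    (fun μ hμ => card_near_le_one hl hD3 hμ (Finset.filter_subset _ _)
      (fun ν hν => (Finset.mem_filter.1 hν).2)) (fun μ => ‖a μ‖) (fun μ => norm_nonneg _)
    (fun μ ν => ‖∫ x in p..q, osc (phase γ (iv (μ - ν))) x‖) (P := q - p - κ) (ε := C / √D)
    hP (by positivity)
    (fun μ _ ν _ hne _ => hgap _ (sub_ne_zero.2 hne))
    (fun μ _ ν _ hn => by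
      push Not at hn
      refine (hdec p q hp hpq.le hq _ (hD.trans hn)).trans ?_
      gcongr)
  have h3 : ∑ μ ∈ Elat lam, ∑ ν ∈ (Elat lam).erase μ,
      ‖∫ t in p..q, a μ * starRingEnd ℂ (a ν) * osc (phase γ (iv (μ - ν))) t‖ =
      ∑ μ ∈ Elat lam, ∑ ν ∈ (Elat lam).erase μ, ‖a μ‖ * ‖a ν‖ *
      ‖∫ x in p..q, osc (phase γ (iv (μ - ν))) x‖ := by
    refine Finset.sum_congr rfl fun μ _ => Finset.sum_congr rfl fun ν _ => ?_
    rw [intervalIntegral.integral_const_mul, norm_mul, norm_mul, RCLike.norm_conj]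
  rw [h3] at h1
  simp only [efn_eq_sum_osc]
  have hσ : 0 ≤ ∑ μ ∈ Elat lam, ‖a μ‖ ^ 2 := Finset.sum_nonneg fun _ _ => by positivity
  have h4 : C / √D * (Elat lam).card ≤ κ / 2 := by
    rw [div_mul_eq_mul_div, div_le_iff₀ hsD]
    have := hCM
    rw [div_mul_eq_mul_div, div_le_iff₀ hκ] at this
    linarith
  have h5 := neg_le_of_abs_le h1
  nlinarith [mul_le_mul_of_nonneg_right h4 hσ]

theorem exists_integral_window_le (A : IsCurvedArc γ α β c K) : ∃ C : ℝ, 0 < C ∧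
    ∀ lam D h θ : ℝ, 0 < lam → 1 ≤ D → 8 * D ^ 3 ≤ 2 * lam → 0 < h → h ≤ β - α → 0 < θ →
      2 * K * h ≤ θ → θ ≤ c → ∀ a : ℤ × ℤ → ℂ,
        ∫ t in α..(β - h), ‖∫ y in t..(t + h), efn lam a (γ y)‖ ^ 2 ≤
          C * h ^ 2 * (θ + 1 / (θ * (lam * h)) ^ 2 + (1 + lam * h) * (Elat lam).card / √D) *
            ∑ μ ∈ Elat lam, ‖a μ‖ ^ 2 := by
  classical
  obtain ⟨C, hC, hdec⟩ := A.exists_norm_integral_mul_osc_le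
  have hc := A.c_pos
  have hK := A.one_le
  have hab := A.lt
  have hs1 := contDiff_deriv_of_top A.smooth
  have hℓ : 0 < β - α := by linarith
  refine ⟨max (2 * (4 / c)) (max (2 * (36 * (β - α))) (C * (1 + 2 * (β - α) * K))),
    by positivity, ?_⟩
  set C' := max (2 * (4 / c)) (max (2 * (36 * (β - α))) (C * (1 + 2 * (β - α) * K))) with hC'
  have hC1 : 2 * (4 / c) ≤ C' := le_max_left _ _
  have hC2 : 2 * (36 * (β - α)) ≤ C' := (le_max_left _ _).trans (le_max_right _ _)
  have hC3 : C * (1 + 2 * (β - α) * K) ≤ C' := (le_max_right _ _).trans (le_max_right _ _)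
  intro lam D h θ hl hD hD3 hh hhl hθ hKh hθc a
  have hsD : 0 < √D := Real.sqrt_pos.2 (by linarith)
  set w : ℤ × ℤ → ℝ → ℂ := fun μ => windowAmp (phase γ (iv μ)) h with hw
  have hwd : ∀ μ t, HasDerivAt (w μ) (starRingEnd ℂ (osc (phase γ (iv μ)) t) *
      ∫ y in t..(t + h), Complex.I * ((phase (deriv γ) (iv μ) y - phase (deriv γ) (iv μ) t : ℝ) : ℂ)
        * osc (phase γ (iv μ)) y) t := fun μ t =>
    hasDerivAt_windowAmp (hasDerivAt_phase A.smooth (iv μ)) (continuous_phase hs1 _) h t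
  have hwc : ∀ μ, Continuous (w μ) := fun μ =>
    continuous_iff_continuousAt.2 fun t => (hwd μ t).continuousAt
  have hwdc := fun μ => continuous_deriv_windowAmp (hasDerivAt_phase A.smooth (iv μ))
    (continuous_phase hs1 (iv μ)) h
  have hG : ∀ t, ∫ y in t..(t + h), efn lam a (γ y) =
      ∑ μ ∈ Elat lam, (a μ * w μ t) * osc (phase γ (iv μ)) t := by
    intro t
    simp only [efn_eq_sum_osc]
    rw [intervalIntegral.integral_finsetSum]
    · refine Finset.sum_congr rfl fun μ _ => ?_
      rw [intervalIntegral.integral_const_mul, mul_assoc, windowAmp_mul_osc]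
    · intro μ _
      exact ((continuous_osc (continuous_phase A.smooth _)).const_mul _).intervalIntegrable _ _
  simp_rw [hG]
  set δ := 4 * θ / c * h ^ 2 + (β - α) * (6 / (θ * lam)) ^ 2 with hδ
  have hδ0 : 0 ≤ δ := by positivity
  have hdiag : ∀ μ ∈ Elat lam, ∫ t in α..(β - h), ‖w μ t‖ ^ 2 ≤ δ := by
    intro μ hμ
    have e := e2_iv_of_mem hl.le hμ
    have := A.integral_normSq_windowAmp_le (v := iv μ) (by rw [e]; exact hl) hh.le hhl hθ hKh hθc
    rwa [e] at this
  have h1 := abs_integral_normSq_sum_sub_le A.smooth (Elat lam) (fun μ t => a μ * w μ t)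
    (fun μ => (hwc μ).const_mul _) α (β - h)
  set ε := C / √D * (h ^ 2 + (β - α) * (2 * (K * lam * h * h) * h)) with hε
  have h2 := sum_sum_erase_le (Elat lam) (fun μ ν => e2 (iv (μ - ν)) < D)
    (fun μ ν h => by rwa [iv_sub, e2_sub_comm, ← iv_sub])
    (fun μ hμ => card_near_le_one hl.le hD3 hμ (Finset.filter_subset _ _)
      (fun ν hν => (Finset.mem_filter.1 hν).2)) (fun μ => ‖a μ‖) (fun μ => norm_nonneg _)
    (fun μ ν => ‖∫ t in α..(β - h), w μ t * starRingEnd ℂ (w ν t) *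
      osc (phase γ (iv (μ - ν))) t‖) (P := δ) (ε := ε)
    hδ0 (by positivity)
    (fun μ hμ ν hν hne _ => norm_integral_mul_le_of_sq (hwc μ) (hwc ν) (by linarith)
      (hdiag μ hμ) (hdiag ν hν))
    (fun μ hμ ν hν hn => by
      push Not at hn
      have hstar : ∀ t, HasDerivAt (fun t => starRingEnd ℂ (w ν t)) (starRingEnd ℂ
        (starRingEnd ℂ (osc (phase γ (iv ν)) t) * ∫ y in t..(t + h), Complex.I *
        ((phase (deriv γ) (iv ν) y - phase (deriv γ) (iv ν) t : ℝ) : ℂ)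
        * osc (phase γ (iv ν)) y)) t := fun t =>
        (Complex.conjCLE.toContinuousLinearMap.hasFDerivAt.comp_hasDerivAt t (hwd ν t))
      have hb : ∀ μ ∈ Elat lam, ∀ t ∈ Set.Icc α (β - h),
          ‖starRingEnd ℂ (osc (phase γ (iv μ)) t) * ∫ y in t..(t + h), Complex.I *
          ((phase (deriv γ) (iv μ) y - phase (deriv γ) (iv μ) t : ℝ) : ℂ)
          * osc (phase γ (iv μ)) y‖ ≤ K * lam * h * h := by
        intro μ hμ t ht
        apply norm_deriv_windowAmp_le hh.le
        intro y hy
        have := A.abs_phase_deriv_sub_le (iv μ) (x := t) (y := y)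
          ⟨ht.1, by linarith [ht.2]⟩ ⟨ht.1.trans hy.1, by linarith [ht.2, hy.2]⟩
        rw [e2_iv_of_mem hl.le hμ, abs_of_nonneg (by linarith [hy.1] : 0 ≤ y - t)] at this
        refine this.trans ?_
        gcongr
        linarith [hy.2]
      have hwb : ∀ μ t, ‖w μ t‖ ≤ h := fun μ t => norm_windowAmp_le _ hh.le t
      refine (hdec α (β - h) le_rfl (by linarith) (by linarith) _ (hD.trans hn)
        (fun t => w μ t * starRingEnd ℂ (w ν t)) _ (h ^ 2) (2 * (K * lam * h * h) * h)
        (fun t => (hwd μ t).mul (hstar t)) ?_ ?_ ?_).trans ?_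
      · exact ((hwdc μ).mul (Complex.continuous_conj.comp (hwc ν))).add
          ((hwc μ).mul (Complex.continuous_conj.comp (hwdc ν)))
      · intro t _
        rw [norm_mul, RCLike.norm_conj, sq]
        exact mul_le_mul (hwb _ _) (hwb _ _) (norm_nonneg _) hh.le
      · intro t ht
        refine (norm_add_le _ _).trans ?_
        have hQ0 : 0 ≤ K * lam * h * h := by positivity
        have i1 := mul_le_mul (hb μ hμ t ht) (hwb ν t) (norm_nonneg _) hQ0
        have i2 := mul_le_mul (hwb μ t) (hb ν hν t ht) (norm_nonneg _) hh.le
        rw [norm_mul _ (starRingEnd ℂ (w ν t)), norm_mul (w μ t), RCLike.norm_conj,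
          RCLike.norm_conj]
        linarith
      · rw [hε]
        gcongr)
  have h3 : ∑ μ ∈ Elat lam, ∑ ν ∈ (Elat lam).erase μ,
      ‖∫ t in α..(β - h), a μ * w μ t * starRingEnd ℂ (a ν * w ν t) *
        osc (phase γ (iv (μ - ν))) t‖ =
      ∑ μ ∈ Elat lam, ∑ ν ∈ (Elat lam).erase μ, ‖a μ‖ * ‖a ν‖ *
      ‖∫ t in α..(β - h), w μ t * starRingEnd ℂ (w ν t) * osc (phase γ (iv (μ - ν))) t‖ := by
    refine Finset.sum_congr rfl fun μ _ => Finset.sum_congr rfl fun ν _ => ?_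
    rw [← RCLike.norm_conj (a ν), ← norm_mul, ← norm_mul, ← intervalIntegral.integral_const_mul]
    congr 2
    funext t
    rw [map_mul]
    ring
  rw [h3] at h1
  have h4 : ∑ μ ∈ Elat lam, ∫ t in α..(β - h), ‖a μ * w μ t‖ ^ 2 ≤
      δ * ∑ μ ∈ Elat lam, ‖a μ‖ ^ 2 := by
    rw [Finset.mul_sum]
    refine Finset.sum_le_sum fun μ hμ => ?_
    simp only [norm_mul, mul_pow, intervalIntegral.integral_const_mul]
    rw [mul_comm]
    gcongr
    exact hdiag μ hμ
  have h5 := (abs_le.1 h1).2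
  have hσ : 0 ≤ ∑ μ ∈ Elat lam, ‖a μ‖ ^ 2 := Finset.sum_nonneg fun _ _ => by positivity
  have h6 : 2 * δ + ε * (Elat lam).card ≤
      C' * h ^ 2 * (θ + 1 / (θ * (lam * h)) ^ 2 + (1 + lam * h) * (Elat lam).card / √D) := by
    have i1 : 2 * (4 * θ / c * h ^ 2) ≤ C' * h ^ 2 * θ := by
      calc _ = 2 * (4 / c) * h ^ 2 * θ := by ring
        _ ≤ _ := by gcongr
    have i2 : 2 * ((β - α) * (6 / (θ * lam)) ^ 2) ≤ C' * h ^ 2 * (1 / (θ * (lam * h)) ^ 2) := by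
      calc _ = 2 * (36 * (β - α)) * h ^ 2 * (1 / (θ * (lam * h)) ^ 2) := by field_simp; ring
        _ ≤ _ := by gcongr
    have i3 : ε * (Elat lam).card ≤ C' * h ^ 2 * ((1 + lam * h) * (Elat lam).card / √D) := by
      calc ε * (Elat lam).card =
          C * (1 + 2 * (β - α) * K * (lam * h)) * h ^ 2 * (Elat lam).card / √D := by
            rw [hε]; field_simp
        _ ≤ C * ((1 + 2 * (β - α) * K) * (1 + lam * h)) * h ^ 2 * (Elat lam).card / √D := by
          gcongr
          have : 0 ≤ 2 * (β - α) * K := by positivity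
          have : 0 < lam * h := by positivity
          nlinarith
        _ = (C * (1 + 2 * (β - α) * K)) * h ^ 2 * ((1 + lam * h) * (Elat lam).card / √D) := by ring
        _ ≤ _ := by gcongr
    rw [hδ]
    linarith
  have h7 := mul_le_mul_of_nonneg_right h6 hσ
  linarith

end IsCurvedArc

/-- A decreasing profile of size `(1+u)^{-1/2}(1+a)^{-1/2}` for `u ≤ a` and
`(1+a)^{1/2}(1+u)^{-3/2}` for `u ≥ a`; its sum over the integers is bounded uniformly in `a`. -/
def profile (a u : ℝ) : ℝ := √(1 + a) / (√(1 + u) * (√(1 + u) + √(1 + a)) ^ 2)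

theorem profile_nonneg (a u : ℝ) : 0 ≤ profile a u := by unfold profile; positivity

theorem profile_antitone {a u v : ℝ} (hu : 0 ≤ u) (huv : u ≤ v) : profile a v ≤ profile a u := by
  unfold profile
  have : 0 < √(1 + u) := Real.sqrt_pos.2 (by linarith)
  gcongr

theorem sum_profile_le {a : ℝ} (ha : 0 ≤ a) (n : ℕ) :
    ∑ k ∈ Finset.range n, profile a k ≤ 6 := by
  set β := √(1 + a) with hβ
  have hβ0 : 0 < β := Real.sqrt_pos.2 (by linarith)
  let Φ : ℕ → ℝ := fun k => √(1 + k) / (√(1 + k) + β)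
  have hstep : ∀ k : ℕ, profile a k ≤ 6 * (Φ (k + 1) - Φ k) := by
    intro k
    simp only [profile, Φ, ← hβ]
    have hk : (0:ℝ) ≤ k := Nat.cast_nonneg k
    set X := √(1 + (k:ℝ)) with hX
    set Y := √(1 + ((k + 1 : ℕ) : ℝ)) with hY
    have hX1 : X ^ 2 = 1 + k := Real.sq_sqrt (by positivity)
    have hY1 : Y ^ 2 = 2 + k := by rw [hY, Real.sq_sqrt (by positivity)]; push_cast; ring
    have hX0 : 0 < X := Real.sqrt_pos.2 (by positivity)
    have hY0 : 0 < Y := Real.sqrt_pos.2 (by positivity)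
    have hYX : Y ≤ 2 * X := by
      refine (sq_le_sq₀ (by positivity) (by positivity)).1 ?_
      nlinarith
    have hdiff : (Y - X) * (Y + X) = 1 := by nlinarith
    have e : Y / (Y + β) - X / (X + β) = β / ((Y + X) * ((Y + β) * (X + β))) := by
      rw [div_sub_div _ _ (by positivity) (by positivity), div_eq_div_iff (by positivity)
        (by positivity)]
      linear_combination β * (Y + β) * (X + β) * hdiff
    rw [e, ← mul_div_assoc, div_le_div_iff₀ (by positivity) (by positivity)]
    have h1 : (Y + X) * ((Y + β) * (X + β)) ≤ 3 * X * ((2 * (X + β)) * (X + β)) := by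
      gcongr <;> linarith
    have h2 := mul_le_mul_of_nonneg_left h1 hβ0.le
    linarith
  calc ∑ k ∈ Finset.range n, profile a k ≤ ∑ k ∈ Finset.range n, 6 * (Φ (k + 1) - Φ k) :=
        Finset.sum_le_sum fun k _ => hstep k
    _ = 6 * (Φ n - Φ 0) := by rw [← Finset.mul_sum, Finset.sum_range_sub]
    _ ≤ 6 * 1 := by
      have h1 : Φ n ≤ 1 := by
        simp only [Φ]
        exact (div_le_one (by positivity)).2 (by linarith)
      have h0 : 0 ≤ Φ 0 := by simp only [Φ]; positivity
      linarith
    _ = 6 := by norm_num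

theorem le_profile_of_sq {a u T : ℝ} (ha : 0 ≤ a) (hu : 0 ≤ u) (hT : 0 ≤ T)
    (h : T ^ 2 * ((1 + u) * (2 + u + a) ^ 2) ≤ 108 * (1 + 2 * a)) : T ≤ 30 * profile a u := by
  unfold profile
  set X := √(1 + u) with hX
  set β := √(1 + a) with hβ
  have hX1 : X ^ 2 = 1 + u := Real.sq_sqrt (by positivity)
  have hβ1 : β ^ 2 = 1 + a := Real.sq_sqrt (by positivity)
  have hX0 : 0 < X := Real.sqrt_pos.2 (by positivity)
  have hβ0 : 0 < β := Real.sqrt_pos.2 (by positivity)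
  rw [← mul_div_assoc, le_div_iff₀ (by positivity)]
  refine (sq_le_sq₀ (by positivity) (by positivity)).1 ?_
  have h1 : (X + β) ^ 2 ≤ 2 * (X ^ 2 + β ^ 2) := by nlinarith [sq_nonneg (X - β)]
  calc (T * (X * (X + β) ^ 2)) ^ 2 = T ^ 2 * X ^ 2 * ((X + β) ^ 2) ^ 2 := by ring
    _ ≤ T ^ 2 * X ^ 2 * (2 * (X ^ 2 + β ^ 2)) ^ 2 := by gcongr
    _ = 4 * (T ^ 2 * ((1 + u) * (2 + u + a) ^ 2)) := by rw [hX1, hβ1]; ring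
    _ ≤ 4 * (108 * (1 + 2 * a)) := by gcongr
    _ ≤ 900 * β ^ 2 := by rw [hβ1]; linarith
    _ = _ := by ring

theorem le_sum_profile {d e T : ℝ} (hT : 0 ≤ T)
    (h : T ^ 2 * ((1 + |d|) * (1 + |e|) * (1 + |(d + e) / 2|)) ≤ 12 * (1 + 2 * (|d - e| / 2))) :
    T ≤ 30 * (profile (|d - e| / 2) |d| + profile (|d - e| / 2) |e| +
      profile (|d - e| / 2) |(d + e) / 2|) := by
  set a := |d - e| / 2 with ha
  set p := |d| with hp
  set q := |e| with hq
  set r := |(d + e) / 2| with hr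
  have hp0 : 0 ≤ p := abs_nonneg _
  have hq0 : 0 ≤ q := abs_nonneg _
  have hr0 : 0 ≤ r := abs_nonneg _
  have ha0 : 0 ≤ a := by positivity
  have hr' : r = |d + e| / 2 := by rw [hr, abs_div]; norm_num
  have t1 : 2 * a ≤ p + q := by
    have := abs_sub d e
    linarith
  have t2 : a ≤ r + p := by
    have := abs_sub (2 * d) (d + e)
    rw [show 2 * d - (d + e) = d - e by ring, abs_mul, abs_two] at this
    linarith
  have t3 : a ≤ r + q := by
    have := abs_sub (2 * e) (d + e)
    rw [show 2 * e - (d + e) = e - d by ring, abs_mul, abs_two, abs_sub_comm e d] at this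
    linarith
  have P1 := profile_nonneg a p
  have P2 := profile_nonneg a q
  have P3 := profile_nonneg a r
  have key : ∀ u y z : ℝ, 0 ≤ u → 0 ≤ y → 0 ≤ z → 2 + u + a ≤ 3 * (1 + y) →
      2 + u + a ≤ 3 * (1 + z) → (1 + p) * (1 + q) * (1 + r) = (1 + u) * ((1 + y) * (1 + z)) →
      T ≤ 30 * profile a u := by
    intro u y z hu hy hz h1 h2 h3
    apply le_profile_of_sq ha0 hu hT
    have h4 : (2 + u + a) ^ 2 ≤ 9 * ((1 + y) * (1 + z)) := by
      have := mul_le_mul h1 h2 (by positivity) (by positivity)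
      nlinarith
    calc T ^ 2 * ((1 + u) * (2 + u + a) ^ 2) ≤ T ^ 2 * ((1 + u) * (9 * ((1 + y) * (1 + z)))) := by
          gcongr
      _ = 9 * (T ^ 2 * ((1 + p) * (1 + q) * (1 + r))) := by rw [h3]; ring
      _ ≤ _ := by linarith
  rcases le_total p q with h1 | h1
  · rcases le_total p r with h2 | h2
    · have := key p q r hp0 hq0 hr0 (by linarith) (by linarith) (by ring)
      linarith
    · have := key r p q hr0 hp0 hq0 (by linarith) (by linarith) (by ring)
      linarith
  · rcases le_total q r with h2 | h2
    · have := key q p r hq0 hp0 hr0 (by linarith) (by linarith) (by ring)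
      linarith
    · have := key r p q hr0 hp0 hq0 (by linarith) (by linarith) (by ring)
      linarith

theorem sum_comp_abs_sub_le {ι : Type*} (S : Finset ι) (x : ι → ℝ) {B : ℕ}
    (hB : ∀ z : ℝ, (S.filter fun ν => z ≤ x ν ∧ x ν ≤ z + 1).card ≤ B)
    (g : ℝ → ℝ) (hg : ∀ u v, 0 ≤ u → u ≤ v → g v ≤ g u) (hg0 : ∀ u, 0 ≤ g u) {s : ℝ}
    (hs : ∀ n : ℕ, ∑ k ∈ Finset.range n, g k ≤ s) (z : ℝ) :
    ∑ ν ∈ S, g |x ν - z| ≤ 2 * B * s := by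
  classical
  obtain ⟨n, hn⟩ : ∃ n : ℕ, ∀ ν ∈ S, ⌊|x ν - z|⌋₊ < n :=
    ⟨S.sup (fun ν => ⌊|x ν - z|⌋₊) + 1, fun ν hν =>
      Nat.lt_succ_of_le (Finset.le_sup (f := fun ν => ⌊|x ν - z|⌋₊) hν)⟩
  rw [← Finset.sum_fiberwise_of_maps_to (t := Finset.range n) (g := fun ν => ⌊|x ν - z|⌋₊)
    (fun ν hν => Finset.mem_range.2 (hn ν hν))]
  calc ∑ k ∈ Finset.range n, ∑ ν ∈ S.filter (fun ν => ⌊|x ν - z|⌋₊ = k), g |x ν - z|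
      ≤ ∑ k ∈ Finset.range n, 2 * B * g k := by
        refine Finset.sum_le_sum fun k _ => ?_
        have hcard : (S.filter (fun ν => ⌊|x ν - z|⌋₊ = k)).card ≤ 2 * B := by
          have hsub : S.filter (fun ν => ⌊|x ν - z|⌋₊ = k) ⊆
              (S.filter fun ν => z + k ≤ x ν ∧ x ν ≤ z + k + 1) ∪
              (S.filter fun ν => z - k - 1 ≤ x ν ∧ x ν ≤ z - k - 1 + 1) := by
            intro ν hν
            rw [Finset.mem_filter] at hν
            have h := (Nat.floor_eq_iff (abs_nonneg _)).1 hν.2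
            simp only [Finset.mem_union, Finset.mem_filter, hν.1, true_and]
            rcases abs_cases (x ν - z) with ⟨h1, _⟩ | ⟨h1, _⟩ <;> rw [h1] at h
            · left; constructor <;> linarith [h.1, h.2]
            · right; constructor <;> linarith [h.1, h.2]
          have := (Finset.card_le_card hsub).trans (Finset.card_union_le _ _)
          have h1 := hB (z + k)
          have h2 := hB (z - k - 1)
          omega
        calc ∑ ν ∈ S.filter (fun ν => ⌊|x ν - z|⌋₊ = k), g |x ν - z|
            ≤ ∑ ν ∈ S.filter (fun ν => ⌊|x ν - z|⌋₊ = k), g k := by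
              refine Finset.sum_le_sum fun ν hν => hg _ _ (Nat.cast_nonneg _) ?_
              have h := (Finset.mem_filter.1 hν).2
              exact ((Nat.floor_eq_iff (abs_nonneg _)).1 h).1
          _ = (S.filter (fun ν => ⌊|x ν - z|⌋₊ = k)).card * g k := by
              rw [Finset.sum_const, nsmul_eq_mul]
          _ ≤ 2 * B * g k := by
              have : ((S.filter (fun ν => ⌊|x ν - z|⌋₊ = k)).card : ℝ) ≤ 2 * B := by
                exact_mod_cast hcard
              exact mul_le_mul_of_nonneg_right this (hg0 _)
    _ = 2 * B * ∑ k ∈ Finset.range n, g k := by rw [Finset.mul_sum]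
    _ ≤ _ := by
      gcongr
      exact hs n

theorem mul_sqrt_div_sqrt_le {m s n r k : ℝ} (h0 : 0 ≤ k) (h1 : k ≤ 1)
    (hbal : |m + s - n - r| ≤ 1) (h2 : k ^ 2 * (|m - n| * |m - r|) ≤ 1) :
    k * (√(1 + |m - s|) / √(1 + |n - r|)) ≤
      2 * ((if |n - m| ≤ 2 then 1 else 0) + (if |n - s| ≤ 2 then 1 else 0)) +
      30 * (profile (|m - s| / 2) |n - m| + profile (|m - s| / 2) |n - s| +
        profile (|m - s| / 2) |n - (m + s) / 2|) := by
  have P1 := profile_nonneg (|m - s| / 2) |n - m|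
  have P2 := profile_nonneg (|m - s| / 2) |n - s|
  have P3 := profile_nonneg (|m - s| / 2) |n - (m + s) / 2|
  have hI : ∀ u : ℝ, (0:ℝ) ≤ if u ≤ 2 then 1 else 0 := fun u => by split_ifs <;> norm_num
  have I1 := hI |n - m|
  have I2 := hI |n - s|
  have hsq : 0 < √(1 + |n - r|) := Real.sqrt_pos.2 (by positivity)
  have hb := abs_le.1 hbal
  have hWnear : |m - s| ≤ |n - r| + 3 → k * (√(1 + |m - s|) / √(1 + |n - r|)) ≤ 2 := by
    intro h
    have : √(1 + |m - s|) / √(1 + |n - r|) ≤ 2 := by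
      rw [div_le_iff₀ hsq]
      refine (Real.sqrt_le_sqrt (y := 2 ^ 2 * (1 + |n - r|)) ?_).trans ?_
      · linarith [abs_nonneg (n - r)]
      · rw [Real.sqrt_mul (by positivity), Real.sqrt_sq (by norm_num)]
    have h3 : 0 ≤ √(1 + |m - s|) / √(1 + |n - r|) := by positivity
    nlinarith
  by_cases hp : |m - n| ≤ 1
  · have := hWnear (by
      have e : m - s = (n - r) - (m + s - n - r) + 2 * (m - n) := by ring
      have a1 := abs_add_le ((n - r) - (m + s - n - r)) (2 * (m - n))
      have a2 := abs_sub (n - r) (m + s - n - r)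
      rw [abs_mul, abs_two] at a1
      rw [e]
      linarith)
    rw [if_pos (by rw [abs_sub_comm]; linarith : |n - m| ≤ 2)]
    linarith
  by_cases hq : |m - r| ≤ 1
  · have hq' := abs_le.1 hq
    have := hWnear (by
      have e : m - s = -(n - r) - (m + s - n - r) + 2 * (m - r) := by ring
      have a1 := abs_add_le (-(n - r) - (m + s - n - r)) (2 * (m - r))
      have a2 := abs_sub (-(n - r)) (m + s - n - r)
      rw [abs_neg] at a2
      rw [abs_mul, abs_two] at a1
      rw [e]
      linarith)
    rw [if_pos (by rw [abs_le]; constructor <;> linarith : |n - s| ≤ 2)]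
    linarith
  push Not at hp hq
  have hT : 0 ≤ k * (√(1 + |m - s|) / √(1 + |n - r|)) := by positivity
  have e1 : (n - m) - (n - s) = -(m - s) := by ring
  have e2 : ((n - m) + (n - s)) / 2 = n - (m + s) / 2 := by ring
  have := le_sum_profile (d := n - m) (e := n - s) hT (by
    rw [e1, e2, abs_neg, mul_pow, div_pow, Real.sq_sqrt (by positivity),
      Real.sq_sqrt (by positivity)]
    have g1 : 1 + |n - m| ≤ 2 * |m - n| := by rw [abs_sub_comm n m]; linarith
    have g2 : 1 + |n - s| ≤ 3 * |m - r| := by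
      have a1 := abs_sub (m - r) (m + s - n - r)
      rw [show m - r - (m + s - n - r) = n - s by ring] at a1
      linarith
    have g3 : 1 + |n - (m + s) / 2| ≤ 2 * (1 + |n - r|) := by
      have a1 := abs_sub (n - r) (m + s - n - r)
      rw [show n - r - (m + s - n - r) = 2 * (n - (m + s) / 2) by ring, abs_mul, abs_two] at a1
      linarith [abs_nonneg (n - r)]
    have hmul : (1 + |n - m|) * (1 + |n - s|) * (1 + |n - (m + s) / 2|) ≤
        (2 * |m - n|) * (3 * |m - r|) * (2 * (1 + |n - r|)) := by gcongr
    have hpos : 0 < 1 + |n - r| := by positivity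
    calc k ^ 2 * ((1 + |m - s|) / (1 + |n - r|)) *
          ((1 + |n - m|) * (1 + |n - s|) * (1 + |n - (m + s) / 2|))
        ≤ k ^ 2 * ((1 + |m - s|) / (1 + |n - r|)) *
          ((2 * |m - n|) * (3 * |m - r|) * (2 * (1 + |n - r|))) := by gcongr
      _ = 12 * (1 + |m - s|) * (k ^ 2 * (|m - n| * |m - r|)) := by field_simp; ring
      _ ≤ 12 * (1 + |m - s|) * 1 := by gcongr
      _ = _ := by ring)
  rw [e1, e2, abs_neg] at this
  linarith

theorem sum_sum_mul_sqrt_div_sqrt_le {ι : Type*} (S : Finset ι) (x : ι → ℝ) {B : ℕ}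
    (hB : ∀ z : ℝ, (S.filter fun ν => z ≤ x ν ∧ x ν ≤ z + 1).card ≤ B) (m s : ℝ) (k : ι → ι → ℝ)
    (hcount : ∀ ν ∈ S, (S.filter fun ρ => k ν ρ ≠ 0).card ≤ 2)
    (h0 : ∀ ν ρ, 0 ≤ k ν ρ) (h1 : ∀ ν ρ, k ν ρ ≤ 1)
    (hbal : ∀ ν ∈ S, ∀ ρ ∈ S, k ν ρ ≠ 0 → |m + s - x ν - x ρ| ≤ 1)
    (h2 : ∀ ν ∈ S, ∀ ρ ∈ S, k ν ρ ^ 2 * (|m - x ν| * |m - x ρ|) ≤ 1) :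
    ∑ ν ∈ S, ∑ ρ ∈ S, k ν ρ * (√(1 + |m - s|) / √(1 + |x ν - x ρ|)) ≤ 2208 * B := by
  classical
  set a := |m - s| / 2 with ha
  have ha0 : 0 ≤ a := by positivity
  let ind : ℝ → ℝ := fun u => if u ≤ 2 then 1 else 0
  have hI : ∀ u : ℝ, 0 ≤ ind u := fun u => by simp only [ind]; split_ifs <;> norm_num
  have hIa : ∀ u v : ℝ, 0 ≤ u → u ≤ v → ind v ≤ ind u := fun u v _ huv => by
    simp only [ind]
    split_ifs <;> linarith
  have hIs : ∀ n : ℕ, ∑ j ∈ Finset.range n, ind j ≤ 3 := by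
    intro n
    have hsub : (Finset.range n).filter (fun j : ℕ => (j : ℝ) ≤ 2) ⊆ Finset.range 3 := by
      intro j hj
      have := (Finset.mem_filter.1 hj).2
      have h' : j ≤ 2 := by exact_mod_cast this
      exact Finset.mem_range.2 (by omega)
    have := Finset.card_le_card hsub
    rw [Finset.card_range] at this
    simp only [ind, Finset.sum_boole]
    exact_mod_cast this
  let g : ι → ℝ := fun ν => 2 * (ind |x ν - m| + ind |x ν - s|) +
      30 * (profile a |x ν - m| + profile a |x ν - s| + profile a |x ν - (m + s) / 2|)
  have hg0 : ∀ ν, 0 ≤ g ν := fun ν => by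
    have := hI |x ν - m|
    have := hI |x ν - s|
    have := profile_nonneg a |x ν - m|
    have := profile_nonneg a |x ν - s|
    have := profile_nonneg a |x ν - (m + s) / 2|
    simp only [g]
    positivity
  have hrow : ∀ ν ∈ S, ∑ ρ ∈ S, k ν ρ * (√(1 + |m - s|) / √(1 + |x ν - x ρ|)) ≤ 2 * g ν := by
    intro ν hν
    rw [← Finset.sum_filter_of_ne (p := fun ρ => k ν ρ ≠ 0)
      (fun ρ _ h => left_ne_zero_of_mul h)]
    calc _ ≤ ∑ ρ ∈ S.filter (fun ρ => k ν ρ ≠ 0), g ν := by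
          refine Finset.sum_le_sum fun ρ hρ => ?_
          rw [Finset.mem_filter] at hρ
          exact mul_sqrt_div_sqrt_le (h0 _ _) (h1 _ _) (hbal ν hν ρ hρ.1 hρ.2) (h2 ν hν ρ hρ.1)
      _ = (S.filter (fun ρ => k ν ρ ≠ 0)).card * g ν := by rw [Finset.sum_const, nsmul_eq_mul]
      _ ≤ 2 * g ν := by
          have : ((S.filter (fun ρ => k ν ρ ≠ 0)).card : ℝ) ≤ 2 := by exact_mod_cast hcount ν hν
          exact mul_le_mul_of_nonneg_right this (hg0 ν)
  refine (Finset.sum_le_sum hrow).trans ?_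
  simp only [g, ← Finset.mul_sum, Finset.sum_add_distrib]
  have A1 := sum_comp_abs_sub_le S x hB ind hIa hI hIs m
  have A2 := sum_comp_abs_sub_le S x hB ind hIa hI hIs s
  have A3 := fun z => sum_comp_abs_sub_le S x hB (profile a)
    (fun u v hu huv => profile_antitone hu huv) (profile_nonneg a) (sum_profile_le ha0) z
  linarith [A3 m, A3 s, A3 ((m + s) / 2)]

theorem sum_quad_le {ι : Type*} (S : Finset ι) (x : ι → ℝ) {B : ℕ}
    (hB : ∀ z : ℝ, (S.filter fun ν => z ≤ x ν ∧ x ν ≤ z + 1).card ≤ B) (k : ι → ι → ι → ι → ℝ)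
    (hsymm : ∀ μ σ ν ρ, k μ σ ν ρ = k ν ρ μ σ)
    (hcount : ∀ μ ∈ S, ∀ σ ∈ S, ∀ ν ∈ S, (S.filter fun ρ => k μ σ ν ρ ≠ 0).card ≤ 2)
    (h0 : ∀ μ σ ν ρ, 0 ≤ k μ σ ν ρ) (h1 : ∀ μ σ ν ρ, k μ σ ν ρ ≤ 1)
    (hbal : ∀ μ ∈ S, ∀ σ ∈ S, ∀ ν ∈ S, ∀ ρ ∈ S, k μ σ ν ρ ≠ 0 → |x μ + x σ - x ν - x ρ| ≤ 1)
    (h2 : ∀ μ ∈ S, ∀ σ ∈ S, ∀ ν ∈ S, ∀ ρ ∈ S,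
      k μ σ ν ρ ^ 2 * (|x μ - x ν| * |x μ - x ρ|) ≤ 1) (a : ι → ℝ) :
    ∑ μ ∈ S, ∑ σ ∈ S, ∑ ν ∈ S, ∑ ρ ∈ S, a μ * a σ * a ν * a ρ * k μ σ ν ρ ≤
      2208 * B * (∑ μ ∈ S, a μ ^ 2) ^ 2 := by
  classical
  let w : ι → ι → ℝ := fun μ σ => √(1 + |x μ - x σ|)
  have hw : ∀ μ σ, 0 < w μ σ := fun μ σ => Real.sqrt_pos.2 (by positivity)
  let U : ι → ι → ι → ι → ℝ := fun μ σ ν ρ => (a μ * a σ) ^ 2 * (k μ σ ν ρ * (w μ σ / w ν ρ))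
  have hterm : ∀ μ σ ν ρ, a μ * a σ * a ν * a ρ * k μ σ ν ρ ≤
      (U μ σ ν ρ + U ν ρ μ σ) / 2 := by
    intro μ σ ν ρ
    simp only [U, ← hsymm μ σ ν ρ]
    have w1 := hw μ σ
    have w2 := hw ν ρ
    have hkk := h0 μ σ ν ρ
    have key : 2 * ((a μ * a σ) * (a ν * a ρ)) ≤
        (a μ * a σ) ^ 2 * (w μ σ / w ν ρ) + (a ν * a ρ) ^ 2 * (w ν ρ / w μ σ) := by
      have e : (a μ * a σ) ^ 2 * (w μ σ / w ν ρ) + (a ν * a ρ) ^ 2 * (w ν ρ / w μ σ) -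
          2 * ((a μ * a σ) * (a ν * a ρ)) =
          ((a μ * a σ) * w μ σ - (a ν * a ρ) * w ν ρ) ^ 2 / (w μ σ * w ν ρ) := by
        field_simp
        ring
      have : 0 ≤ ((a μ * a σ) * w μ σ - (a ν * a ρ) * w ν ρ) ^ 2 / (w μ σ * w ν ρ) := by positivity
      linarith
    have := mul_le_mul_of_nonneg_right key hkk
    linarith
  have hU : ∑ μ ∈ S, ∑ σ ∈ S, ∑ ν ∈ S, ∑ ρ ∈ S, U μ σ ν ρ ≤
      2208 * B * (∑ μ ∈ S, a μ ^ 2) ^ 2 := by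
    calc ∑ μ ∈ S, ∑ σ ∈ S, ∑ ν ∈ S, ∑ ρ ∈ S, U μ σ ν ρ
        ≤ ∑ μ ∈ S, ∑ σ ∈ S, (a μ ^ 2 * a σ ^ 2) * (2208 * B) := by
          refine Finset.sum_le_sum fun μ hμ => Finset.sum_le_sum fun σ hσ => ?_
          simp only [U, ← Finset.mul_sum, mul_pow]
          refine mul_le_mul_of_nonneg_left ?_ (by positivity)
          exact sum_sum_mul_sqrt_div_sqrt_le S x hB (x μ) (x σ) (fun ν ρ => k μ σ ν ρ)
            (hcount μ hμ σ hσ) (h0 μ σ) (h1 μ σ) (hbal μ hμ σ hσ) (h2 μ hμ σ hσ)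
      _ = _ := by
          simp only [← Finset.sum_mul, ← Finset.mul_sum]
          ring
  have hswap : ∑ μ ∈ S, ∑ σ ∈ S, ∑ ν ∈ S, ∑ ρ ∈ S, U ν ρ μ σ =
      ∑ μ ∈ S, ∑ σ ∈ S, ∑ ν ∈ S, ∑ ρ ∈ S, U μ σ ν ρ := by
    have e := Finset.sum_comm (s := S ×ˢ S) (t := S ×ˢ S)
      (f := fun p q : ι × ι => U q.1 q.2 p.1 p.2)
    simpa only [Finset.sum_product] using e
  calc _ ≤ ∑ μ ∈ S, ∑ σ ∈ S, ∑ ν ∈ S, ∑ ρ ∈ S, (U μ σ ν ρ + U ν ρ μ σ) / 2 := by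
        refine Finset.sum_le_sum fun μ _ => Finset.sum_le_sum fun σ _ =>
          Finset.sum_le_sum fun ν _ => Finset.sum_le_sum fun ρ _ => hterm μ σ ν ρ
    _ = (∑ μ ∈ S, ∑ σ ∈ S, ∑ ν ∈ S, ∑ ρ ∈ S, U μ σ ν ρ +
          ∑ μ ∈ S, ∑ σ ∈ S, ∑ ν ∈ S, ∑ ρ ∈ S, U ν ρ μ σ) / 2 := by
        simp only [← Finset.sum_div, Finset.sum_add_distrib]
    _ ≤ _ := by rw [hswap]; linarith

theorem card_le_Bmax {lam : ℝ} {x : ℝ × ℝ} (hx : e2 x = lam) {s : Finset (ℤ × ℤ)}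
    (hs : s ⊆ Elat lam) (h : ∀ ξ ∈ s, e2 (iv ξ - x) ≤ √lam) : s.card ≤ Bmax lam := by
  classical
  unfold Bmax
  have hbdd : BddAbove {n : ℕ | ∃ x : ℝ × ℝ, e2 x = lam ∧
      n = ((Elat lam).filter fun ξ => e2 (iv ξ - x) ≤ √lam).card} := by
    refine ⟨(Elat lam).card, ?_⟩
    rintro n ⟨x, -, rfl⟩
    exact Finset.card_filter_le _ _
  calc s.card ≤ ((Elat lam).filter fun ξ => e2 (iv ξ - x) ≤ √lam).card :=
        Finset.card_le_card fun ξ hξ => Finset.mem_filter.2 ⟨hs hξ, h ξ hξ⟩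
    _ ≤ _ := by
        convert le_csSup hbdd ⟨x, hx, rfl⟩

theorem Bmax_le_card (lam : ℝ) : Bmax lam ≤ (Elat lam).card := by
  classical
  unfold Bmax
  refine csSup_le' ?_
  rintro n ⟨x, -, rfl⟩
  exact Finset.card_filter_le _ _

theorem one_le_Bmax {lam : ℝ} (hl : 0 ≤ lam) {μ : ℤ × ℤ} (h : μ ∈ Elat lam) : 1 ≤ Bmax lam := by
  have := card_le_Bmax (s := {μ}) (e2_iv_of_mem hl h) (by simpa using h) (by simp [e2])
  simpa using this

theorem abs_mul_le_of_quadrant {l m₁ m₂ n₁ n₂ r₁ r₂ s₁ s₂ δ : ℝ} (hl : 0 ≤ l) (hδ : 0 ≤ δ)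
    (hm : m₁ ^ 2 + m₂ ^ 2 = l ^ 2) (hn : n₁ ^ 2 + n₂ ^ 2 = l ^ 2) (hr : r₁ ^ 2 + r₂ ^ 2 = l ^ 2)
    (hs : s₁ ^ 2 + s₂ ^ 2 = l ^ 2) (hm₁ : 0 ≤ m₁) (hm₂ : 0 ≤ m₂) (hn₁ : 0 ≤ n₁) (hn₂ : 0 ≤ n₂)
    (hr₁ : 0 ≤ r₁) (hr₂ : 0 ≤ r₂)
    (hd : (m₁ + s₁ - n₁ - r₁) ^ 2 + (m₂ + s₂ - n₂ - r₂) ^ 2 = δ ^ 2) (hδl : δ ≤ 4 * l) :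
    |m₂ - n₂| * |m₂ - r₂| ≤ 3 * l * δ := by
  have key : 2 * ((m₁ - n₁) * (m₁ - r₁) + (m₂ - n₂) * (m₂ - r₂)) =
      δ ^ 2 - 2 * ((m₁ + s₁ - n₁ - r₁) * s₁ + (m₂ + s₂ - n₂ - r₂) * s₂) := by
    linear_combination hs + hm - hn - hr + hd
  have cs : |(m₁ + s₁ - n₁ - r₁) * s₁ + (m₂ + s₂ - n₂ - r₂) * s₂| ≤ δ * l := by
    refine abs_le_of_sq_le_sq ?_ (by positivity)
    rw [mul_pow, ← hd, ← hs]
    nlinarith [sq_nonneg ((m₁ + s₁ - n₁ - r₁) * s₂ - (m₂ + s₂ - n₂ - r₂) * s₁)]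
  have neg : ∀ x₁ x₂ : ℝ, 0 ≤ x₁ → 0 ≤ x₂ → x₁ ^ 2 + x₂ ^ 2 = l ^ 2 →
      (m₁ - x₁) * (m₂ - x₂) ≤ 0 := by
    intro x₁ x₂ h₁ h₂ hx
    rcases le_total m₁ x₁ with h | h
    · have h3 := (sq_le_sq₀ hm₁ h₁).2 h
      have : x₂ ≤ m₂ := (sq_le_sq₀ h₂ hm₂).1 (by linarith)
      exact mul_nonpos_of_nonpos_of_nonneg (by linarith) (by linarith)
    · have h3 := (sq_le_sq₀ h₁ hm₁).2 h
      have : m₂ ≤ x₂ := (sq_le_sq₀ hm₂ h₂).1 (by linarith)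
      exact mul_nonpos_of_nonneg_of_nonpos (by linarith) (by linarith)
  have pos : 0 ≤ ((m₁ - n₁) * (m₁ - r₁)) * ((m₂ - n₂) * (m₂ - r₂)) := by
    have := mul_nonneg_of_nonpos_of_nonpos (neg n₁ n₂ hn₁ hn₂ hn) (neg r₁ r₂ hr₁ hr₂ hr)
    linarith
  rw [← abs_mul]
  have h1 : |(m₂ - n₂) * (m₂ - r₂)| ≤
      |(m₁ - n₁) * (m₁ - r₁) + (m₂ - n₂) * (m₂ - r₂)| := by
    rw [← sq_le_sq]
    nlinarith [sq_nonneg ((m₁ - n₁) * (m₁ - r₁))]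
  have cs' := abs_le.1 cs
  have h2 : |(m₁ - n₁) * (m₁ - r₁) + (m₂ - n₂) * (m₂ - r₂)| ≤ 3 * l * δ := by
    rw [abs_le]
    have := mul_le_mul_of_nonneg_left hδl hδ
    constructor <;> linarith [sq_nonneg δ]
  linarith

theorem sq_add_sq_le_of_octant {l m₁ m₂ n₁ n₂ : ℝ} (hl : 0 < l)
    (hm : m₁ ^ 2 + m₂ ^ 2 = l ^ 2) (hn : n₁ ^ 2 + n₂ ^ 2 = l ^ 2) (hm₂ : 0 ≤ m₂) (hm₁ : m₂ ≤ m₁)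
    (hn₂ : 0 ≤ n₂) (hn₁ : n₂ ≤ n₁) :
    (m₁ - n₁) ^ 2 + (m₂ - n₂) ^ 2 ≤ 2 * (m₂ - n₂) ^ 2 := by
  have hpos : 0 < m₁ + n₁ := by
    by_contra hcon
    have h1 : m₁ = 0 := by linarith
    have h2 : m₂ = 0 := by linarith
    subst h1 h2
    nlinarith
  have e : (m₁ - n₁) * (m₁ + n₁) = -((m₂ - n₂) * (m₂ + n₂)) := by linear_combination hm - hn
  have h3 : ((m₁ - n₁) * (m₁ + n₁)) ^ 2 ≤ ((m₂ - n₂) * (m₁ + n₁)) ^ 2 := by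
    rw [e, neg_sq, mul_pow, mul_pow]
    gcongr
  rw [mul_pow, mul_pow] at h3
  have := le_of_mul_le_mul_right h3 (by positivity)
  linarith

theorem integral_norm_sum_pow_four_le {γ : ℝ → ℝ × ℝ} (h : ContDiff ℝ (⊤ : ℕ∞) γ)
    (S : Finset (ℤ × ℤ)) (a : ℤ × ℤ → ℂ) {p q : ℝ} (hpq : p ≤ q) :
    ∫ t in p..q, ‖∑ μ ∈ S, a μ * osc (phase γ (iv μ)) t‖ ^ 4 ≤
      ∑ μ ∈ S, ∑ σ ∈ S, ∑ ν ∈ S, ∑ ρ ∈ S, ‖a μ‖ * ‖a σ‖ * ‖a ν‖ * ‖a ρ‖ *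
        ‖∫ t in p..q, osc (phase γ (iv (μ + σ - ν - ρ))) t‖ := by
  have hc : ∀ v, Continuous (osc (phase γ v)) := fun v => continuous_osc (continuous_phase h v)
  have e : ∀ t, ((‖∑ μ ∈ S, a μ * osc (phase γ (iv μ)) t‖ ^ 4 : ℝ) : ℂ) =
      ∑ μ ∈ S, ∑ σ ∈ S, ∑ ν ∈ S, ∑ ρ ∈ S,
        a μ * a σ * starRingEnd ℂ (a ν) * starRingEnd ℂ (a ρ) *
          osc (phase γ (iv (μ + σ - ν - ρ))) t := by
    intro t
    set g := ∑ μ ∈ S, a μ * osc (phase γ (iv μ)) t with hg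
    have e1 : ((‖g‖ ^ 4 : ℝ) : ℂ) = starRingEnd ℂ g * (starRingEnd ℂ g * (g * g)) := by
      have := Complex.mul_conj' g
      push_cast
      linear_combination -(g * starRingEnd ℂ g + (‖g‖ : ℂ) ^ 2) * this
    rw [e1, hg, map_sum]
    simp only [Finset.mul_sum, Finset.sum_mul]
    refine Finset.sum_congr rfl fun μ _ => Finset.sum_congr rfl fun σ _ =>
      Finset.sum_congr rfl fun ν _ => Finset.sum_congr rfl fun ρ _ => ?_
    rw [iv_sub, iv_sub, iv_add, osc_phase_sub, osc_phase_sub, osc_phase_add, map_mul, map_mul]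
    ring
  have e2' : ((∫ t in p..q, ‖∑ μ ∈ S, a μ * osc (phase γ (iv μ)) t‖ ^ 4 : ℝ) : ℂ) =
      ∑ μ ∈ S, ∑ σ ∈ S, ∑ ν ∈ S, ∑ ρ ∈ S,
        a μ * a σ * starRingEnd ℂ (a ν) * starRingEnd ℂ (a ρ) *
          ∫ t in p..q, osc (phase γ (iv (μ + σ - ν - ρ))) t := by
    rw [← intervalIntegral.integral_ofReal]
    simp only [e]
    have hi : ∀ (w : ℂ) v, IntervalIntegrable (fun t => w * osc (phase γ v) t) volume p q :=
      fun w v => (continuous_const.mul (hc v)).intervalIntegrable _ _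
    rw [intervalIntegral.integral_finsetSum]
    · refine Finset.sum_congr rfl fun μ _ => ?_
      rw [intervalIntegral.integral_finsetSum]
      · refine Finset.sum_congr rfl fun σ _ => ?_
        rw [intervalIntegral.integral_finsetSum]
        · refine Finset.sum_congr rfl fun ν _ => ?_
          rw [intervalIntegral.integral_finsetSum fun ρ _ => hi _ _]
          exact Finset.sum_congr rfl fun ρ _ => intervalIntegral.integral_const_mul _ _
        all_goals
          intros; apply Continuous.intervalIntegrable
          fun_prop (disch := assumption)
      all_goals
        intros; apply Continuous.intervalIntegrable
        fun_prop (disch := assumption)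
    all_goals
      intros; apply Continuous.intervalIntegrable
      fun_prop (disch := assumption)
  have hnn : 0 ≤ ∫ t in p..q, ‖∑ μ ∈ S, a μ * osc (phase γ (iv μ)) t‖ ^ 4 :=
    intervalIntegral.integral_nonneg hpq fun t _ => by positivity
  rw [← abs_of_nonneg hnn, ← Real.norm_eq_abs, ← Complex.norm_real, e2']
  refine (norm_sum_le _ _).trans (Finset.sum_le_sum fun μ _ => ?_)
  refine (norm_sum_le _ _).trans (Finset.sum_le_sum fun σ _ => ?_)
  refine (norm_sum_le _ _).trans (Finset.sum_le_sum fun ν _ => ?_)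
  refine (norm_sum_le _ _).trans (Finset.sum_le_sum fun ρ _ => ?_)
  simp

theorem IsCurvedArc.exists_integral_octant_pow_four_le {γ : ℝ → ℝ × ℝ} {α β c K : ℝ}
    (A : IsCurvedArc γ α β c K) : ∃ C : ℝ, 0 < C ∧ ∀ lam R : ℝ, 0 < lam → 1 ≤ R →
      8 * R ^ 3 ≤ 2 * lam → 2 * R ≤ √lam → ((Elat lam).card : ℝ) ^ 2 ≤ √R →
      ∀ S ⊆ Elat lam, ∀ X Y : ℝ × ℝ →ₗ[ℝ] ℝ, (∀ v, X v ^ 2 + Y v ^ 2 = v.1 ^ 2 + v.2 ^ 2) →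
      (∀ μ ∈ S, 0 ≤ Y (iv μ) ∧ Y (iv μ) ≤ X (iv μ)) → ∀ a : ℤ × ℤ → ℂ,
      ∫ t in α..β, ‖∑ μ ∈ S, a μ * osc (phase γ (iv μ)) t‖ ^ 4 ≤
        C * Bmax lam * (∑ μ ∈ S, ‖a μ‖ ^ 2) ^ 2 := by
  classical
  obtain ⟨C₀, hC₀, hosc⟩ := A.exists_norm_integral_osc_le
  have hαβ := A.lt
  set C₁ := (β - α) + 4 * C₀ with hC₁
  have hC₁pos : 0 < C₁ := by linarith
  refine ⟨2208 * C₁ + C₀, by positivity, ?_⟩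
  intro lam R hlam hR hR3 hRl hM S hS X Y hXY hoct a
  have hsl : 0 < √lam := Real.sqrt_pos.2 hlam
  let J : ℤ × ℤ → ℝ := fun Δ => ‖∫ t in α..β, osc (phase γ (iv Δ)) t‖
  have hJ0 : ∀ Δ, 0 ≤ J Δ := fun _ => norm_nonneg _
  have hJ1 : ∀ Δ, J Δ ≤ C₁ := fun Δ => by
    have := norm_integral_osc_le (φ := phase γ (iv Δ)) hαβ.le
    linarith
  have hJneg : ∀ Δ, J (-Δ) = J Δ := fun Δ => by
    simp only [J]
    rw [← norm_integral_osc_neg]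
    congr 2
    ext t
    simp only [osc, iv_neg, phase_neg, neg_neg]
  have hJ2 : ∀ Δ, Δ ≠ 0 → J Δ ≤ C₀ / √(e2 (iv Δ)) := fun Δ hΔ =>
    hosc α β le_rfl hαβ.le le_rfl _ (one_le_e2_iv hΔ)
  let k : ℤ × ℤ → ℤ × ℤ → ℤ × ℤ → ℤ × ℤ → ℝ := fun μ σ ν ρ =>
    if e2 (iv (μ + σ - ν - ρ)) < R then J (μ + σ - ν - ρ) / C₁ else 0
  have hcirc : ∀ μ ∈ S, X (iv μ) ^ 2 + Y (iv μ) ^ 2 = lam ^ 2 := fun μ hμ => by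
    rw [hXY]; exact (mem_Elat hlam.le μ).1 (hS hμ)
  have hYle : ∀ v, |Y v| ≤ e2 v := fun v => by
    refine abs_le_of_sq_le_sq ?_ (e2_nonneg v)
    rw [e2_sq, ← hXY]
    nlinarith [sq_nonneg (X v)]
  have hquad := sum_quad_le S (fun μ => 2 * Y (iv μ) / √lam) (B := Bmax lam) ?hB k ?hsymm ?hcount
    ?h0 ?h1 ?hbal ?h2 (fun μ => ‖a μ‖)
  case hB =>
    intro z
    rcases (S.filter fun ν => z ≤ 2 * Y (iv ν) / √lam ∧ 2 * Y (iv ν) / √lam ≤ z + 1).eq_empty_or_nonempty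
      with h | ⟨μ, hμ⟩
    · simp [h]
    rw [Finset.mem_filter] at hμ
    refine card_le_Bmax (e2_iv_of_mem hlam.le (hS hμ.1)) ((Finset.filter_subset _ _).trans hS) ?_
    intro ν hν
    rw [Finset.mem_filter] at hν
    refine abs_le_of_sq_le_sq' ?_ hsl.le |>.2
    have h1 : |2 * Y (iv ν) / √lam - 2 * Y (iv μ) / √lam| ≤ 1 := by
      rw [abs_le]; constructor <;> linarith [hν.2.1, hν.2.2, hμ.2.1, hμ.2.2]
    rw [← sub_div, abs_div, abs_of_pos hsl, div_le_one hsl, ← mul_sub, abs_mul, abs_two] at h1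
    have h2 := sq_add_sq_le_of_octant hlam (hcirc ν hν.1) (hcirc μ hμ.1) (hoct ν hν.1).1
      (hoct ν hν.1).2 (hoct μ hμ.1).1 (hoct μ hμ.1).2
    have h3 := hXY (iv ν - iv μ)
    rw [← e2_sq, map_sub, map_sub] at h3
    rw [← h3]
    have h4 : (2 * |Y (iv ν) - Y (iv μ)|) ^ 2 ≤ √lam ^ 2 := by gcongr
    rw [mul_pow, sq_abs] at h4
    linarith [sq_nonneg (Y (iv ν) - Y (iv μ))]
  case hsymm =>
    intro μ σ ν ρ
    have e : ν + ρ - μ - σ = -(μ + σ - ν - ρ) := by abel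
    simp only [k, e, hJneg, iv_neg, e2_neg]
  case hcount =>
    intro μ _ σ _ ν _
    refine card_filter_e2_lt_le_two hlam.le hR3 (iv (μ + σ - ν))
      ((Finset.filter_subset _ _).trans hS) ?_
    intro ρ hρ
    have h := (Finset.mem_filter.1 hρ).2
    simp only [k] at h
    rw [ite_ne_right_iff] at h
    rw [e2_sub_comm, ← iv_sub]
    exact h.1
  case h0 =>
    intro μ σ ν ρ
    simp only [k]
    split_ifs
    · exact div_nonneg (hJ0 _) hC₁pos.le
    · rfl
  case h1 =>
    intro μ σ ν ρ
    simp only [k]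
    split_ifs
    · exact (div_le_one hC₁pos).2 (hJ1 _)
    · norm_num
  case hbal =>
    intro μ _ σ _ ν _ ρ _ h
    simp only [k] at h
    rw [ite_ne_right_iff] at h
    have h1 := hYle (iv (μ + σ - ν - ρ))
    have e : 2 * Y (iv μ) / √lam + 2 * Y (iv σ) / √lam - 2 * Y (iv ν) / √lam -
        2 * Y (iv ρ) / √lam = 2 * Y (iv (μ + σ - ν - ρ)) / √lam := by
      rw [iv_sub, iv_sub, iv_add, map_sub, map_sub, map_add]
      ring
    rw [e, abs_div, abs_of_pos hsl, div_le_one hsl, abs_mul, abs_two]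
    linarith [h.1]
  case h2 =>
    intro μ hμ σ hσ ν hν ρ hρ
    set Δ := μ + σ - ν - ρ with hΔ
    have hδ : e2 (iv Δ) ≤ 4 * lam := by
      have h1 := e2_sub_le (iv (μ + σ - ν)) 0 (iv ρ)
      have h2 := e2_sub_le (iv (μ + σ)) 0 (iv ν)
      have h3 := e2_add_le (iv μ) (iv σ)
      rw [← iv_add] at h3
      simp only [sub_zero, zero_sub, e2_neg, ← iv_sub] at h1 h2
      have := fun {x} hx => e2_iv_of_mem (μ := x) hlam.le (hS hx)
      rw [this hρ] at h1
      rw [this hν] at h2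
      rw [this hμ, this hσ] at h3
      linarith
    have h1 := abs_mul_le_of_quadrant hlam.le (e2_nonneg (iv Δ)) (hcirc μ hμ) (hcirc ν hν)
      (hcirc ρ hρ) (hcirc σ hσ) ((hoct μ hμ).1.trans (hoct μ hμ).2) (hoct μ hμ).1
      ((hoct ν hν).1.trans (hoct ν hν).2) (hoct ν hν).1
      ((hoct ρ hρ).1.trans (hoct ρ hρ).2) (hoct ρ hρ).1 (by
        rw [e2_sq, ← hXY, hΔ, iv_sub, iv_sub, iv_add]
        simp only [map_sub, map_add]) hδ
    have h2 : |2 * Y (iv μ) / √lam - 2 * Y (iv ν) / √lam| *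
        |2 * Y (iv μ) / √lam - 2 * Y (iv ρ) / √lam| ≤ 12 * e2 (iv Δ) := by
      rw [← sub_div, ← sub_div, abs_div, abs_div, abs_of_pos hsl, ← mul_sub, ← mul_sub, abs_mul,
        abs_mul, abs_two, div_mul_div_comm, Real.mul_self_sqrt hlam.le, div_le_iff₀ hlam]
      linarith
    have h3 : k μ σ ν ρ ^ 2 * (12 * e2 (iv Δ)) ≤ 1 := by
      by_cases h0 : Δ = 0
      · rw [h0]
        simp [iv, e2]
      have hpos : 0 < e2 (iv Δ) := zero_lt_one.trans_le (one_le_e2_iv h0)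
      simp only [k, ← hΔ]
      split_ifs
      · have h4 := pow_le_pow_left₀ (hJ0 _) (hJ2 Δ h0) 2
        rw [div_pow, Real.sq_sqrt hpos.le, le_div_iff₀ hpos] at h4
        rw [div_pow, div_mul_eq_mul_div, div_le_one (by positivity)]
        have h5 : (4 * C₀) ^ 2 ≤ C₁ ^ 2 := by gcongr; linarith
        nlinarith [sq_nonneg C₀]
      · norm_num
    exact (mul_le_mul_of_nonneg_left h2 (sq_nonneg _)).trans h3
  rcases S.eq_empty_or_nonempty with rfl | ⟨μ₀, hμ₀⟩
  · simp
  have hB1 : (1 : ℝ) ≤ Bmax lam := by exact_mod_cast one_le_Bmax hlam.le (hS hμ₀)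
  set w : ℝ := ∑ μ ∈ S, ‖a μ‖ ^ 2 with hw
  have hsplit : ∀ Δ, J Δ ≤ (if e2 (iv Δ) < R then J Δ / C₁ else 0) * C₁ + C₀ / √R := by
    intro Δ
    split_ifs with h
    · rw [div_mul_cancel₀ _ hC₁pos.ne']
      have : 0 ≤ C₀ / √R := by positivity
      linarith
    · push Not at h
      rw [zero_mul, zero_add]
      refine (hJ2 Δ ?_).trans ?_
      · rintro rfl
        simp [iv, e2] at h
        linarith
      · have : 0 < √R := Real.sqrt_pos.2 (by linarith)
        gcongr
  refine (integral_norm_sum_pow_four_le A.smooth S a hαβ.le).trans ?_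
  have hsum4 : ∑ μ ∈ S, ∑ σ ∈ S, ∑ ν ∈ S, ∑ ρ ∈ S, ‖a μ‖ * ‖a σ‖ * ‖a ν‖ * ‖a ρ‖ =
      (∑ μ ∈ S, ‖a μ‖) ^ 4 := by
    simp only [← Finset.mul_sum, ← Finset.sum_mul]
    ring
  have hcs : (∑ μ ∈ S, ‖a μ‖) ^ 2 ≤ (Elat lam).card * w := by
    refine (sq_sum_le_card_mul_sum_sq).trans ?_
    have : (S.card : ℝ) ≤ (Elat lam).card := by exact_mod_cast Finset.card_le_card hS
    gcongr
  have hw0 : 0 ≤ w := Finset.sum_nonneg fun _ _ => by positivity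
  calc _ ≤ ∑ μ ∈ S, ∑ σ ∈ S, ∑ ν ∈ S, ∑ ρ ∈ S, ((‖a μ‖ * ‖a σ‖ * ‖a ν‖ * ‖a ρ‖ * k μ σ ν ρ) * C₁ +
          ‖a μ‖ * ‖a σ‖ * ‖a ν‖ * ‖a ρ‖ * (C₀ / √R)) := by
        refine Finset.sum_le_sum fun μ _ => Finset.sum_le_sum fun σ _ =>
          Finset.sum_le_sum fun ν _ => Finset.sum_le_sum fun ρ _ => ?_
        refine (mul_le_mul_of_nonneg_left (hsplit (μ + σ - ν - ρ)) (by positivity)).trans ?_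
        simp only [k]
        linarith
    _ = (∑ μ ∈ S, ∑ σ ∈ S, ∑ ν ∈ S, ∑ ρ ∈ S, ‖a μ‖ * ‖a σ‖ * ‖a ν‖ * ‖a ρ‖ * k μ σ ν ρ) * C₁ +
          (∑ μ ∈ S, ‖a μ‖) ^ 4 * (C₀ / √R) := by
        rw [← hsum4]
        simp only [Finset.sum_add_distrib, Finset.sum_mul]
    _ ≤ (2208 * Bmax lam * w ^ 2) * C₁ + w ^ 2 * C₀ := by
        refine add_le_add (mul_le_mul_of_nonneg_right hquad hC₁pos.le) ?_
        have hsR : 0 < √R := Real.sqrt_pos.2 (by linarith)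
        have h4 := pow_le_pow_left₀ (by positivity) hcs 2
        rw [mul_div_assoc', div_le_iff₀ hsR]
        calc (∑ μ ∈ S, ‖a μ‖) ^ 4 * C₀ = ((∑ μ ∈ S, ‖a μ‖) ^ 2) ^ 2 * C₀ := by ring
          _ ≤ (((Elat lam).card : ℝ) * w) ^ 2 * C₀ := by gcongr
          _ = w ^ 2 * C₀ * ((Elat lam).card : ℝ) ^ 2 := by ring
          _ ≤ _ := by gcongr
    _ ≤ _ := by
        have : w ^ 2 * C₀ * 1 ≤ w ^ 2 * C₀ * Bmax lam := by gcongr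
        linarith

def octant (μ : ℤ × ℤ) : Bool × Bool × Bool :=
  (decide (0 ≤ μ.1), decide (0 ≤ μ.2), decide (|μ.2| ≤ |μ.1|))

theorem exists_octant_coordinates (o : Bool × Bool × Bool) : ∃ X Y : ℝ × ℝ →ₗ[ℝ] ℝ,
    (∀ v, X v ^ 2 + Y v ^ 2 = v.1 ^ 2 + v.2 ^ 2) ∧
    ∀ μ, octant μ = o → 0 ≤ Y (iv μ) ∧ Y (iv μ) ≤ X (iv μ) := by
  obtain ⟨s, t, w⟩ := o
  let sgn : Bool → ℝ := fun b => if b then 1 else -1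
  have hsgn : ∀ b, sgn b ^ 2 = 1 := fun b => by cases b <;> simp [sgn]
  have habs : ∀ n : ℤ, sgn (decide (0 ≤ n)) * (n : ℝ) = |(n : ℝ)| := by
    intro n
    by_cases h : 0 ≤ n
    · have : (0 : ℝ) ≤ n := by exact_mod_cast h
      simp [sgn, h, abs_of_nonneg this]
    · have : (n : ℝ) < 0 := by exact_mod_cast not_le.1 h
      simp [sgn, h, abs_of_neg this]
  let P : ℝ × ℝ →ₗ[ℝ] ℝ := sgn s • LinearMap.fst ℝ ℝ ℝ
  let Q : ℝ × ℝ →ₗ[ℝ] ℝ := sgn t • LinearMap.snd ℝ ℝ ℝ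
  have hPQ : ∀ v, P v ^ 2 + Q v ^ 2 = v.1 ^ 2 + v.2 ^ 2 := fun v => by
    simp [P, Q, mul_pow, hsgn]
  have hP : ∀ μ, octant μ = (s, t, w) → P (iv μ) = |(μ.1 : ℝ)| := by
    intro μ h
    simp only [octant, Prod.mk.injEq] at h
    simp [P, ← h.1, iv, habs]
  have hQ : ∀ μ, octant μ = (s, t, w) → Q (iv μ) = |(μ.2 : ℝ)| := by
    intro μ h
    simp only [octant, Prod.mk.injEq] at h
    simp [Q, ← h.2.1, iv, habs]
  cases w
  · refine ⟨Q, P, fun v => by rw [add_comm, hPQ], fun μ h => ?_⟩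
    rw [hP μ h, hQ μ h]
    simp only [octant, Prod.mk.injEq, decide_eq_false_iff_not, not_le] at h
    exact ⟨abs_nonneg _, by exact_mod_cast h.2.2.le⟩
  · refine ⟨P, Q, hPQ, fun μ h => ?_⟩
    rw [hP μ h, hQ μ h]
    simp only [octant, Prod.mk.injEq, decide_eq_true_eq] at h
    exact ⟨abs_nonneg _, by exact_mod_cast h.2.2⟩

theorem IsCurvedArc.exists_integral_pow_four_le {γ : ℝ → ℝ × ℝ} {α β c K : ℝ}
    (A : IsCurvedArc γ α β c K) : ∃ C : ℝ, 0 < C ∧ ∀ lam R : ℝ, 0 < lam → 1 ≤ R →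
      8 * R ^ 3 ≤ 2 * lam → 2 * R ≤ √lam → ((Elat lam).card : ℝ) ^ 2 ≤ √R →
      ∀ a : ℤ × ℤ → ℂ, ∫ t in α..β, ‖efn lam a (γ t)‖ ^ 4 ≤
        C * Bmax lam * (∑ μ ∈ Elat lam, ‖a μ‖ ^ 2) ^ 2 := by
  classical
  obtain ⟨C, hC, hoct⟩ := A.exists_integral_octant_pow_four_le
  refine ⟨8 ^ 4 * C, by positivity, ?_⟩
  intro lam R hlam hR hR3 hRl hM a
  let S : Bool × Bool × Bool → Finset (ℤ × ℤ) := fun o => (Elat lam).filter fun μ => octant μ = o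
  have hSE : ∀ o, S o ⊆ Elat lam := fun o => Finset.filter_subset _ _
  let g : Bool × Bool × Bool → ℝ → ℂ := fun o t => ∑ μ ∈ S o, a μ * osc (phase γ (iv μ)) t
  have hg : ∀ o, Continuous (g o) := fun o =>
    continuous_finsetSum _ fun μ _ => continuous_const.mul (continuous_osc (continuous_phase A.smooth _))
  have hgi : ∀ o, IntervalIntegrable (fun t => ‖g o t‖ ^ 4) volume α β := fun o =>
    ((hg o).norm.pow 4).intervalIntegrable _ _
  have hpt : ∀ t, ‖efn lam a (γ t)‖ ^ 4 ≤ 8 ^ 3 * ∑ o, ‖g o t‖ ^ 4 := by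
    intro t
    have e : efn lam a (γ t) = ∑ o, g o t := by
      rw [efn_eq_sum_osc, ← Finset.sum_fiberwise (Elat lam) octant]
    have h1 : ‖efn lam a (γ t)‖ ≤ ∑ o, ‖g o t‖ := by
      rw [e]; exact norm_sum_le _ _
    have h3 := pow_sum_div_card_le_sum_pow (s := Finset.univ) (f := fun o => ‖g o t‖)
      (fun _ _ => norm_nonneg _) 3
    rw [div_le_iff₀ (by simp)] at h3
    have h4 : ((Finset.univ : Finset (Bool × Bool × Bool)).card : ℝ) = 8 := by norm_num
    rw [h4] at h3
    calc _ ≤ (∑ o, ‖g o t‖) ^ 4 := pow_le_pow_left₀ (norm_nonneg _) h1 4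
      _ ≤ _ := by rw [mul_comm]; exact h3
  have hfc : Continuous fun t => efn lam a (γ t) := by
    simp only [efn_eq_sum_osc]
    exact continuous_finsetSum _ fun μ _ =>
      continuous_const.mul (continuous_osc (continuous_phase A.smooth _))
  have hw0 : 0 ≤ ∑ μ ∈ Elat lam, ‖a μ‖ ^ 2 := Finset.sum_nonneg fun _ _ => by positivity
  calc ∫ t in α..β, ‖efn lam a (γ t)‖ ^ 4 ≤ ∫ t in α..β, 8 ^ 3 * ∑ o, ‖g o t‖ ^ 4 := by
        refine intervalIntegral.integral_mono_on A.lt.le ((hfc.norm.pow 4).intervalIntegrable _ _)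
          (Continuous.intervalIntegrable ?_ _ _) fun t _ => hpt t
        exact continuous_const.mul (continuous_finsetSum _ fun o _ => (hg o).norm.pow 4)
    _ = 8 ^ 3 * ∑ o, ∫ t in α..β, ‖g o t‖ ^ 4 := by
        rw [intervalIntegral.integral_const_mul,
          intervalIntegral.integral_finsetSum fun o _ => hgi o]
    _ ≤ 8 ^ 3 * ∑ _o : Bool × Bool × Bool, C * Bmax lam * (∑ μ ∈ Elat lam, ‖a μ‖ ^ 2) ^ 2 := by
        gcongr with o
        obtain ⟨X, Y, hXY, ho⟩ := exists_octant_coordinates o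
        refine (hoct lam R hlam hR hR3 hRl hM (S o) (hSE o) X Y hXY
          (fun μ hμ => ho μ (Finset.mem_filter.1 hμ).2) a).trans ?_
        gcongr
        exact hSE o
    _ = _ := by
        rw [Finset.sum_const, Finset.card_univ]
        simp
        ring

theorem integral_window_eq {v : ℝ → ℝ} (hv : Continuous v) (α β h : ℝ) :
    ∫ t in α..(β - h), ∫ y in t..(t + h), v y =
      (∫ t in (β - h)..β, ∫ y in α..t, v y) - ∫ t in α..(α + h), ∫ y in α..t, v y := by
  have hi : ∀ a b, IntervalIntegrable v volume a b := fun a b => hv.intervalIntegrable a b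
  have hV : Continuous fun t => ∫ y in α..t, v y := intervalIntegral.continuous_primitive hi α
  have hVi : ∀ a b, IntervalIntegrable (fun t => ∫ y in α..t, v y) volume a b :=
    fun a b => hV.intervalIntegrable a b
  have e : ∀ t, ∫ y in t..(t + h), v y = (∫ y in α..(t + h), v y) - ∫ y in α..t, v y := fun t =>
    (intervalIntegral.integral_interval_sub_left (hi _ _) (hi _ _)).symm
  simp only [e]
  have hV' : Continuous fun t => ∫ y in α..(t + h), v y := hV.comp (continuous_add_const h)
  rw [intervalIntegral.integral_sub (hV'.intervalIntegrable _ _) (hVi _ _), intervalIntegral.integral_comp_add_right (fun t => ∫ y in α..t, v y) h,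
    sub_add_cancel, intervalIntegral.integral_interval_sub_interval_comm (hVi _ _) (hVi _ _)
    (hVi _ _), intervalIntegral.integral_symm α (α + h), intervalIntegral.integral_symm β (β - h)]
  ring

theorem integral_window_le {v : ℝ → ℝ} (hv : Continuous v) (h0 : ∀ t, 0 ≤ v t) {α β h : ℝ}
    (hh : 0 ≤ h) :
    ∫ t in α..(β - h), ∫ y in t..(t + h), v y ≤ h * ∫ t in α..β, v t := by
  have hi : ∀ a b, IntervalIntegrable v volume a b := fun a b => hv.intervalIntegrable a b
  have hV : Continuous fun t => ∫ y in α..t, v y := intervalIntegral.continuous_primitive hi α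
  have hmono : ∀ s t, s ≤ t → ∫ y in α..s, v y ≤ ∫ y in α..t, v y := fun s t hst => by
    rw [← intervalIntegral.integral_add_adjacent_intervals (hi α s) (hi s t)]
    linarith [intervalIntegral.integral_nonneg (μ := volume) hst fun y _ => h0 y]
  rw [integral_window_eq hv]
  have h1 : ∫ t in (β - h)..β, ∫ y in α..t, v y ≤ ∫ _t in (β - h)..β, ∫ y in α..β, v y :=
    intervalIntegral.integral_mono_on (by linarith) (hV.intervalIntegrable _ _)
      intervalIntegrable_const fun t ht => hmono t β ht.2
  have h2 : 0 ≤ ∫ t in α..(α + h), ∫ y in α..t, v y :=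
    intervalIntegral.integral_nonneg (by linarith) fun t ht =>
      intervalIntegral.integral_nonneg ht.1 fun y _ => h0 y
  rw [intervalIntegral.integral_const, smul_eq_mul] at h1
  linarith

theorem le_integral_window {v : ℝ → ℝ} (hv : Continuous v) (h0 : ∀ t, 0 ≤ v t) {α β p q h : ℝ}
    (hh : 0 ≤ h) (hp : α + h ≤ p) (hq : q ≤ β - h) :
    h * ∫ t in p..q, v t ≤ ∫ t in α..(β - h), ∫ y in t..(t + h), v y := by
  have hi : ∀ a b, IntervalIntegrable v volume a b := fun a b => hv.intervalIntegrable a b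
  have hV : Continuous fun t => ∫ y in α..t, v y := intervalIntegral.continuous_primitive hi α
  have hmono : ∀ s t, s ≤ t → ∫ y in α..s, v y ≤ ∫ y in α..t, v y := fun s t hst => by
    rw [← intervalIntegral.integral_add_adjacent_intervals (hi α s) (hi s t)]
    linarith [intervalIntegral.integral_nonneg (μ := volume) hst fun y _ => h0 y]
  rw [integral_window_eq hv]
  have h1 : ∫ _t in (β - h)..β, ∫ y in α..q, v y ≤ ∫ t in (β - h)..β, ∫ y in α..t, v y :=
    intervalIntegral.integral_mono_on (by linarith) intervalIntegrable_const
      (hV.intervalIntegrable _ _) fun t ht => hmono q t (hq.trans ht.1)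
  have h2 : ∫ t in α..(α + h), ∫ y in α..t, v y ≤ ∫ _t in α..(α + h), ∫ y in α..p, v y :=
    intervalIntegral.integral_mono_on (by linarith) (hV.intervalIntegrable _ _)
      intervalIntegrable_const fun t ht => hmono t p (ht.2.trans hp)
  have h3 : ∫ t in p..q, v t = (∫ t in α..q, v t) - ∫ t in α..p, v t :=
    (intervalIntegral.integral_interval_sub_left (hi _ _) (hi _ _)).symm
  rw [intervalIntegral.integral_const, smul_eq_mul] at h1 h2
  rw [h3]
  linarith

theorem abs_integral_eq_of_ne_zero {u : ℝ → ℝ} (hu : Continuous u) {s t : ℝ} (hst : s ≤ t)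
    (h : ∀ y ∈ Set.Icc s t, u y ≠ 0) : |∫ y in s..t, u y| = ∫ y in s..t, |u y| := by
  have key : ∀ y ∈ Set.Icc s t, ∀ z ∈ Set.Icc s t, 0 ≤ u y → 0 ≤ u z := by
    intro y hy z hz hyp
    by_contra hneg
    push Not at hneg
    obtain ⟨x, hx, hx0⟩ := intermediate_value_uIcc (a := z) (b := y) hu.continuousOn
      (Set.mem_uIcc.2 (Or.inl ⟨hneg.le, hyp⟩))
    exact h x (Set.uIcc_subset_Icc hz hy hx) hx0
  have hs : s ∈ Set.Icc s t := Set.left_mem_Icc.2 hst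
  by_cases h0 : 0 ≤ u s
  · rw [abs_of_nonneg (intervalIntegral.integral_nonneg hst fun y hy => key s hs y hy h0)]
    refine intervalIntegral.integral_congr fun y hy => ?_
    rw [Set.uIcc_of_le hst] at hy
    exact (abs_of_nonneg (key s hs y hy h0)).symm
  · have hn : ∀ y ∈ Set.Icc s t, u y ≤ 0 := fun y hy => by
      by_contra hc
      push Not at hc
      exact h0 (key y hy s hs hc.le)
    rw [← abs_neg, ← intervalIntegral.integral_neg, abs_of_nonneg
      (intervalIntegral.integral_nonneg hst fun y hy => neg_nonneg.2 (hn y hy))]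
    refine intervalIntegral.integral_congr fun y hy => ?_
    rw [Set.uIcc_of_le hst] at hy
    exact (abs_of_nonpos (hn y hy)).symm

theorem integral_sq_le_of_zeros {u : ℝ → ℝ} (hu : Continuous u) {t h T : ℝ} (hh : 0 ≤ h)
    (hT : 0 < T) (Z : Finset ℝ) (hZ : ∀ y ∈ Set.Icc t (t + h), u y = 0 → y ∈ Z) :
    ∫ y in t..(t + h), u y ^ 2 ≤ T * |∫ y in t..(t + h), u y| +
      T ^ 2 * h * ∑ z ∈ Z, (Set.Icc (z - h) z).indicator 1 t +
      (T ^ 2)⁻¹ * ∫ y in t..(t + h), u y ^ 4 := by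
  have hle : t ≤ t + h := by linarith
  have hi4 : IntervalIntegrable (fun y => u y ^ 4) volume t (t + h) :=
    (hu.pow 4).intervalIntegrable _ _
  have hi2 : IntervalIntegrable (fun y => u y ^ 2) volume t (t + h) :=
    (hu.pow 2).intervalIntegrable _ _
  have hind : ∀ z : ℝ, (0 : ℝ) ≤ (Set.Icc (z - h) z).indicator 1 t := fun z =>
    Set.indicator_nonneg (fun _ _ => zero_le_one) t
  have hsum : (0 : ℝ) ≤ ∑ z ∈ Z, (Set.Icc (z - h) z).indicator 1 t :=
    Finset.sum_nonneg fun z _ => hind z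
  have hpt : ∀ y, u y ^ 2 ≤ T ^ 2 + (T ^ 2)⁻¹ * u y ^ 4 := fun y => by
    rw [← sub_nonneg]
    have : T ^ 2 + (T ^ 2)⁻¹ * u y ^ 4 - u y ^ 2 =
        (T ^ 2)⁻¹ * ((u y ^ 2 - T ^ 2 / 2) ^ 2 + 3 / 4 * T ^ 4) := by field_simp; ring
    rw [this]
    positivity
  have hpt' : ∀ y, u y ^ 2 ≤ T * |u y| + (T ^ 2)⁻¹ * u y ^ 4 := fun y => by
    rw [inv_mul_eq_div]
    rcases le_total (|u y|) T with hc | hc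
    · have : u y ^ 2 ≤ T * |u y| := by
        rw [← sq_abs, sq]
        exact mul_le_mul_of_nonneg_right hc (abs_nonneg _)
      have : 0 ≤ u y ^ 4 / T ^ 2 := by positivity
      linarith
    · have : u y ^ 2 ≤ u y ^ 4 / T ^ 2 := by
        rw [le_div_iff₀ (by positivity)]
        have := pow_le_pow_left₀ hT.le hc 2
        rw [sq_abs] at this
        calc u y ^ 2 * T ^ 2 ≤ u y ^ 2 * u y ^ 2 := by gcongr
          _ = u y ^ 4 := by ring
      have : 0 ≤ T * |u y| := by positivity
      linarith
  by_cases hz : ∃ z ∈ Set.Icc t (t + h), u z = 0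
  · obtain ⟨z, hz, hz0⟩ := hz
    have h1 : (1 : ℝ) ≤ ∑ z ∈ Z, (Set.Icc (z - h) z).indicator 1 t := by
      refine le_trans ?_ (Finset.single_le_sum (fun z _ => hind z) (hZ z hz hz0))
      rw [Set.indicator_of_mem (by constructor <;> linarith [hz.1, hz.2])]
      rfl
    have h2 := intervalIntegral.integral_mono_on hle hi2
      (intervalIntegrable_const.add (hi4.const_mul _)) fun y _ => hpt y
    rw [intervalIntegral.integral_add intervalIntegrable_const (hi4.const_mul _),
      intervalIntegral.integral_const, intervalIntegral.integral_const_mul, smul_eq_mul] at h2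
    have h3 : T ^ 2 * h * 1 ≤ T ^ 2 * h * ∑ z ∈ Z, (Set.Icc (z - h) z).indicator 1 t := by gcongr
    have h4 : 0 ≤ T * |∫ y in t..(t + h), u y| := by positivity
    linarith
  · push Not at hz
    rw [abs_integral_eq_of_ne_zero hu hle hz]
    have hi1 : IntervalIntegrable (fun y => T * |u y|) volume t (t + h) :=
      (continuous_const.mul hu.abs).intervalIntegrable _ _
    have h2 := intervalIntegral.integral_mono_on hle hi2
      (hi1.add (hi4.const_mul _)) fun y _ => hpt' y
    rw [intervalIntegral.integral_add hi1 (hi4.const_mul _),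
      intervalIntegral.integral_const_mul, intervalIntegral.integral_const_mul] at h2
    have h3 : 0 ≤ T ^ 2 * h * ∑ z ∈ Z, (Set.Icc (z - h) z).indicator 1 t := by positivity
    linarith

theorem integral_sum_indicator_le (Z : Finset ℝ) {h a b : ℝ} (hh : 0 ≤ h) (hab : a ≤ b) :
    IntervalIntegrable (fun t => ∑ z ∈ Z, (Set.Icc (z - h) z).indicator (1 : ℝ → ℝ) t)
      volume a b ∧
    ∫ t in a..b, ∑ z ∈ Z, (Set.Icc (z - h) z).indicator (1 : ℝ → ℝ) t ≤ Z.card * h := by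
  have hInt_aux : ∀ z : ℝ, Integrable ((Set.Icc (z - h) z).indicator (1 : ℝ → ℝ)) := fun z =>
    (integrable_indicator_iff measurableSet_Icc).2
      (integrableOn_const (by simp) (by simp))
  have hs : Integrable fun t => ∑ z ∈ Z, (Set.Icc (z - h) z).indicator (1 : ℝ → ℝ) t :=
    integrable_finsetSum _ fun z _ => hInt_aux z
  refine ⟨hs.intervalIntegrable, ?_⟩
  rw [intervalIntegral.integral_of_le hab]
  refine (setIntegral_le_integral hs (ae_of_all _ fun t => Finset.sum_nonneg fun z _ =>
    Set.indicator_nonneg (fun _ _ => zero_le_one) t)).trans ?_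
  rw [integral_finsetSum _ fun z _ => hInt_aux z]
  refine (Finset.sum_le_card_nsmul _ _ h fun z _ => ?_).trans (by simp)
  rw [integral_indicator_one measurableSet_Icc]
  simp [hh]

theorem le_card_of_zeros {u : ℝ → ℝ} (hu : Continuous u) {α β p q h κ Q η w : ℝ} (hh : 0 < h)
    (hp : α + h ≤ p) (hpq : p ≤ q) (hq : q ≤ β - h) (hαβ : α < β) (hκ : 0 < κ) (hQ : 0 < Q)
    (hw : 0 < w) (hη : 16 * Q * (β - α) * η ≤ κ ^ 3)
    (h2 : κ * w ≤ ∫ t in p..q, u t ^ 2) (h4 : ∫ t in α..β, u t ^ 4 ≤ Q * w ^ 2)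
    (hwin : ∫ t in α..(β - h), (∫ y in t..(t + h), u y) ^ 2 ≤ η * h ^ 2 * w)
    (Z : Finset ℝ) (hZ : ∀ y ∈ Set.Icc α β, u y = 0 → y ∈ Z) :
    κ ^ 2 / (16 * Q * h) ≤ Z.card := by
  set T := √(4 * Q * w / κ) with hTdef
  have hTsq : T ^ 2 = 4 * Q * w / κ := Real.sq_sqrt (by positivity)
  have hT : 0 < T := Real.sqrt_pos.2 (by positivity)
  have hl : 0 < β - α := by linarith
  set ε := κ / (4 * (β - α)) with hε
  have hε0 : 0 < ε := by positivity
  have hle : α ≤ β - h := by linarith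
  have hprim : ∀ {v : ℝ → ℝ}, Continuous v → Continuous fun t => ∫ y in t..(t + h), v y := by
    intro v hv
    have hi : ∀ a b, IntervalIntegrable v volume a b := fun a b => hv.intervalIntegrable a b
    have hV : Continuous fun t => ∫ y in (0 : ℝ)..t, v y :=
      intervalIntegral.continuous_primitive hi 0
    have e : (fun t => ∫ y in t..(t + h), v y) =
        fun t => (∫ y in (0 : ℝ)..(t + h), v y) - ∫ y in (0 : ℝ)..t, v y := by
      ext t
      exact (intervalIntegral.integral_interval_sub_left (hi _ _) (hi _ _)).symm
    rw [e]
    exact (hV.comp (continuous_add_const h)).sub hV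
  obtain ⟨hIi, hIle⟩ := integral_sum_indicator_le Z hh.le hle
  have hG : IntervalIntegrable (fun t => (∫ y in t..(t + h), u y) ^ 2) volume α (β - h) :=
    ((hprim hu).pow 2).intervalIntegrable _ _
  have h4i : IntervalIntegrable (fun t => ∫ y in t..(t + h), u y ^ 4) volume α (β - h) :=
    (hprim (hu.pow 4)).intervalIntegrable _ _
  have hpt : ∀ t ∈ Set.Icc α (β - h), ∫ y in t..(t + h), u y ^ 2 ≤
      ((ε * h * w + T ^ 2 / (4 * ε * h * w) * (∫ y in t..(t + h), u y) ^ 2) +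
      T ^ 2 * h * ∑ z ∈ Z, (Set.Icc (z - h) z).indicator 1 t) +
      (T ^ 2)⁻¹ * ∫ y in t..(t + h), u y ^ 4 := by
    intro t ht
    refine (integral_sq_le_of_zeros hu hh.le hT Z fun y hy => hZ y
      ⟨ht.1.trans hy.1, by linarith [hy.2, ht.2]⟩).trans ?_
    gcongr
    set G := ∫ y in t..(t + h), u y
    have hpos : 0 < ε * h * w := by positivity
    have e : ε * h * w + T ^ 2 / (4 * ε * h * w) * G ^ 2 - T * |G| =
        (2 * (ε * h * w) - T * |G|) ^ 2 / (4 * (ε * h * w)) := by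
      rw [← sq_abs G]
      field_simp
      ring
    have : 0 ≤ (2 * (ε * h * w) - T * |G|) ^ 2 / (4 * (ε * h * w)) := by positivity
    linarith
  have hInt_aux := intervalIntegral.integral_mono_on hle
    ((hprim (v := fun y => u y ^ 2) (hu.pow 2)).intervalIntegrable α (β - h))
    (((intervalIntegrable_const.add (hG.const_mul _)).add (hIi.const_mul _)).add
      (h4i.const_mul _)) hpt
  rw [intervalIntegral.integral_add
      ((intervalIntegrable_const.add (hG.const_mul _)).add (hIi.const_mul _)) (h4i.const_mul _),
    intervalIntegral.integral_add (intervalIntegrable_const.add (hG.const_mul _))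
      (hIi.const_mul _),
    intervalIntegral.integral_add intervalIntegrable_const (hG.const_mul _),
    intervalIntegral.integral_const, smul_eq_mul, intervalIntegral.integral_const_mul,
    intervalIntegral.integral_const_mul, intervalIntegral.integral_const_mul] at hInt_aux
  have hlow := le_integral_window (v := fun t => u t ^ 2) (hu.pow 2) (fun t => by positivity)
    hh.le hp hq
  have hup := integral_window_le (v := fun t => u t ^ 4) (hu.pow 4) (fun t => by positivity)
    (α := α) (β := β) hh.le
  have i1 : h * (κ * w) ≤ h * ∫ t in p..q, u t ^ 2 := by gcongr
  have i2 : (β - h - α) * (ε * h * w) ≤ κ / 4 * (h * w) := by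
    calc (β - h - α) * (ε * h * w) ≤ (β - α) * (ε * h * w) := by gcongr; linarith
      _ = _ := by rw [hε]; field_simp
  have i3 : T ^ 2 / (4 * ε * h * w) * ∫ t in α..(β - h), (∫ y in t..(t + h), u y) ^ 2 ≤
      κ / 4 * (h * w) := by
    calc _ ≤ T ^ 2 / (4 * ε * h * w) * (η * h ^ 2 * w) := by gcongr
      _ = (16 * Q * (β - α) * η) * (h * w) / (4 * κ ^ 2) := by
          rw [hTsq, hε]; field_simp; ring
      _ ≤ κ ^ 3 * (h * w) / (4 * κ ^ 2) := by gcongr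
      _ = _ := by field_simp
  have i4 : T ^ 2 * h * ∫ t in α..(β - h), ∑ z ∈ Z, (Set.Icc (z - h) z).indicator (1 : ℝ → ℝ) t ≤
      (4 * Q * h * Z.card / κ) * (h * w) := by
    calc _ ≤ T ^ 2 * h * (Z.card * h) := by gcongr
      _ = _ := by rw [hTsq]; ring
  have i5 : (T ^ 2)⁻¹ * ∫ t in α..(β - h), ∫ y in t..(t + h), u y ^ 4 ≤ κ / 4 * (h * w) := by
    calc _ ≤ (T ^ 2)⁻¹ * (h * (Q * w ^ 2)) := by
          gcongr
          exact hup.trans (by gcongr)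
      _ = _ := by rw [hTsq]; field_simp
  have hfin : κ / 4 * (h * w) ≤ (4 * Q * h * Z.card / κ) * (h * w) := by
    linarith
  have := le_of_mul_le_mul_right hfin (by positivity)
  rw [le_div_iff₀ hκ] at this
  rw [div_le_iff₀ (by positivity)]
  linarith

theorem exists_mul_card_Elat_pow_le (s : ℕ) {A : ℝ} (hA : 0 < A) : ∃ lam₀ : ℝ, 0 < lam₀ ∧
    ∀ lam, lam₀ ≤ lam → (Elat lam).Nonempty → A * ((Elat lam).card : ℝ) ^ s ≤ lam := by
  obtain ⟨C, hC, h⟩ := exists_card_Elat_pow_le (s * 4)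
  refine ⟨1 + A ^ 4 * C, by positivity, ?_⟩
  intro lam hl hne
  have hp : 0 < A ^ 4 * C := by positivity
  have hl1 : 1 ≤ lam := by linarith
  have h1 := (h lam (by linarith)).resolve_right hne.ne_empty
  rw [pow_mul] at h1
  refine le_of_pow_le_pow_left₀ four_ne_zero (by linarith) ?_
  calc (A * ((Elat lam).card : ℝ) ^ s) ^ 4 = A ^ 4 * (((Elat lam).card : ℝ) ^ s) ^ 4 := by ring
    _ ≤ A ^ 4 * (C * lam ^ 2) := by gcongr
    _ = A ^ 4 * C * lam ^ 2 := by ring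
    _ ≤ lam ^ 2 * lam ^ 2 := by
        gcongr
        nlinarith
    _ = lam ^ 4 := by ring

theorem neg_mem_Elat {lam : ℝ} (hl : 0 ≤ lam) {μ : ℤ × ℤ} (h : μ ∈ Elat lam) : -μ ∈ Elat lam := by
  rw [mem_Elat hl] at h ⊢
  simpa using h

theorem ofReal_re_efn {lam : ℝ} (hl : 0 ≤ lam) {a : ℤ × ℤ → ℂ}
    (ha : ∀ μ : ℤ × ℤ, a (-μ) = starRingEnd ℂ (a μ)) (x : ℝ × ℝ) :
    ((efn lam a x).re : ℂ) = efn lam a x := by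
  refine Complex.conj_eq_iff_re.1 ?_
  unfold efn
  rw [map_sum]
  refine Finset.sum_nbij' (fun μ => -μ) (fun μ => -μ) (fun μ hμ => neg_mem_Elat hl hμ)
    (fun μ hμ => neg_mem_Elat hl hμ) (by simp) (by simp) fun μ _ => ?_
  rw [map_mul, ← ha, ← Complex.exp_conj, map_mul, Complex.conj_I, Complex.conj_ofReal]
  congr 2
  push_cast [Prod.fst_neg, Prod.snd_neg]
  ring

theorem exists_window_parameters {c K l C₁ C₂ η : ℝ} (hc : 0 < c) (hK : 1 ≤ K) (hl : 0 < l)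
    (hC₁ : 0 < C₁) (hC₂ : 0 < C₂) (hη : 0 < η) : ∃ A₀ P : ℝ, 0 < A₀ ∧ 0 < P ∧ ∀ lam B M : ℝ,
      1 ≤ B → B ≤ M → P * M ^ 24 ≤ lam → ∃ D h θ : ℝ, 1 ≤ D ∧ 8 * D ^ 3 ≤ 2 * lam ∧
      2 * D ≤ √lam ∧ M ^ 2 ≤ √D ∧ C₁ * M ≤ √D ∧ 0 < h ∧ h ≤ l / 4 ∧ 0 < θ ∧ 2 * K * h ≤ θ ∧
      θ ≤ c ∧ C₂ * (θ + 1 / (θ * (lam * h)) ^ 2 + (1 + lam * h) * M / √D) ≤ η / B ∧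
      lam * h = A₀ * √B ^ 3 := by
  obtain ⟨τ, hτ⟩ : ∃ τ, τ = η / (3 * C₂) := ⟨_, rfl⟩
  have hτ0 : 0 < τ := by rw [hτ]; positivity
  obtain ⟨θ, hθ⟩ : ∃ θ, θ = min c τ := ⟨_, rfl⟩
  have hθ0 : 0 < θ := by rw [hθ]; exact lt_min hc hτ0
  obtain ⟨A₀, hA₀⟩ : ∃ A₀, A₀ = 1 / (θ * √τ) := ⟨_, rfl⟩
  have hA₀0 : 0 < A₀ := by rw [hA₀]; positivity
  have hAτ : 0 < (1 + A₀) / τ := by positivity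
  obtain ⟨C₃, hC₃⟩ : ∃ C₃, C₃ = 1 + C₁ + (1 + A₀) / τ := ⟨_, rfl⟩
  have hC₃1 : 1 ≤ C₃ := by linarith
  have hC₃0 : 0 < C₃ := by linarith
  refine ⟨A₀, 4 * C₃ ^ 6 + 4 * A₀ / l + 2 * K * A₀ / θ, hA₀0, by positivity, ?_⟩
  intro lam B M hB1 hBM hcd
  have hB0 : 0 < B := by linarith
  have hM1 : 1 ≤ M := hB1.trans hBM
  have hM0 : 0 < M := by linarith
  obtain ⟨b, hb⟩ : ∃ b, b = √B := ⟨_, rfl⟩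
  rw [← hb]
  have hb1 : 1 ≤ b := by rw [hb]; exact Real.one_le_sqrt.2 hB1
  have hb0 : 0 < b := by linarith
  have hbsq : b ^ 2 = B := by rw [hb]; exact Real.sq_sqrt hB0.le
  have hb3M : b ^ 3 ≤ M ^ 2 := by
    calc b ^ 3 ≤ b ^ 4 := pow_le_pow_right₀ hb1 (by norm_num)
      _ = B ^ 2 := by rw [← hbsq]; ring
      _ ≤ M ^ 2 := by gcongr
  have hMp : ∀ n : ℕ, n ≤ 24 → M ^ n ≤ M ^ 24 := fun n hn => pow_le_pow_right₀ hM1 hn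
  have q1 : 0 ≤ 4 * C₃ ^ 6 * M ^ 24 := by positivity
  have q2 : 0 < 4 * A₀ / l * M ^ 24 := by positivity
  have q3 : 0 < 2 * K * A₀ / θ * M ^ 24 := by positivity
  rw [add_mul, add_mul] at hcd
  have hlpos : 0 < lam := by linarith
  obtain ⟨D, hD⟩ : ∃ D, D = (C₃ * M ^ 4) ^ 2 := ⟨_, rfl⟩
  have hDs : √D = C₃ * M ^ 4 := by rw [hD]; exact Real.sqrt_sq (by positivity)
  have hD1 : 1 ≤ D := by
    rw [hD]
    exact one_le_pow₀ (one_le_mul_of_one_le_of_one_le hC₃1 (one_le_pow₀ hM1))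
  have hD3 : D ^ 3 = C₃ ^ 6 * M ^ 24 := by rw [hD]; ring
  obtain ⟨h, hh⟩ : ∃ h, h = A₀ * b ^ 3 / lam := ⟨_, rfl⟩
  have hlh : lam * h = A₀ * b ^ 3 := by rw [hh]; field_simp
  refine ⟨D, h, θ / B, hD1, by linarith, ?_, ?_, ?_, by rw [hh]; positivity, ?_, by positivity,
    ?_, ?_, ?_, hlh⟩
  · refine Real.le_sqrt_of_sq_le ?_
    have : D ^ 2 ≤ D ^ 3 := pow_le_pow_right₀ hD1 (by norm_num)
    linarith
  · rw [hDs]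
    have h1 : M ^ 2 ≤ M ^ 4 := pow_le_pow_right₀ hM1 (by norm_num)
    exact h1.trans (le_mul_of_one_le_left (by positivity) hC₃1)
  · rw [hDs]
    have h1 : M ≤ M ^ 4 := le_self_pow₀ hM1 (by norm_num)
    have h2 : C₁ ≤ C₃ := by linarith
    exact mul_le_mul h2 h1 hM0.le hC₃0.le
  · rw [hh, div_le_iff₀ hlpos]
    have h1 : 4 * A₀ / l * b ^ 3 ≤ 4 * A₀ / l * M ^ 24 :=
      mul_le_mul_of_nonneg_left (hb3M.trans (hMp 2 (by norm_num))) (by positivity)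
    have h2 : 4 * A₀ / l * b ^ 3 ≤ lam := by linarith
    rw [div_mul_eq_mul_div, div_le_iff₀ hl] at h2
    linarith
  · rw [le_div_iff₀ hB0, hh]
    have h0 : b ^ 3 * B ≤ M ^ 24 := by
      calc b ^ 3 * B ≤ M ^ 2 * M := mul_le_mul hb3M hBM hB0.le (by positivity)
        _ = M ^ 3 := by ring
        _ ≤ _ := hMp 3 (by norm_num)
    have h1 : 2 * K * A₀ / θ * (b ^ 3 * B) ≤ 2 * K * A₀ / θ * M ^ 24 :=
      mul_le_mul_of_nonneg_left h0 (by positivity)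
    have h2 : 2 * K * A₀ / θ * (b ^ 3 * B) ≤ lam := by linarith
    rw [div_mul_eq_mul_div, div_le_iff₀ hθ0] at h2
    rw [mul_div_assoc', div_mul_eq_mul_div, div_le_iff₀ hlpos]
    linarith
  · exact (div_le_self hθ0.le hB1).trans (hθ ▸ min_le_left _ _)
  · have t1 : θ / B ≤ τ / B := div_le_div_of_nonneg_right (hθ ▸ min_le_right _ _) hB0.le
    have t2 : 1 / (θ / B * (lam * h)) ^ 2 ≤ τ / B := by
      have hs : √τ ^ 2 = τ := Real.sq_sqrt hτ0.le
      have e : (θ / B * (lam * h)) ^ 2 = B / τ := by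
        have e1 : θ * A₀ = 1 / √τ := by rw [hA₀]; field_simp
        have e2 : (θ / B * (lam * h)) ^ 2 = (θ * A₀) ^ 2 * (b ^ 2) ^ 3 / B ^ 2 := by
          rw [hlh]; ring
        rw [e2, e1, hbsq, div_pow, hs]
        field_simp
      rw [e, one_div_div]
    have t3 : (1 + lam * h) * M / √D ≤ τ / B := by
      rw [hlh, hDs, div_le_div_iff₀ (by positivity) hB0]
      have h1 : (1 + A₀) / τ ≤ C₃ := by linarith
      rw [div_le_iff₀ hτ0] at h1
      have h2 : 1 + A₀ * b ^ 3 ≤ (1 + A₀) * M ^ 2 := by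
        have h3 : 1 ≤ M ^ 2 := one_le_pow₀ hM1
        have h4 : A₀ * b ^ 3 ≤ A₀ * M ^ 2 := mul_le_mul_of_nonneg_left hb3M hA₀0.le
        linarith
      calc (1 + A₀ * b ^ 3) * M * B ≤ ((1 + A₀) * M ^ 2) * M * M := by gcongr
        _ = (1 + A₀) * M ^ 4 := by ring
        _ ≤ (C₃ * τ) * M ^ 4 := by gcongr
        _ = _ := by ring
    calc _ ≤ C₂ * (τ / B + τ / B + τ / B) := by gcongr
      _ = _ := by rw [hτ]; field_simp; ring

theorem IsCurvedArc.exists_le_card_zeros {γ : ℝ → ℝ × ℝ} {α β c K : ℝ}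
    (A : IsCurvedArc γ α β c K) : ∃ c₀ : ℝ, 0 < c₀ ∧ ∃ lam₀ : ℝ, 0 < lam₀ ∧ ∀ lam, lam₀ ≤ lam →
      ∀ a : ℤ × ℤ → ℂ, (∀ μ : ℤ × ℤ, a (-μ) = starRingEnd ℂ (a μ)) →
      (∃ μ ∈ Elat lam, a μ ≠ 0) → ∀ Z : Finset ℝ,
      (∀ t ∈ Set.Icc α β, efn lam a (γ t) = 0 → t ∈ Z) →
      c₀ * lam / (Bmax lam : ℝ) ^ ((5 : ℝ) / 2) ≤ Z.card := by
  have hlt := A.lt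
  obtain ⟨l, hl_def⟩ : ∃ l, l = β - α := ⟨_, rfl⟩
  have hl : 0 < l := by linarith
  obtain ⟨κ, C₁, hκ, hC₁, hlow⟩ := A.exists_le_integral_normSq (p := α + l / 4) (q := β - l / 4)
    (by linarith) (by linarith) (by linarith)
  obtain ⟨C₂, hC₂, hwin⟩ := A.exists_integral_window_le
  obtain ⟨C₄, hC₄, hfour⟩ := A.exists_integral_pow_four_le
  obtain ⟨A₀, P, hA₀, hP, hpar⟩ := exists_window_parameters (η := κ ^ 3 / (16 * C₄ * l)) A.c_pos
    A.one_le hl hC₁ hC₂ (by positivity)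
  obtain ⟨lam₀, hlam₀, hcard⟩ := exists_mul_card_Elat_pow_le 24 hP
  refine ⟨κ ^ 2 / (16 * C₄ * A₀), by positivity, lam₀, hlam₀, ?_⟩
  intro lam hlam a ha hne Z hZ
  obtain ⟨μ₀, hμ₀, haμ₀⟩ := hne
  have hlpos : 0 < lam := by linarith
  have hB1 : (1 : ℝ) ≤ Bmax lam := by exact_mod_cast one_le_Bmax hlpos.le hμ₀
  obtain ⟨D, h, θ, hD1, hD3, hDl, hMD, hC₁D, hh0, hhl, hθ0, hKh, hθc, hsum, hlh⟩ :=
    hpar lam (Bmax lam) (Elat lam).card hB1 (by exact_mod_cast Bmax_le_card lam)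
      (hcard lam hlam ⟨μ₀, hμ₀⟩)
  have hB0 : (0 : ℝ) < Bmax lam := by linarith
  have hB52 : (Bmax lam : ℝ) ^ ((5 : ℝ) / 2) = Bmax lam * √(Bmax lam) ^ 3 := by
    rw [Real.sqrt_eq_rpow, ← Real.rpow_natCast ((Bmax lam : ℝ) ^ (1 / 2 : ℝ)),
      ← Real.rpow_mul hB0.le, ← Real.rpow_one_add' hB0.le (by norm_num)]
    norm_num
  have hw0 : 0 < ∑ μ ∈ Elat lam, ‖a μ‖ ^ 2 :=
    Finset.sum_pos' (fun _ _ => by positivity) ⟨μ₀, hμ₀, by positivity⟩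
  have H1 := hlow lam D hlpos.le hD1 hD3 hC₁D a
  have H2 := hwin lam D h θ hlpos hD1 hD3 hh0 (by linarith) hθ0 hKh hθc a
  have H4 := hfour lam D hlpos hD1 hD3 hDl hMD a
  obtain ⟨B, hB⟩ : ∃ B : ℝ, B = Bmax lam := ⟨_, rfl⟩
  obtain ⟨w, hw⟩ : ∃ w : ℝ, w = ∑ μ ∈ Elat lam, ‖a μ‖ ^ 2 := ⟨_, rfl⟩
  rw [← hB] at hB0 hB1 hsum hlh hB52 H4
  rw [← hw] at H1 H2 H4 hw0
  rw [← hB, hB52]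
  set u : ℝ → ℝ := fun t => (efn lam a (γ t)).re with hu
  have hue : ∀ t, efn lam a (γ t) = (u t : ℂ) := fun t => (ofReal_re_efn hlpos.le ha (γ t)).symm
  have hun : ∀ t, ‖efn lam a (γ t)‖ = |u t| := fun t => by
    rw [hue, Complex.norm_real, Real.norm_eq_abs]
  have huc : Continuous u := by
    refine Complex.continuous_re.comp ?_
    simp only [efn_eq_sum_osc]
    exact continuous_finsetSum _ fun μ _ =>
      continuous_const.mul (continuous_osc (continuous_phase A.smooth _))
  have hGn : ∀ t, ‖∫ y in t..(t + h), efn lam a (γ y)‖ ^ 2 = (∫ y in t..(t + h), u y) ^ 2 := by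
    intro t
    simp only [hue]
    rw [intervalIntegral.integral_ofReal, Complex.norm_real, Real.norm_eq_abs, sq_abs]
  simp only [hun, sq_abs] at H1
  simp only [hun, Even.pow_abs (show Even 4 by decide)] at H4
  simp only [hGn] at H2
  have hbound : C₂ * h ^ 2 * (θ + 1 / (θ * (lam * h)) ^ 2 + (1 + lam * h) *
      ((Elat lam).card : ℝ) / √D) * w ≤ κ ^ 3 / (16 * C₄ * l) / B * h ^ 2 * w := by
    have := mul_le_mul_of_nonneg_right hsum (by positivity : 0 ≤ h ^ 2 * w)
    linarith
  have main := le_card_of_zeros huc hh0 (p := α + l / 4) (q := β - l / 4) (by linarith)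
    (by linarith) (by linarith) hlt hκ (Q := C₄ * B) (by positivity) hw0
    (η := κ ^ 3 / (16 * C₄ * l) / B) (by rw [← hl_def]; exact le_of_eq (by field_simp)) H1 H4
    (H2.trans hbound) Z (fun y hy h0 => hZ y hy (by rw [hue, h0, Complex.ofReal_zero]))
  refine le_trans (le_of_eq ?_) main
  have hb : 0 < √B := Real.sqrt_pos.2 hB0
  have e : h = A₀ * √B ^ 3 / lam := by rw [eq_div_iff hlpos.ne']; linarith
  rw [e]
  field_simp

/-- Theorem 1.1: for a smooth curve with nowhere-zero curvature, the number of nodal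
intersections satisfies `N_{F,C} ≫ lam / B_lam^{5/2}`. -/
theorem nodal_intersections_lower_bound
    (L Kmin Kmax : ℝ) (γ : ℝ → ℝ × ℝ)
    (hL : 0 < L) (hKmin : 0 < Kmin)
    (hsmooth : ContDiff ℝ (⊤ : ℕ∞) γ)
    (hunit : ∀ t ∈ Set.Icc (0:ℝ) L, e2 (deriv γ t) = 1)
    (hcurv : ∀ t ∈ Set.Icc (0:ℝ) L,
      Kmin ≤ e2 (deriv (deriv γ) t) ∧ e2 (deriv (deriv γ) t) ≤ Kmax) :
    ∃ c > (0:ℝ), ∃ lam0 > (0:ℝ), ∀ lam : ℝ, lam0 ≤ lam →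
      ∀ a : ℤ × ℤ → ℂ,
        (∀ μ : ℤ × ℤ, a (-μ) = starRingEnd ℂ (a μ)) →
        (∃ μ ∈ Elat lam, a μ ≠ 0) →
        ∃ T : Finset (ℝ × ℝ),
          (↑T : Set (ℝ × ℝ)) ⊆ {x | efn lam a x = 0} ∩ (γ '' Set.Icc 0 L) ∧
          c * lam / (Bmax lam : ℝ) ^ ((5:ℝ)/2) ≤ T.card := by
  obtain ⟨α, β, c, K, hsub, A⟩ := exists_isCurvedArc L Kmin Kmax γ hL hKmin hsmooth hunit hcurv
  obtain ⟨c₀, hc₀, lam₀, hlam₀, hcount⟩ := A.exists_le_card_zeros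
  refine ⟨c₀, hc₀, lam₀, hlam₀, ?_⟩
  intro lam hlam a ha hne
  set s : Set ℝ := {t | t ∈ Set.Icc α β ∧ efn lam a (γ t) = 0} with hs
  obtain ⟨Z, hZs, hZ⟩ : ∃ Z : Finset ℝ, (↑Z : Set ℝ) ⊆ s ∧
      c₀ * lam / (Bmax lam : ℝ) ^ ((5:ℝ)/2) ≤ Z.card := by
    by_cases hfin : s.Finite
    · refine ⟨hfin.toFinset, by simp, ?_⟩
      exact hcount lam hlam a ha hne _ fun t ht h0 => hfin.mem_toFinset.2 ⟨ht, h0⟩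
    · obtain ⟨Z, hZs, hZc⟩ := Set.Infinite.exists_subset_card_eq hfin
        ⌈c₀ * lam / (Bmax lam : ℝ) ^ ((5:ℝ)/2)⌉₊
      exact ⟨Z, hZs, by rw [hZc]; exact Nat.le_ceil _⟩
  classical
  refine ⟨Z.image γ, ?_, ?_⟩
  · intro x hx
    obtain ⟨t, ht, rfl⟩ := Finset.mem_image.1 (Finset.mem_coe.1 hx)
    exact ⟨(hZs ht).2, t, hsub (hZs ht).1, rfl⟩
  · rwa [Finset.card_image_of_injOn (A.inj.mono fun t ht => (hZs ht).1)]
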